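/- For every planar graph G, dcol_4(G) ≤ 76, where dcol_4 is the distance-4 colouring number. -/

import Mathlib

open SimpleGraph

/-- The number of negative edges of a walk, where `σ e = true` means edge `e` is negative. -/
def negCount {V : Type} {G : SimpleGraph V} (σ : Sym2 V → Bool) {x y : V}
    (p : G.Walk x y) : ℕ :=
  (p.edges.filter (fun e => σ e)).length

/-- A walk is negative if it contains an odd number of negative edges. -/
def IsNegWalk {V : Type} {G : SimpleGraph V} (σ : Sym2 V → Bool) {x y : V}
    (p : G.Walk x y) : Prop :=
  Odd (negCount σ p)

/-- The exact-distance `-k` graph of the signed graph `(G, σ)`: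
`xy` is an edge iff `d_G(x,y) = k` and every `xy`-path of length `k` is negative. -/
def exactDistNeg {V : Type} (G : SimpleGraph V) (σ : Sym2 V → Bool) (k : ℕ) :
    SimpleGraph V :=
  SimpleGraph.fromRel (fun x y =>
    G.dist x y = k ∧ ∀ p : G.Walk x y, p.IsPath → p.length = k → IsNegWalk σ p)

/-- The strong exact-distance `-k` graph of the signed graph `(G, σ)`:
`xy` is an edge iff `d_G(x,y) = k` and some `xy`-path of length `k` is negative. -/
def strongExactDistNeg {V : Type} (G : SimpleGraph V) (σ : Sym2 V → Bool) (k : ℕ) :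
    SimpleGraph V :=
  SimpleGraph.fromRel (fun x y =>
    G.dist x y = k ∧ ∃ p : G.Walk x y, p.IsPath ∧ p.length = k ∧ IsNegWalk σ p)

/-- `WReach G L k y` : the set of vertices weakly `k`-reachable from `y` w.r.t. ordering `L`. -/
def WReach {V : Type} (G : SimpleGraph V) (L : LinearOrder V) (k : ℕ) (y : V) : Set V :=
  {x | ∃ p : G.Walk x y, p.IsPath ∧ p.length ≤ k ∧ ∀ z ∈ p.support, L.le x z}

/-- The weak `k`-colouring number of `G`. -/
noncomputable def wcol {V : Type} (G : SimpleGraph V) (k : ℕ) : ℕ :=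
  ⨅ L : LinearOrder V, ⨆ y : V, (WReach G L k y).ncard

/-- `DReach G L k y` : the set of vertices `x` such that there is an `xy`-path
`z_0, …, z_s` (`x = z_0`, `y = z_s`) of length `s ≤ k` on which `x` is the `L`-minimum
and `y ≤_L z_i` for all `⌊k/2⌋ + 1 ≤ i ≤ s`. -/
def DReach {V : Type} (G : SimpleGraph V) (L : LinearOrder V) (k : ℕ) (y : V) : Set V :=
  {x | ∃ p : G.Walk x y, p.IsPath ∧ p.length ≤ k ∧ (∀ z ∈ p.support, L.le x z) ∧
        ∀ i, k / 2 + 1 ≤ i → i ≤ p.length → L.le y (p.support.getD i y)}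

/-- The distance-`k`-colouring number of `G`. -/
noncomputable def dcol {V : Type} (G : SimpleGraph V) (k : ℕ) : ℕ :=
  ⨅ L : LinearOrder V, ⨆ y : V, (DReach G L k y).ncard

/-- `SReach G L k y` : the set of vertices strongly `k`-reachable from `y` w.r.t. `L`. -/
def SReach {V : Type} (G : SimpleGraph V) (L : LinearOrder V) (k : ℕ) (y : V) : Set V :=
  {x | ∃ p : G.Walk x y, p.IsPath ∧ p.length ≤ k ∧ (∀ z ∈ p.support, L.le x z) ∧
        ∀ z ∈ p.support, z ≠ x → L.le y z}

/-- The strong `k`-colouring number of `G`. -/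
noncomputable def scol {V : Type} (G : SimpleGraph V) (k : ℕ) : ℕ :=
  ⨅ L : LinearOrder V, ⨆ y : V, (SReach G L k y).ncard

/-- `H` is a minor of `G` (branch-set definition). -/
def IsMinor {W V : Type} (H : SimpleGraph W) (G : SimpleGraph V) : Prop :=
  ∃ B : W → Set V,
    (∀ w, (B w).Nonempty) ∧
    (∀ w, (G.induce (B w)).Connected) ∧
    (Pairwise (Function.onFun Disjoint B)) ∧
    ∀ w w', H.Adj w w' → ∃ u ∈ B w, ∃ v ∈ B w', G.Adj u v

/-- `G` is planar iff it has no `K₅` and no `K₃,₃` minor (Wagner's theorem). -/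
def IsPlanar {V : Type} (G : SimpleGraph V) : Prop :=
  ¬ IsMinor (completeGraph (Fin 5)) G ∧
  ¬ IsMinor (completeBipartiteGraph (Fin 3) (Fin 3)) G

/-- `G` is outerplanar iff it has no `K₄` and no `K₂,₃` minor. -/
def IsOuterplanar {V : Type} (G : SimpleGraph V) : Prop :=
  ¬ IsMinor (completeGraph (Fin 4)) G ∧
  ¬ IsMinor (completeBipartiteGraph (Fin 2) (Fin 3)) G

/-- `G` has treewidth at most `t` (tree-decomposition definition). -/
def HasTreewidthLE {V : Type} (G : SimpleGraph V) (t : ℕ) : Prop :=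
  ∃ (ι : Type) (T : SimpleGraph ι) (B : ι → Finset V),
    T.Connected ∧ T.IsAcyclic ∧
    (∀ v, ∃ i, v ∈ B i) ∧
    (∀ u v, G.Adj u v → ∃ i, u ∈ B i ∧ v ∈ B i) ∧
    (∀ v, (T.induce {i | v ∈ B i}).Connected) ∧
    (∀ i, (B i).card ≤ t + 1)

namespace PlanarDcol

variable {V : Type*}

/-- `u` and `v` are joined by a walk inside `S`. -/
def Linked (G : SimpleGraph V) (S : Set V) (u v : V) : Prop :=
  ∃ p : G.Walk u v, ∀ z ∈ p.support, z ∈ S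

/-- `S` is connected in `G`, or empty. -/
def ConnIn (G : SimpleGraph V) (S : Set V) : Prop :=
  ∀ u ∈ S, ∀ v ∈ S, Linked G S u v

/-- Some edge joins `A` to `B`. -/
def Touch (G : SimpleGraph V) (A B : Set V) : Prop :=
  ∃ a ∈ A, ∃ b ∈ B, G.Adj a b

/-- The component of `u` in `S`. -/
def comp (G : SimpleGraph V) (S : Set V) (u : V) : Set V :=
  {v | Linked G S u v}

variable {G : SimpleGraph V} {S T A B : Set V} {u v w : V}

theorem Touch.symm (h : Touch G A B) : Touch G B A := by
  obtain ⟨a, ha, b, hb, hab⟩ := h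
  exact ⟨b, hb, a, ha, hab.symm⟩

theorem Touch.mono {A' B' : Set V} (h : Touch G A B) (hA : A ⊆ A') (hB : B ⊆ B') :
    Touch G A' B' := by
  obtain ⟨a, ha, b, hb, hab⟩ := h
  exact ⟨a, hA ha, b, hB hb, hab⟩

theorem Linked.refl (h : u ∈ S) : Linked G S u u :=
  ⟨Walk.nil, by simpa using h⟩

theorem Linked.symm (h : Linked G S u v) : Linked G S v u := by
  obtain ⟨p, hp⟩ := h
  exact ⟨p.reverse, by simpa using hp⟩

theorem Linked.trans (h : Linked G S u v) (h' : Linked G S v w) : Linked G S u w := by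
  obtain ⟨p, hp⟩ := h
  obtain ⟨q, hq⟩ := h'
  refine ⟨p.append q, fun z hz => ?_⟩
  rw [Walk.mem_support_append_iff] at hz
  exact hz.elim (hp z) (hq z)

theorem Linked.mono (h : Linked G S u v) (hST : S ⊆ T) : Linked G T u v := by
  obtain ⟨p, hp⟩ := h
  exact ⟨p, fun z hz => hST (hp z hz)⟩

theorem Linked.of_adj (h : G.Adj u v) (hu : u ∈ S) (hv : v ∈ S) : Linked G S u v :=
  ⟨h.toWalk, by simp [hu, hv]⟩

theorem Linked.left_mem (h : Linked G S u v) : u ∈ S := by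
  obtain ⟨p, hp⟩ := h
  exact hp _ p.start_mem_support

theorem Linked.right_mem (h : Linked G S u v) : v ∈ S := h.symm.left_mem

/-- A linked pair on different sides of `A` yields an edge leaving `A`, the first one. -/
theorem Linked.exists_exit (h : Linked G S u v) (hu : u ∈ A) (hv : v ∉ A) :
    ∃ a b, Linked G (S ∩ A) u a ∧ G.Adj a b ∧ b ∈ S ∧ b ∉ A ∧ Linked G S b v := by
  obtain ⟨p, hp⟩ := h
  induction p with
  | nil => exact absurd hu hv
  | @cons x y z hxy q ih =>
    have hx : x ∈ S := hp _ (by simp)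
    have hq : ∀ t ∈ q.support, t ∈ S := fun t ht => hp t (by simp [ht])
    by_cases hy : y ∈ A
    · obtain ⟨a, b, h1, h2⟩ := ih hy hv hq
      refine ⟨a, b, Linked.trans (Linked.of_adj hxy ?_ ?_) h1, h2⟩
      exacts [⟨hx, hu⟩, ⟨hq _ q.start_mem_support, hy⟩]
    · exact ⟨x, y, Linked.refl ⟨hx, hu⟩, hxy, hq _ q.start_mem_support, hy, q, hq⟩

theorem Linked.mem_of_closed (h : Linked G S u v) (hu : u ∈ A)
    (hA : ∀ a ∈ A, ∀ b ∈ S, G.Adj a b → b ∈ A) : v ∈ A := by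
  by_contra hv
  obtain ⟨a, b, h1, h2, h3, h4, -⟩ := h.exists_exit hu hv
  exact h4 (hA a h1.right_mem.2 b h3 h2)

theorem ConnIn.exists_exit (h : ConnIn G S) (hu : u ∈ S) (hv : v ∈ S) (huA : u ∈ A)
    (hvA : v ∉ A) : ∃ a ∈ S ∩ A, ∃ b ∈ S, b ∉ A ∧ G.Adj a b := by
  obtain ⟨a, b, h1, h2, h3, h4, -⟩ := (h u hu v hv).exists_exit huA hvA
  exact ⟨a, h1.right_mem, b, h3, h4, h2⟩

theorem comp_subset : comp G S u ⊆ S := fun _ h => h.right_mem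

theorem mem_comp_self (h : u ∈ S) : u ∈ comp G S u := Linked.refl h

theorem comp_closed {a b : V} (ha : a ∈ comp G S u) (hb : b ∈ S) (hab : G.Adj a b) :
    b ∈ comp G S u :=
  Linked.trans ha (Linked.of_adj hab (comp_subset ha) hb)

theorem Linked.in_comp (h : Linked G S u v) : Linked G (comp G S u) u v := by
  classical
  obtain ⟨p, hp⟩ := h
  refine ⟨p, fun z hz => ⟨p.takeUntil z hz, fun t ht => hp t ?_⟩⟩
  exact p.support_takeUntil_subset_support hz ht

theorem connIn_comp : ConnIn G (comp G S u) := fun _ ha _ hb =>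
  (Linked.in_comp ha).symm.trans (Linked.in_comp hb)

theorem ConnIn.subset_comp (h : ConnIn G T) (hu : u ∈ T) (hTS : T ⊆ S) : T ⊆ comp G S u :=
  fun v hv => (h u hu v hv).mono hTS

theorem comp_eq_of_mem (h : v ∈ comp G S u) : comp G S v = comp G S u := by
  ext w
  exact ⟨fun hw => Linked.trans h hw, fun hw => (Linked.symm h).trans hw⟩

theorem ConnIn.union (hS : ConnIn G S) (hT : ConnIn G T) (h : Touch G S T) :
    ConnIn G (S ∪ T) := by
  obtain ⟨a, ha, b, hb, hab⟩ := h
  have key : ∀ u ∈ S ∪ T, Linked G (S ∪ T) u a := by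
    rintro u (hu | hu)
    · exact (hS u hu a ha).mono Set.subset_union_left
    · exact ((hT u hu b hb).mono Set.subset_union_right).trans
        (Linked.of_adj hab.symm (Or.inr hb) (Or.inl ha))
  exact fun u hu v hv => (key u hu).trans (key v hv).symm

theorem ConnIn.union_of_mem (hS : ConnIn G S) (hT : ConnIn G T) (ha : u ∈ S) (hb : u ∈ T) :
    ConnIn G (S ∪ T) := by
  have key : ∀ x ∈ S ∪ T, Linked G (S ∪ T) x u := by
    rintro x (hx | hx)
    · exact (hS x hx u ha).mono Set.subset_union_left
    · exact (hT x hx u hb).mono Set.subset_union_right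
  exact fun x hx y hy => (key x hx).trans (key y hy).symm

theorem connIn_singleton : ConnIn G {u} := by
  rintro x rfl y rfl
  exact Linked.refl rfl

theorem ConnIn.insert (hS : ConnIn G S) (hu : u ∈ S) (huv : G.Adj u v) :
    ConnIn G (insert v S) := by
  have := hS.union (connIn_singleton (u := v)) ⟨u, hu, v, rfl, huv⟩
  rwa [Set.union_singleton] at this

theorem connIn_support (p : G.Walk u v) : ConnIn G {z | z ∈ p.support} := by
  classical
  have key : ∀ x ∈ p.support, Linked G {z | z ∈ p.support} u x := fun x hx =>
    ⟨p.takeUntil x hx, fun t ht => p.support_takeUntil_subset_support hx ht⟩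
  exact fun x hx y hy => (key x hx).symm.trans (key y hy)

theorem ConnIn.induce_connected (h : ConnIn G S) (hS : S.Nonempty) :
    (G.induce S).Connected := by
  rw [SimpleGraph.connected_iff]
  refine ⟨?_, hS.to_subtype⟩
  rintro ⟨a, ha⟩ ⟨b, hb⟩
  obtain ⟨p, hp⟩ := h a ha b hb
  exact ⟨p.induce S hp⟩

end PlanarDcol

namespace PlanarDcol

variable {W : Type*}

/-- `T` is the set of triangles of a simplicial complex on `Γ` that behaves like a
triangulated sphere over `ZMod 2`: every edge lies in no or in two triangles, and every
`1`-cocycle is a coboundary. -/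
structure IsSphere [DecidableEq W] (Γ : SimpleGraph W) (T : Finset (Finset W)) : Prop where
  triangle : ∀ t ∈ T, ∃ a b c, Γ.Adj a b ∧ Γ.Adj b c ∧ Γ.Adj a c ∧ t = {a, b, c}
  edge : ∀ a b, Γ.Adj a b →
    (T.filter fun t => a ∈ t ∧ b ∈ t).card = 0 ∨ (T.filter fun t => a ∈ t ∧ b ∈ t).card = 2
  coboundary : ∀ φ : Sym2 W → ZMod 2,
    (∀ a b c, Γ.Adj a b → Γ.Adj b c → Γ.Adj a c → {a, b, c} ∈ T →
      φ s(a, b) + φ s(b, c) + φ s(a, c) = 0) →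
    ∃ U : W → ZMod 2, ∀ a b, Γ.Adj a b → φ s(a, b) = U a + U b

open Classical in
/-- The triangles meeting each of `X`, `Y`, `Z`. -/
noncomputable def triTri (T : Finset (Finset W)) (X Y Z : Set W) : Finset (Finset W) :=
  T.filter fun t => (∃ x ∈ t, x ∈ X) ∧ (∃ y ∈ t, y ∈ Y) ∧ ∃ z ∈ t, z ∈ Z

theorem exists_closed_coloring [Finite W] (Γ : SimpleGraph W) (n : ℕ) :
    ∀ c : W → Option (Fin 3), {v | c v = none}.ncard = n →
    (∀ i, ConnIn Γ {v | c v = some i}) →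
    ∃ c' : W → Option (Fin 3), (∀ v i, c v = some i → c' v = some i) ∧
      (∀ i, ConnIn Γ {v | c' v = some i}) ∧ ∀ u v, Γ.Adj u v → c' u ≠ none → c' v ≠ none := by
  classical
  induction n using Nat.strong_induction_on with
  | _ n ih =>
    intro c hn hc
    by_cases h : ∀ u v, Γ.Adj u v → c u ≠ none → c v ≠ none
    · exact ⟨c, fun _ _ h => h, hc, h⟩
    push Not at h
    obtain ⟨u, v, huv, hu, hv⟩ := h
    obtain ⟨j, hj⟩ := Option.ne_none_iff_exists'.1 hu
    have hlt : {w | Function.update c v (some j) w = none}.ncard < n := by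
      rw [← hn]
      refine Set.ncard_lt_ncard ⟨?_, ?_⟩ (Set.toFinite _)
      · intro w hw
        by_cases hwv : w = v
        · subst hwv; exact hv
        · simpa [Function.update_of_ne hwv] using hw
      · intro hsub
        have := hsub (show v ∈ {w | c w = none} from hv)
        simp at this
    obtain ⟨c', h1, h2, h3⟩ := ih _ hlt (Function.update c v (some j)) rfl (by
      intro i
      by_cases hij : i = j
      · subst hij
        have : {w | Function.update c v (some i) w = some i} = insert v {w | c w = some i} := by
          ext w
          by_cases hwv : w = v
          · subst hwv; simp
          · simp [hwv]
        rw [this]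
        exact (hc i).insert hj huv
      · have : {w | Function.update c v (some j) w = some i} = {w | c w = some i} := by
          ext w
          by_cases hwv : w = v
          · subst hwv; simp [hv, Ne.symm hij]
          · simp [hwv]
        rw [this]
        exact hc i)
    refine ⟨c', fun w i hw => h1 w i ?_, h2, h3⟩
    have : w ≠ v := by rintro rfl; rw [hv] at hw; simp at hw
    simpa [this] using hw

/-- Extension by zero from a finite set of pairs. -/
def extendZero [DecidableEq W] (E : Finset (Sym2 W)) :
    (E → ZMod 2) →ₗ[ZMod 2] (Sym2 W → ZMod 2) where
  toFun f e := if h : e ∈ E then f ⟨e, h⟩ else 0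
  map_add' f g := by
    ext e
    by_cases h : e ∈ E <;> simp [h]
  map_smul' r f := by
    ext e
    by_cases h : e ∈ E <;> simp [h]

/-- The pairs of distinct elements of a set. -/
def pairs [DecidableEq W] (t : Finset W) : Finset (Sym2 W) :=
  t.sym2.filter fun e => ¬ e.IsDiag

theorem mem_pairs [DecidableEq W] {t : Finset W} {a b : W} :
    s(a, b) ∈ pairs t ↔ a ∈ t ∧ b ∈ t ∧ a ≠ b := by
  simp [pairs, and_assoc]

theorem sum_pairs [DecidableEq W] {a b c : W} (hab : a ≠ b) (hbc : b ≠ c) (hac : a ≠ c)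
    (φ : Sym2 W → ZMod 2) :
    ∑ e ∈ pairs {a, b, c}, φ e = φ s(a, b) + φ s(b, c) + φ s(a, c) := by
  have : pairs {a, b, c} = {s(a, b), s(b, c), s(a, c)} := by
    ext e
    induction e with
    | _ x y =>
      simp only [mem_pairs, Finset.mem_insert, Finset.mem_singleton, Sym2.eq_iff]
      grind
  rw [this, Finset.sum_insert, Finset.sum_insert, Finset.sum_singleton, add_assoc]
  · simp; grind
  · simp; grind

end PlanarDcol

namespace PlanarDcol

variable {W : Type*}

/-- The linear combination of the colour indicators with coefficients `w`, colour `2`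
being normalised to zero. -/
def colorValue (w : Fin 2 → ZMod 2) : Option (Fin 3) → ZMod 2
  | some 0 => w 0
  | some 1 => w 1
  | _ => 0

/-- The coboundary of `colorValue`, on a set of pairs. -/
def colorCoboundary (c : W → Option (Fin 3)) (E : Finset (Sym2 W)) :
    (Fin 2 → ZMod 2) →ₗ[ZMod 2] (E → ZMod 2) where
  toFun w e := Sym2.lift ⟨fun a b => colorValue w (c a) + colorValue w (c b),
    fun _ _ => add_comm _ _⟩ e.1
  map_add' w w' := by
    have key : ∀ o, colorValue (w + w') o = colorValue w o + colorValue w' o := by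
      intro o
      match o with
      | none => simp [colorValue]
      | some 0 => simp [colorValue]
      | some 1 => simp [colorValue]
      | some 2 => simp [colorValue]
    ext ⟨e, he⟩
    induction e with
    | _ a b => simp [key]; ring
  map_smul' r w := by
    have key : ∀ o, colorValue (r • w) o = r * colorValue w o := by
      intro o
      match o with
      | none => simp [colorValue]
      | some 0 => simp [colorValue]
      | some 1 => simp [colorValue]
      | some 2 => simp [colorValue]
    ext ⟨e, he⟩
    induction e with
    | _ a b => simp [key]; ring

theorem extendZero_apply_of_mem [DecidableEq W] {E : Finset (Sym2 W)} (f : E → ZMod 2) {e : Sym2 W}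
    (h : e ∈ E) : extendZero E f e = f ⟨e, h⟩ := by simp [extendZero, h]

theorem extendZero_apply_of_notMem [DecidableEq W] {E : Finset (Sym2 W)} (f : E → ZMod 2)
    {e : Sym2 W} (h : e ∉ E) : extendZero E f e = 0 := by simp [extendZero, h]

theorem exists_const_of_connIn {Γ : SimpleGraph W} {S : Set W} (h : ConnIn Γ S) (U : W → ZMod 2)
    (hU : ∀ a ∈ S, ∀ b ∈ S, Γ.Adj a b → U a = U b) : ∃ u, ∀ v ∈ S, U v = u := by
  rcases S.eq_empty_or_nonempty with rfl | ⟨a, ha⟩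
  · exact ⟨0, by simp⟩
  · refine ⟨U a, fun v hv => ?_⟩
    have := (h a ha v hv).mem_of_closed (A := {x | x ∈ S ∧ U x = U a}) ⟨ha, rfl⟩
      (fun x hx y hy hxy => ⟨hy, (hU x hx.1 y hy hxy).symm.trans hx.2⟩)
    exact this.2

theorem card_triTri_le_two [Finite W] [DecidableEq W] {Γ : SimpleGraph W}
    {T : Finset (Finset W)} (h : IsSphere Γ T) {X Y Z : Set W} (hX : ConnIn Γ X)
    (hY : ConnIn Γ Y) (hZ : ConnIn Γ Z) (hXY : Disjoint X Y) (hXZ : Disjoint X Z)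
    (hYZ : Disjoint Y Z) : (triTri T X Y Z).card ≤ 2 := by
  classical
  cases nonempty_fintype W
  rw [Set.disjoint_left] at hXY hXZ hYZ
  obtain ⟨c, hc1, hc2, hc3⟩ := exists_closed_coloring Γ _
    (fun v => if v ∈ X then some 0 else if v ∈ Y then some 1 else if v ∈ Z then some 2 else none)
    rfl (by
      intro i
      fin_cases i
      · convert hX using 1; ext v; simp; grind
      · convert hY using 1; ext v; simp; grind
      · convert hZ using 1; ext v; simp; grind)
  have cX : ∀ v ∈ X, c v = some 0 := fun v hv => hc1 v 0 (by simp [hv])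
  have cY : ∀ v ∈ Y, c v = some 1 := fun v hv => hc1 v 1 (by
    have : v ∉ X := fun h => hXY h hv
    simp [hv, this])
  have cZ : ∀ v ∈ Z, c v = some 2 := fun v hv => hc1 v 2 (by
    have : v ∉ X := fun h => hXZ h hv
    have : v ∉ Y := fun h => hYZ h hv
    simp [*])
  have cU : ∀ (U : W → ZMod 2), (∀ a b, Γ.Adj a b → c a = c b → U a = U b) →
      ∃ u : Fin 3 → ZMod 2, ∀ v i, c v = some i → U v = u i := by
    intro U hU
    choose u hu using fun i => exists_const_of_connIn (hc2 i) U
      (fun a ha b hb hab => hU a b hab (ha.trans hb.symm))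
    exact ⟨u, fun v i hv => hu i v hv⟩
  clear hc1 hc2 hX hY hZ hXY hXZ hYZ
  obtain ⟨E, hE⟩ : ∃ E : Finset (Sym2 W), ∀ a b, s(a, b) ∈ E ↔ Γ.Adj a b ∧ c a ≠ c b := by
    refine ⟨Finset.univ.filter fun e => e ∈ Γ.edgeSet ∧ ¬ (e.map c).IsDiag, fun a b => ?_⟩
    simp
  set Tc := T.filter fun t => ∃ e ∈ E, e ∈ pairs t with hTc
  have hpT : ∀ e ∈ E, (Tc.filter fun t => e ∈ pairs t).card = 0 ∨
      (Tc.filter fun t => e ∈ pairs t).card = 2 := by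
    intro e
    induction e with
    | _ a b =>
      intro he
      have hab := ((hE a b).1 he).1
      have : (Tc.filter fun t => s(a, b) ∈ pairs t) = T.filter fun t => a ∈ t ∧ b ∈ t := by
        ext t
        simp only [hTc, Finset.mem_filter, mem_pairs]
        constructor
        · rintro ⟨⟨h1, -⟩, h2, h3, -⟩; exact ⟨h1, h2, h3⟩
        · rintro ⟨h1, h2, h3⟩
          exact ⟨⟨h1, _, he, mem_pairs.2 ⟨h2, h3, hab.ne⟩⟩, h2, h3, hab.ne⟩
      rw [this]
      exact h.edge a b hab
  have hsub : triTri T X Y Z ⊆ Tc := by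
    intro t ht
    simp only [triTri, Finset.mem_filter] at ht
    obtain ⟨htT, ⟨x, hxt, hx⟩, ⟨y, hyt, hy⟩, -⟩ := ht
    have hne : c x ≠ c y := by simp [cX x hx, cY y hy]
    have hxy : x ≠ y := fun h => hne (by rw [h])
    refine Finset.mem_filter.2 ⟨htT, s(x, y), (hE x y).2 ⟨?_, hne⟩, mem_pairs.2 ⟨hxt, hyt, hxy⟩⟩
    obtain ⟨a, b, d, h1, h2, h3, rfl⟩ := h.triangle t htT
    simp only [Finset.mem_insert, Finset.mem_singleton] at hxt hyt
    grind [SimpleGraph.adj_comm]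
  rcases Finset.eq_empty_or_nonempty Tc with h0 | hne
  · rw [h0, Finset.subset_empty] at hsub
    simp [hsub]
  -- counting incidences
  have hcount : 2 * Tc.card + (triTri T X Y Z).card ≤ 2 * E.card := by
    have h1 : ∑ t ∈ Tc, (E.filter fun e => e ∈ pairs t).card =
        ∑ e ∈ E, (Tc.filter fun t => e ∈ pairs t).card := by
      simp only [Finset.card_filter]
      exact Finset.sum_comm
    have h2 : ∑ e ∈ E, (Tc.filter fun t => e ∈ pairs t).card ≤ ∑ e ∈ E, 2 :=
      Finset.sum_le_sum fun e he => by rcases hpT e he with h | h <;> omega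
    have h3 : ∑ t ∈ Tc, (2 + if t ∈ triTri T X Y Z then 1 else 0) ≤
        ∑ t ∈ Tc, (E.filter fun e => e ∈ pairs t).card := by
      refine Finset.sum_le_sum fun t ht => ?_
      obtain ⟨htT, e, he, het⟩ := Finset.mem_filter.1 ht
      obtain ⟨a, b, d, hab, hbd, had, rfl⟩ := h.triangle t htT
      have hall : ∀ x ∈ ({a, b, d} : Finset W), ∀ y ∈ ({a, b, d} : Finset W), x ≠ y →
          Γ.Adj x y := by
        intro x hx y hy hxy
        simp only [Finset.mem_insert, Finset.mem_singleton] at hx hy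
        grind [SimpleGraph.adj_comm]
      have hmemE : ∀ x ∈ ({a, b, d} : Finset W), ∀ y ∈ ({a, b, d} : Finset W), c x ≠ c y →
          s(x, y) ∈ E.filter fun e => e ∈ pairs {a, b, d} := by
        intro x hx y hy hxy
        have : x ≠ y := fun h => hxy (by rw [h])
        exact Finset.mem_filter.2 ⟨(hE x y).2 ⟨hall x hx y hy this, hxy⟩,
          mem_pairs.2 ⟨hx, hy, this⟩⟩
      split_ifs with h3
      · simp only [triTri, Finset.mem_filter] at h3
        obtain ⟨-, ⟨x, hxt, hx⟩, ⟨y, hyt, hy⟩, ⟨z, hzt, hz⟩⟩ := h3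
        have hx := cX x hx
        have hy := cY y hy
        have hz := cZ z hz
        have hxy : c x ≠ c y := by simp [hx, hy]
        have hxz : c x ≠ c z := by simp [hx, hz]
        have hyz : c y ≠ c z := by simp [hy, hz]
        have : ({s(x, y), s(y, z), s(x, z)} : Finset (Sym2 W)) ⊆
            E.filter fun e => e ∈ pairs {a, b, d} := by
          intro e he
          simp only [Finset.mem_insert, Finset.mem_singleton] at he
          rcases he with rfl | rfl | rfl
          exacts [hmemE _ hxt _ hyt hxy, hmemE _ hyt _ hzt hyz, hmemE _ hxt _ hzt hxz]
        refine le_trans ?_ (Finset.card_le_card this)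
        rw [Finset.card_insert_of_notMem, Finset.card_insert_of_notMem, Finset.card_singleton]
        all_goals simp; grind
      · rw [Nat.add_zero]
        refine Finset.one_lt_card.2 ?_
        have hb : c a ≠ c b ∨ c b ≠ c d ∨ c a ≠ c d := by
          revert he het
          induction e with
          | _ x y =>
            intro he het
            have := ((hE x y).1 he).2
            rw [mem_pairs] at het
            simp only [Finset.mem_insert, Finset.mem_singleton] at het
            grind
        have ma : a ∈ ({a, b, d} : Finset W) := by simp
        have mb : b ∈ ({a, b, d} : Finset W) := by simp
        have md : d ∈ ({a, b, d} : Finset W) := by simp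
        have n1 := hab.ne
        have n2 := hbd.ne
        have n3 := had.ne
        by_cases e1 : c a = c b
        · have e2 : c b ≠ c d := by grind
          exact ⟨_, hmemE b mb d md e2, _, hmemE a ma d md (e1 ▸ e2), by simp; grind⟩
        · by_cases e2 : c b = c d
          · exact ⟨_, hmemE a ma b mb e1, _, hmemE a ma d md (e2 ▸ e1), by simp; grind⟩
          · exact ⟨_, hmemE a ma b mb e1, _, hmemE b mb d md e2, by simp; grind⟩
    have h4 : (Tc.filter fun t => t ∈ triTri T X Y Z).card = (triTri T X Y Z).card := by
      congr 1
      ext t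
      simp only [Finset.mem_filter]
      exact ⟨fun h => h.2, fun h => ⟨hsub h, h⟩⟩
    rw [Finset.sum_add_distrib, ← Finset.card_filter, h4] at h3
    simp only [Finset.sum_const, smul_eq_mul] at h2 h3
    omega
  -- the boundary map
  let d : (E → ZMod 2) →ₗ[ZMod 2] (Tc → ZMod 2) :=
    LinearMap.pi fun t => (∑ e ∈ pairs t.1, LinearMap.proj e) ∘ₗ extendZero E
  have hd : ∀ f t, d f t = ∑ e ∈ pairs t.1, extendZero E f e := by
    intro f t; simp [d]
  have hker : Module.finrank (ZMod 2) (LinearMap.ker d) ≤ 2 := by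
    have hle : LinearMap.ker d ≤ LinearMap.range (colorCoboundary c E) := by
      intro f hf
      obtain ⟨U, hU⟩ := h.coboundary (extendZero E f) (by
        intro x y z hxy hyz hxz ht
        by_cases hm : ({x, y, z} : Finset W) ∈ Tc
        · have := congrFun (LinearMap.mem_ker.1 hf) ⟨_, hm⟩
          rw [hd, sum_pairs hxy.ne hyz.ne hxz.ne] at this
          exact this
        · have key : ∀ e ∈ pairs {x, y, z}, e ∉ E := fun e he heE =>
            hm (Finset.mem_filter.2 ⟨ht, e, heE, he⟩)
          rw [extendZero_apply_of_notMem, extendZero_apply_of_notMem, extendZero_apply_of_notMem]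
          · simp
          all_goals apply key; simp [mem_pairs, hxy.ne, hyz.ne, hxz.ne])
      obtain ⟨u, hu⟩ := cU U (by
        intro a b hab hcab
        have := hU a b hab
        rw [extendZero_apply_of_notMem _ (by simp [hE, hcab])] at this
        exact CharTwo.add_eq_zero.1 this.symm)
      have hval : ∀ v, c v ≠ none → U v = colorValue (fun i => u i.castSucc + u 2) (c v) + u 2 := by
        intro v hv
        obtain ⟨i, hi⟩ := Option.ne_none_iff_exists'.1 hv
        rw [hu v i hi, hi]
        fin_cases i <;> simp [colorValue, add_assoc, CharTwo.add_self_eq_zero]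
      refine ⟨fun i => u i.castSucc + u 2, ?_⟩
      ext ⟨e, he⟩
      revert he
      induction e with
      | _ a b =>
        intro he
        obtain ⟨hab, hcab⟩ := (hE a b).1 he
        have hca : c a ≠ none := by
          intro hn
          by_cases hb : c b = none
          · exact hcab (hn.trans hb.symm)
          · exact hc3 b a hab.symm hb hn
        have := hU a b hab
        rw [extendZero_apply_of_mem _ he, hval a hca, hval b (hc3 a b hab hca)] at this
        rw [this, add_add_add_comm, CharTwo.add_self_eq_zero, add_zero]
        rfl
    refine (Submodule.finrank_mono hle).trans ((LinearMap.finrank_range_le _).trans ?_)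
    simp
  have hrange : Module.finrank (ZMod 2) (LinearMap.range d) + 1 ≤ Tc.card := by
    let σ : (Tc → ZMod 2) →ₗ[ZMod 2] ZMod 2 := ∑ t, LinearMap.proj t
    have hle : LinearMap.range d ≤ LinearMap.ker σ := by
      rintro _ ⟨f, rfl⟩
      rw [LinearMap.mem_ker]
      have : σ (d f) = ∑ t ∈ Tc, ∑ e ∈ pairs t, extendZero E f e := by
        rw [← Finset.sum_coe_sort Tc]
        simp [σ, hd]
      rw [this]
      have h1 : ∀ t ∈ Tc, ∑ e ∈ pairs t, extendZero E f e =
          ∑ e ∈ E, if e ∈ pairs t then extendZero E f e else 0 := by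
        intro t _
        rw [← Finset.sum_filter, Finset.filter_mem_eq_inter, Finset.inter_comm,
          ← Finset.filter_mem_eq_inter, Finset.sum_filter]
        refine Finset.sum_congr rfl fun e _ => ?_
        split_ifs with he
        · rfl
        · exact extendZero_apply_of_notMem f he
      rw [Finset.sum_congr rfl h1, Finset.sum_comm]
      refine Finset.sum_eq_zero fun e he => ?_
      rw [← Finset.sum_filter, Finset.sum_const]
      rcases hpT e he with h | h <;> rw [h]
      · simp
      · rw [two_smul, CharTwo.add_self_eq_zero]
    have hσ : Function.Surjective σ := by
      obtain ⟨t, ht⟩ := hne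
      intro r
      refine ⟨Pi.single ⟨t, ht⟩ r, ?_⟩
      simp [σ]
    have h1 := LinearMap.finrank_range_add_finrank_ker σ
    rw [LinearMap.range_eq_top.2 hσ, finrank_top, Module.finrank_self,
      Module.finrank_fintype_fun_eq_card, Fintype.card_coe] at h1
    have := Submodule.finrank_mono hle
    omega
  have := LinearMap.finrank_range_add_finrank_ker d
  rw [Module.finrank_fintype_fun_eq_card, Fintype.card_coe] at this
  omega

end PlanarDcol

namespace PlanarDcol

variable {W : Type*} [DecidableEq W] {Γ : SimpleGraph W} {T : Finset (Finset W)}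
  {A B C : Set W}

omit [DecidableEq W] in
theorem mem_triTri {X Y Z : Set W} {t : Finset W} : t ∈ triTri T X Y Z ↔
    t ∈ T ∧ (∃ x ∈ t, x ∈ X) ∧ (∃ y ∈ t, y ∈ Y) ∧ ∃ z ∈ t, z ∈ Z := by
  classical
  simp [triTri]

theorem exists_of_mem_triTri (h : IsSphere Γ T) (hAB : Disjoint A B) (hAC : Disjoint A C)
    (hBC : Disjoint B C) {t : Finset W} (ht : t ∈ triTri T A B C) :
    ∃ a ∈ A, ∃ b ∈ B, ∃ c ∈ C, Γ.Adj a b ∧ Γ.Adj b c ∧ Γ.Adj a c ∧ t = {a, b, c} := by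
  rw [Set.disjoint_left] at hAB hAC hBC
  obtain ⟨htT, ⟨x, hx, hxA⟩, ⟨y, hy, hyB⟩, ⟨z, hz, hzC⟩⟩ := mem_triTri.1 ht
  obtain ⟨a, b, d, h1, h2, h3, rfl⟩ := h.triangle t htT
  have hxy : x ≠ y := fun e => hAB hxA (e ▸ hyB)
  have hyz : y ≠ z := fun e => hBC hyB (e ▸ hzC)
  have hxz : x ≠ z := fun e => hAC hxA (e ▸ hzC)
  simp only [Finset.mem_insert, Finset.mem_singleton] at hx hy hz
  refine ⟨x, hxA, y, hyB, z, hzC, ?_, ?_, ?_, ?_⟩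
  · grind [SimpleGraph.adj_comm]
  · grind [SimpleGraph.adj_comm]
  · grind [SimpleGraph.adj_comm]
  · ext v
    simp only [Finset.mem_insert, Finset.mem_singleton]
    grind

open Classical in
/-- The indicator of the pairs joining `A` to `C`. -/
noncomputable def door (A C : Set W) (e : Sym2 W) : ZMod 2 :=
  if ∃ a ∈ A, ∃ c ∈ C, e = s(a, c) then 1 else 0

theorem door_sum (hAB : Disjoint A B) (hAC : Disjoint A C)
    (hBC : Disjoint B C) (hN : ∀ c ∈ C, ∀ x, Γ.Adj c x → x ∈ A ∨ x ∈ B ∨ x ∈ C)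
    {a b d : W} (hab : Γ.Adj a b) (hbd : Γ.Adj b d) (had : Γ.Adj a d) (ht : {a, b, d} ∈ T)
    [Decidable ({a, b, d} ∈ triTri T A B C)] :
    door A C s(a, b) + door A C s(b, d) + door A C s(a, d) =
      if {a, b, d} ∈ triTri T A B C then 1 else 0 := by
  classical
  rw [Set.disjoint_left] at hAB hAC hBC
  have hd : ∀ x y, door A C s(x, y) = if (x ∈ A ∧ y ∈ C) ∨ (y ∈ A ∧ x ∈ C) then 1 else 0 := by
    intro x y
    unfold door
    congr 1
    simp only [Sym2.eq_iff, eq_iff_iff]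
    grind
  have cls : ∀ v, (v ∈ A ∧ v ∉ B ∧ v ∉ C) ∨ (v ∉ A ∧ v ∈ B ∧ v ∉ C) ∨ (v ∉ A ∧ v ∉ B ∧ v ∈ C) ∨
      (v ∉ A ∧ v ∉ B ∧ v ∉ C) := by
    intro v
    have := @hAB v
    have := @hAC v
    have := @hBC v
    tauto
  have e1 := fun h => hN a h b hab
  have e2 := fun h => hN b h a hab.symm
  have e3 := fun h => hN b h d hbd
  have e4 := fun h => hN d h b hbd.symm
  have e5 := fun h => hN a h d had
  have e6 := fun h => hN d h a had.symm
  have two : (1 + 1 : ZMod 2) = 0 := by decide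
  simp only [hd, mem_triTri, ht, true_and, Finset.mem_insert, Finset.mem_singleton,
    exists_eq_or_imp, exists_eq_left]
  clear hd hN hab hbd had ht hAB hAC hBC
  rcases cls a with ⟨a1, a2, a3⟩ | ⟨a1, a2, a3⟩ | ⟨a1, a2, a3⟩ | ⟨a1, a2, a3⟩ <;>
  rcases cls b with ⟨b1, b2, b3⟩ | ⟨b1, b2, b3⟩ | ⟨b1, b2, b3⟩ | ⟨b1, b2, b3⟩ <;>
  rcases cls d with ⟨d1, d2, d3⟩ | ⟨d1, d2, d3⟩ | ⟨d1, d2, d3⟩ | ⟨d1, d2, d3⟩ <;>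
  simp only [a1, a2, a3, b1, b2, b3, d1, d2, d3] at e1 e2 e3 e4 e5 e6 ⊢ <;> simp_all

theorem even_triTri [Finite W] (h : IsSphere Γ T) (hAB : Disjoint A B) (hAC : Disjoint A C)
    (hBC : Disjoint B C) (hN : ∀ c ∈ C, ∀ x, Γ.Adj c x → x ∈ A ∨ x ∈ B ∨ x ∈ C) :
    Even (triTri T A B C).card := by
  classical
  cases nonempty_fintype W
  have h1 : ∀ t ∈ T, ∑ e ∈ pairs t, door A C e = if t ∈ triTri T A B C then 1 else 0 := by
    intro t ht
    obtain ⟨a, b, d, hab, hbd, had, rfl⟩ := h.triangle t ht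
    rw [sum_pairs hab.ne hbd.ne had.ne, door_sum hAB hAC hBC hN hab hbd had ht]
  have h2 : ∑ t ∈ T, ∑ e ∈ pairs t, door A C e = 0 := by
    have : ∀ t ∈ T, ∑ e ∈ pairs t, door A C e =
        ∑ e, if e ∈ pairs t then door A C e else 0 := by
      intro t _
      simp
    rw [Finset.sum_congr rfl this, Finset.sum_comm]
    refine Finset.sum_eq_zero fun e _ => ?_
    rw [← Finset.sum_filter, Finset.sum_const]
    induction e with
    | _ a b =>
      by_cases hab : Γ.Adj a b
      · have : (T.filter fun t => s(a, b) ∈ pairs t) = T.filter fun t => a ∈ t ∧ b ∈ t := by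
          ext t
          simp [mem_pairs, hab.ne]
        rw [this]
        rcases h.edge a b hab with h | h <;> rw [h]
        · simp
        · rw [two_smul, CharTwo.add_self_eq_zero]
      · have : (T.filter fun t => s(a, b) ∈ pairs t) = ∅ := by
          ext t
          simp only [Finset.mem_filter, mem_pairs, Finset.notMem_empty, iff_false]
          rintro ⟨ht, ha, hb, hne⟩
          obtain ⟨x, y, z, h1, h2, h3, rfl⟩ := h.triangle t ht
          simp only [Finset.mem_insert, Finset.mem_singleton] at ha hb
          grind [SimpleGraph.adj_comm]
        simp [this]
  rw [Finset.sum_congr rfl h1, ← Finset.sum_filter, Finset.sum_const] at h2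
  have h3 : (T.filter fun t => t ∈ triTri T A B C) = triTri T A B C := by
    ext t
    simp only [Finset.mem_filter]
    exact ⟨fun h => h.2, fun h => ⟨(mem_triTri.1 h).1, h⟩⟩
  rw [h3, nsmul_one] at h2
  exact (ZMod.natCast_eq_zero_iff_even).1 h2

theorem triTri_nonempty (h : IsSphere Γ T) (hA : ConnIn Γ A) (hB : ConnIn Γ B)
    (hC : ConnIn Γ C) (hAB : Disjoint A B) (hAC : Disjoint A C)
    (hBC : Disjoint B C) (hN : ∀ c ∈ C, ∀ x, Γ.Adj c x → x ∈ A ∨ x ∈ B ∨ x ∈ C)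
    (tAB : Touch Γ A B) (tCA : Touch Γ C A) (tCB : Touch Γ C B) :
    (triTri T A B C).Nonempty := by
  classical
  by_contra hne
  rw [Finset.not_nonempty_iff_eq_empty] at hne
  obtain ⟨U, hU⟩ := h.coboundary (door A C) (by
    intro a b d hab hbd had ht
    rw [door_sum hAB hAC hBC hN hab hbd had ht, hne]
    simp)
  rw [Set.disjoint_left] at hAB hAC hBC
  have h0 : ∀ x y, Γ.Adj x y → ¬ (x ∈ A ∧ y ∈ C) → ¬ (y ∈ A ∧ x ∈ C) → U x = U y := by
    intro x y hxy h1 h2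
    have := hU x y hxy
    rw [door, if_neg] at this
    · exact CharTwo.add_eq_zero.1 this.symm
    · rintro ⟨a, ha, c, hc, he⟩
      simp only [Sym2.eq_iff] at he
      grind
  obtain ⟨uA, hA⟩ := exists_const_of_connIn hA U (fun a ha b hb hab =>
    h0 a b hab (fun h => hAC hb h.2) (fun h => hAC ha h.2))
  obtain ⟨uB, hB⟩ := exists_const_of_connIn hB U (fun a ha b hb hab =>
    h0 a b hab (fun h => hBC hb h.2) (fun h => hBC ha h.2))
  obtain ⟨uC, hC⟩ := exists_const_of_connIn hC U (fun a ha b hb hab =>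
    h0 a b hab (fun h => hAC h.1 ha) (fun h => hAC h.1 hb))
  obtain ⟨a, ha, b, hb, hab⟩ := tAB
  have e1 := h0 a b hab (fun h => hBC hb h.2) (fun h => hAB h.1 hb)
  obtain ⟨c, hc, b', hb', hcb⟩ := tCB
  have e2 := h0 c b' hcb (fun h => hBC hb' h.2) (fun h => hAB h.1 hb')
  obtain ⟨c', hc', a', ha', hca⟩ := tCA
  have e3 := hU c' a' hca
  rw [door, if_pos ⟨a', ha', c', hc', Sym2.eq_swap⟩] at e3
  rw [hA a ha, hB b hb] at e1
  rw [hC c hc, hB b' hb'] at e2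
  rw [hC c' hc', hA a' ha', e1, e2, CharTwo.add_self_eq_zero] at e3
  exact one_ne_zero e3

/-- The two poles of a region bounded by two connected sets, and the resulting
Hex-type alternative for the subsets of the region. -/
theorem exists_poles [Finite W] (h : IsSphere Γ T) (hA : ConnIn Γ A) (hB : ConnIn Γ B)
    (hC : ConnIn Γ C) (hAB : Disjoint A B) (hAC : Disjoint A C)
    (hBC : Disjoint B C) (hN : ∀ c ∈ C, ∀ x, Γ.Adj c x → x ∈ A ∨ x ∈ B ∨ x ∈ C)
    (tAB : Touch Γ A B) (tCA : Touch Γ C A) (tCB : Touch Γ C B) :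
    ∃ v ∈ C, ∃ w ∈ C, (∃ a ∈ A, Γ.Adj v a) ∧ (∃ b ∈ B, Γ.Adj v b) ∧
      ∀ S ⊆ C, Linked Γ S v w ↔ ¬ ∃ K ⊆ C \ S, ConnIn Γ K ∧ Touch Γ K A ∧ Touch Γ K B := by
  classical
  have h2 : (triTri T A B C).card = 2 := by
    have h1 := card_triTri_le_two h hA hB hC hAB hAC hBC
    have h2 := even_triTri h hAB hAC hBC hN
    have h3 := (triTri_nonempty h hA hB hC hAB hAC hBC hN tAB tCA tCB).card_pos
    interval_cases (triTri T A B C).card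
    · exact absurd h2 (by decide)
    · rfl
  obtain ⟨t1, t2, hne, htt⟩ := Finset.card_eq_two.1 h2
  obtain ⟨a1, ha1, b1, hb1, v, hv, hab1, hbv, hav, rfl⟩ :=
    exists_of_mem_triTri h hAB hAC hBC (t := t1) (by rw [htt]; simp)
  obtain ⟨a2, ha2, b2, hb2, w, hw, hab2, hbw, haw, rfl⟩ :=
    exists_of_mem_triTri h hAB hAC hBC (t := t2) (by rw [htt]; simp)
  have ht1 : {a1, b1, v} ∈ triTri T A B C := by rw [htt]; simp
  have ht2 : {a2, b2, w} ∈ triTri T A B C := by rw [htt]; simp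
  refine ⟨v, hv, w, hw, ⟨a1, ha1, hav.symm⟩, ⟨b1, hb1, hbv.symm⟩, fun S hS => ⟨?_, ?_⟩⟩
  · rintro hvw ⟨K, hK, hKc, hKA, hKB⟩
    set S0 := comp Γ S v with hS0
    have hvS0 : v ∈ S0 := mem_comp_self hvw.left_mem
    have hwS0 : w ∈ S0 := hvw
    have hS0C : S0 ⊆ C := comp_subset.trans hS
    obtain ⟨k, hk, -⟩ := id hKA
    set K' := comp Γ (C \ S0) k with hK'
    have cS0 : ConnIn Γ S0 := connIn_comp
    have cK' : ConnIn Γ K' := connIn_comp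
    have hKK' : K ⊆ K' := hKc.subset_comp hk (hK.trans (Set.sdiff_subset_sdiff_right comp_subset))
    have hK'C : K' ⊆ C \ S0 := comp_subset
    have hNK : ∀ c ∈ K', ∀ x, Γ.Adj c x → x ∈ A ∨ x ∈ B ∨ x ∈ S0 ∨ x ∈ K' := by
      intro c hc x hcx
      rcases hN c (hK'C hc).1 x hcx with h | h | h
      · exact Or.inl h
      · exact Or.inr (Or.inl h)
      · by_cases hx : x ∈ S0
        · exact Or.inr (Or.inr (Or.inl hx))
        · exact Or.inr (Or.inr (Or.inr (comp_closed hc ⟨h, hx⟩ hcx)))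
    have dKA : Disjoint A K' := hAC.mono_right (hK'C.trans Set.sdiff_subset)
    have dKB : Disjoint B K' := hBC.mono_right (hK'C.trans Set.sdiff_subset)
    have dSA : Disjoint A S0 := hAC.mono_right hS0C
    have dSB : Disjoint B S0 := hBC.mono_right hS0C
    have dSK : Disjoint S0 K' := Set.disjoint_left.2 fun x h1 h2 => (hK'C h2).2 h1
    have hcorner : ∀ t ∈ triTri T A B C, (∃ z ∈ t, z ∈ K') → False := by
      rw [Set.disjoint_left] at dKA dKB dSK
      rintro t ht ⟨z, hz, hzK⟩
      rw [htt] at ht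
      simp only [Finset.mem_insert, Finset.mem_singleton] at ht
      rcases ht with rfl | rfl <;> simp only [Finset.mem_insert, Finset.mem_singleton] at hz <;>
        rcases hz with rfl | rfl | rfl
      exacts [dKA ha1 hzK, dKB hb1 hzK, dSK hvS0 hzK, dKA ha2 hzK, dKB hb2 hzK, dSK hwS0 hzK]
    have tSA : Touch Γ S0 A := ⟨v, hvS0, a1, ha1, hav.symm⟩
    have tSB : Touch Γ S0 B := ⟨v, hvS0, b1, hb1, hbv.symm⟩
    have hside : ∀ X Y : Set W, ConnIn Γ X → ConnIn Γ Y → Disjoint X Y → Disjoint X K' →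
        Disjoint Y K' → Disjoint X S0 → Touch Γ X Y → Touch Γ K X → Touch Γ K Y →
        Touch Γ S0 Y → (∀ c ∈ K', ∀ x, Γ.Adj c x → x ∈ X ∨ x ∈ Y ∨ x ∈ S0 ∨ x ∈ K') →
        2 ≤ (triTri T X (Y ∪ S0) K').card := by
      intro X Y hX hY dXY dXK dYK dXS tXY tKX tKY tSY hN'
      have hYS : ConnIn Γ (Y ∪ S0) := hY.union cS0 tSY.symm
      have d1 : Disjoint X (Y ∪ S0) := Set.disjoint_union_right.2 ⟨dXY, dXS⟩
      have d2 : Disjoint (Y ∪ S0) K' := Set.disjoint_union_left.2 ⟨dYK, dSK⟩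
      have hN'' : ∀ c ∈ K', ∀ x, Γ.Adj c x → x ∈ X ∨ x ∈ Y ∪ S0 ∨ x ∈ K' := by
        intro c hc x hx
        have := hN' c hc x hx
        simp only [Set.mem_union]
        tauto
      have h1 := even_triTri h d1 dXK d2 hN''
      have h2 := triTri_nonempty h hX hYS cK' d1 dXK d2 hN''
        (tXY.mono subset_rfl Set.subset_union_left) (tKX.mono hKK' subset_rfl)
        (tKY.mono hKK' Set.subset_union_left)
      have h3 := h2.card_pos
      obtain ⟨m, hm⟩ := h1
      omega
    have c1 := hside A B hA hB hAB dKA dKB dSA tAB hKA hKB tSB hNK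
    have c2 := hside B A hB hA hAB.symm dKB dKA dSB tAB.symm hKB hKA tSA
      (fun c hc x hx => by have := hNK c hc x hx; tauto)
    have d3 : Disjoint (A ∪ B) S0 := Set.disjoint_union_left.2 ⟨dSA, dSB⟩
    have d4 : Disjoint (A ∪ B) K' := Set.disjoint_union_left.2 ⟨dKA, dKB⟩
    have c3 := card_triTri_le_two h (hA.union hB tAB) cS0 cK' d3 d4 dSK
    have hsub : ∀ X Y : Set W, X ⊆ A ∪ B → (∀ t, t ∈ T → (∃ x ∈ t, x ∈ X) → (∃ x ∈ t, x ∈ Y) →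
        (∃ x ∈ t, x ∈ K') → False) → triTri T X (Y ∪ S0) K' ⊆ triTri T (A ∪ B) S0 K' := by
      intro X Y hX hXY t ht
      obtain ⟨h1, ⟨x, hx, hxX⟩, ⟨y, hy, hyY⟩, hz⟩ := mem_triTri.1 ht
      refine mem_triTri.2 ⟨h1, ⟨x, hx, hX hxX⟩, ?_, hz⟩
      rcases hyY with hyY | hyS
      · exact (hXY t h1 ⟨x, hx, hxX⟩ ⟨y, hy, hyY⟩ hz).elim
      · exact ⟨y, hy, hyS⟩
    have hKC : ∀ {t : Finset W}, (∃ z ∈ t, z ∈ K') → ∃ z ∈ t, z ∈ C :=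
      fun ⟨z, h1, h2⟩ => ⟨z, h1, (hK'C h2).1⟩
    have s1 := hsub A B Set.subset_union_left (fun t h1 h2 h3 h4 =>
      hcorner t (mem_triTri.2 ⟨h1, h2, h3, hKC h4⟩) h4)
    have s2 := hsub B A Set.subset_union_right (fun t h1 h2 h3 h4 =>
      hcorner t (mem_triTri.2 ⟨h1, h3, h2, hKC h4⟩) h4)
    have hdisj : Disjoint (triTri T A (B ∪ S0) K') (triTri T B (A ∪ S0) K') := by
      rw [Finset.disjoint_left]
      intro t ht1 ht2
      obtain ⟨e1, e2, -, e4⟩ := mem_triTri.1 ht1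
      obtain ⟨-, e3, -, -⟩ := mem_triTri.1 ht2
      exact hcorner t (mem_triTri.2 ⟨e1, e2, e3, hKC e4⟩) e4
    have := Finset.card_le_card (Finset.union_subset s1 s2)
    rw [Finset.card_union_of_disjoint hdisj] at this
    omega
  · intro hno
    have hvS : v ∈ S := by
      by_contra hvS
      exact hno ⟨{v}, by simpa using ⟨hv, hvS⟩, connIn_singleton, ⟨v, rfl, a1, ha1, hav.symm⟩,
        ⟨v, rfl, b1, hb1, hbv.symm⟩⟩
    set S0 := comp Γ S v with hS0
    have hvS0 : v ∈ S0 := mem_comp_self hvS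
    have hS0S : S0 ⊆ S := comp_subset
    set Q : Set W := {c | ∃ a ∈ A, ∃ q, Γ.Adj q a ∧ Linked Γ (C \ S) q c} with hQ
    have hQC : Q ⊆ C \ S := by
      rintro c ⟨a, -, q, -, hl⟩
      exact hl.right_mem
    have d1 : Disjoint (A ∪ Q) (B ∪ ((C \ S) \ Q)) := by
      rw [Set.disjoint_left] at hAB hAC hBC ⊢
      rintro x (hx | hx) (hx' | hx')
      · exact hAB hx hx'
      · exact hAC hx hx'.1.1
      · exact hBC hx' (hQC hx).1
      · exact hx'.2 hx
    have d2 : Disjoint (A ∪ Q) S0 := by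
      rw [Set.disjoint_left] at hAC ⊢
      rintro x (hx | hx) hx'
      · exact hAC hx (hS (hS0S hx'))
      · exact (hQC hx).2 (hS0S hx')
    have d3 : Disjoint (B ∪ ((C \ S) \ Q)) S0 := by
      rw [Set.disjoint_left] at hBC ⊢
      rintro x (hx | hx) hx'
      · exact hBC hx (hS (hS0S hx'))
      · exact hx.1.2 (hS0S hx')
    have hev := even_triTri h d1 d2 d3 (by
      intro c hc x hcx
      rcases hN c (hS (hS0S hc)) x hcx with h | h | h
      · exact Or.inl (Or.inl h)
      · exact Or.inr (Or.inl (Or.inl h))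
      · by_cases hxS : x ∈ S
        · exact Or.inr (Or.inr (comp_closed hc hxS hcx))
        · by_cases hxQ : x ∈ Q
          · exact Or.inl (Or.inr hxQ)
          · exact Or.inr (Or.inl (Or.inr ⟨⟨h, hxS⟩, hxQ⟩)))
    have hm1 : {a1, b1, v} ∈ triTri T (A ∪ Q) (B ∪ ((C \ S) \ Q)) S0 :=
      mem_triTri.2 ⟨(mem_triTri.1 ht1).1, ⟨a1, by simp, Or.inl ha1⟩, ⟨b1, by simp, Or.inl hb1⟩,
        ⟨v, by simp, hvS0⟩⟩
    have hcard : 1 < (triTri T (A ∪ Q) (B ∪ ((C \ S) \ Q)) S0).card := by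
      have := Finset.card_pos.2 ⟨_, hm1⟩
      obtain ⟨m, hm⟩ := hev
      omega
    obtain ⟨t', ht', hne'⟩ := Finset.exists_mem_ne hcard {a1, b1, v}
    obtain ⟨x, hx, y, hy, s, hs, hxy, hys, hxs, rfl⟩ := exists_of_mem_triTri h d1 d2 d3 ht'
    have hQK : ∀ x ∈ Q, ConnIn Γ (comp Γ (C \ S) x) ∧ Touch Γ (comp Γ (C \ S) x) A := by
      rintro x ⟨a, ha, q, hqa, hl⟩
      exact ⟨connIn_comp, q, hl.symm, a, ha, hqa⟩
    have hxA : x ∈ A ∧ y ∈ B := by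
      rcases hy with hy | hy
      · refine ⟨?_, hy⟩
        rcases hx with hx | hx
        · exact hx
        · exact (hno ⟨comp Γ (C \ S) x, comp_subset, (hQK x hx).1, (hQK x hx).2, x,
            mem_comp_self (hQC hx), y, hy, hxy⟩).elim
      · exfalso
        apply hy.2
        rcases hx with hx | hx
        · exact ⟨x, hx, y, hxy.symm, Linked.refl hy.1⟩
        · obtain ⟨a, ha, q, hqa, hl⟩ := hx
          exact ⟨a, ha, q, hqa, hl.trans (Linked.of_adj hxy hl.right_mem hy.1)⟩
    have hm : {x, y, s} ∈ triTri T A B C :=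
      mem_triTri.2 ⟨(mem_triTri.1 ht').1, ⟨x, by simp, hxA.1⟩, ⟨y, by simp, hxA.2⟩,
        ⟨s, by simp, hS (hS0S hs)⟩⟩
    rw [htt, Finset.mem_insert, Finset.mem_singleton] at hm
    rcases hm with hm | hm
    · exact absurd hm hne'
    · have hsm : s ∈ ({a2, b2, w} : Finset W) := by rw [← hm]; simp
      rw [Set.disjoint_left] at hAC hBC
      simp only [Finset.mem_insert, Finset.mem_singleton] at hsm
      rcases hsm with rfl | rfl | rfl
      · exact absurd (hS (hS0S hs)) (hAC ha2)
      · exact absurd (hS (hS0S hs)) (hBC hb2)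
      · exact hs

end PlanarDcol

namespace PlanarDcol

variable {W : Type*}

/-- The distance from `v` to `x` inside `C` (zero if they are not linked). -/
noncomputable def innerDist (Γ : SimpleGraph W) (C : Set W) (v x : W) : ℕ :=
  sInf {n | ∃ p : Γ.Walk v x, (∀ z ∈ p.support, z ∈ C) ∧ p.length = n}

variable {Γ : SimpleGraph W} {A B C X : Set W} {u v w a b : W}

theorem innerDist_le (p : Γ.Walk v a) (hp : ∀ z ∈ p.support, z ∈ C) :
    innerDist Γ C v a ≤ p.length := Nat.sInf_le ⟨p, hp, rfl⟩

theorem exists_walk_innerDist (h : Linked Γ C v a) :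
    ∃ p : Γ.Walk v a, (∀ z ∈ p.support, z ∈ C) ∧ p.length = innerDist Γ C v a := by
  obtain ⟨p, hp⟩ := h
  exact Nat.sInf_mem (s := {n | ∃ p : Γ.Walk v a, (∀ z ∈ p.support, z ∈ C) ∧ p.length = n})
    ⟨_, p, hp, rfl⟩

theorem innerDist_triangle (h : Linked Γ C v a) (p : Γ.Walk a b) (hp : ∀ z ∈ p.support, z ∈ C) :
    innerDist Γ C v b ≤ innerDist Γ C v a + p.length := by
  obtain ⟨q, hq, hl⟩ := exists_walk_innerDist h
  rw [← hl, ← Walk.length_append]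
  refine innerDist_le _ fun z hz => ?_
  rw [Walk.mem_support_append_iff] at hz
  exact hz.elim (hq z) (hp z)

theorem exists_first_hit (p : Γ.Walk u v) (hv : v ∈ X) :
    ∃ w ∈ X, ∃ q : Γ.Walk u w, ∃ r : Γ.Walk w v, q.length + r.length = p.length ∧
      (∀ z ∈ q.support, z ∈ p.support) ∧ (∀ z ∈ r.support, z ∈ p.support) ∧
      (∀ z ∈ q.support, z ∈ X → z = w) ∧
      ∀ z ∈ q.support, z ∉ X → Linked Γ ({t | t ∈ p.support} \ X) u z := by
  induction p with
  | nil => exact ⟨_, hv, .nil, .nil, by simp; exact fun h => absurd hv h⟩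
  | @cons x y z h p ih =>
    by_cases hx : x ∈ X
    · exact ⟨x, hx, .nil, .cons h p, by simp; exact fun h => absurd hx h⟩
    · obtain ⟨w, hw, q, r, h1, h2, h3, h4, h5⟩ := ih hv
      have hsub : {t | t ∈ p.support} \ X ⊆ {t | t ∈ (Walk.cons h p).support} \ X :=
        fun t ht => ⟨by simp only [Set.mem_ofPred, Walk.support_cons, List.mem_cons]
                        exact Or.inr ht.1, ht.2⟩
      refine ⟨w, hw, .cons h q, r, by simp; omega, ?_, ?_, ?_, ?_⟩
      · intro z hz
        simp only [Walk.support_cons, List.mem_cons] at hz ⊢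
        exact hz.imp_right (h2 z)
      · intro z hz
        simp only [Walk.support_cons, List.mem_cons]
        exact Or.inr (h3 z hz)
      · intro z hz hzX
        simp only [Walk.support_cons, List.mem_cons] at hz
        rcases hz with rfl | hz
        · exact absurd hzX hx
        · exact h4 z hz hzX
      · intro z hz hzX
        have hx' : x ∈ {t | t ∈ (Walk.cons h p).support} \ X := ⟨by simp, hx⟩
        simp only [Walk.support_cons, List.mem_cons] at hz
        rcases hz with rfl | hz
        · exact Linked.refl hx'
        · have := (h5 z hz hzX).mono hsub
          exact (Linked.of_adj h hx' this.left_mem).trans this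

/-- A walk in `C` realising the distance between its ends. -/
structure IsGeod (C : Set W) (p : Γ.Walk v w) : Prop where
  mem : ∀ z ∈ p.support, z ∈ C
  length : p.length = innerDist Γ C v w

theorem IsGeod.split {p : Γ.Walk v w} (hp : IsGeod C p) {x : W} (q : Γ.Walk v x) (r : Γ.Walk x w)
    (h1 : ∀ z ∈ q.support, z ∈ C) (h2 : ∀ z ∈ r.support, z ∈ C)
    (hqr : q.length + r.length = p.length) : q.length = innerDist Γ C v x := by
  have h3 := innerDist_le q h1
  have h4 := innerDist_triangle ⟨q, h1⟩ r h2
  have h5 := hp.length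
  omega

theorem IsGeod.length_takeUntil [DecidableEq W] {p : Γ.Walk v w} (hp : IsGeod C p) {x : W}
    (hx : x ∈ p.support) : (p.takeUntil x hx).length = innerDist Γ C v x :=
  hp.split _ (p.dropUntil x hx)
    (fun z hz => hp.mem z (p.support_takeUntil_subset_support hx hz))
    (fun z hz => hp.mem z (p.support_dropUntil_subset_support hx hz))
    (by rw [← Walk.length_append, p.take_spec hx])

theorem IsGeod.getVert [DecidableEq W] {p : Γ.Walk v w} (hp : IsGeod C p) {x : W}
    (hx : x ∈ p.support) : p.getVert (innerDist Γ C v x) = x := by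
  rw [← hp.length_takeUntil hx, Walk.getVert_length_takeUntil]

theorem IsGeod.innerDist_getVert {p : Γ.Walk v w} (hp : IsGeod C p) {i : ℕ}
    (hi : i ≤ p.length) : innerDist Γ C v (p.getVert i) = i := by
  rw [← hp.split (p.take i) (p.drop i)
    (fun z hz => hp.mem z ((p.isSubwalk_take i).support_subset hz))
    (fun z hz => hp.mem z ((p.isSubwalk_drop i).support_subset hz)) (by simp; omega)]
  simp [hi]

theorem IsGeod.injOn {p : Γ.Walk v w} (hp : IsGeod C p) :
    Set.InjOn (innerDist Γ C v) {z | z ∈ p.support} := by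
  classical
  intro x hx y hy hxy
  rw [← hp.getVert hx, ← hp.getVert hy, hxy]

theorem IsGeod.linked {p : Γ.Walk v w} (hp : IsGeod C p) {x : W} (hx : x ∈ p.support) :
    Linked Γ C v x := by
  classical
  exact ⟨p.takeUntil x hx, fun z hz => hp.mem z (p.support_takeUntil_subset_support hx hz)⟩

theorem IsGeod.exists_walk {p : Γ.Walk v w} (hp : IsGeod C p) (ha : a ∈ p.support)
    (hb : b ∈ p.support) (hab : innerDist Γ C v a ≤ innerDist Γ C v b) :
    ∃ q : Γ.Walk a b, (∀ z ∈ q.support, z ∈ p.support) ∧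
      innerDist Γ C v a + q.length = innerDist Γ C v b := by
  classical
  have hb' := hp.length_takeUntil hb
  set p' := p.takeUntil b hb with hp'
  have hsub : ∀ z ∈ p'.support, z ∈ p.support := fun z hz =>
    p.support_takeUntil_subset_support hb hz
  have ha' : a ∈ p'.support := by
    rw [← hp.getVert ha, Walk.mem_support_iff_exists_getVert]
    refine ⟨innerDist Γ C v a, ?_, by omega⟩
    rw [hp', Walk.getVert_takeUntil]
    change _ ≤ p'.length
    omega
  refine ⟨p'.dropUntil a ha', fun z hz => hsub z (p'.support_dropUntil_subset_support ha' hz), ?_⟩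
  have hg : IsGeod C p' := ⟨fun z hz => hp.mem z (hsub z hz), hb'⟩
  have h1 := hg.length_takeUntil ha'
  have h2 := congrArg Walk.length (p'.take_spec ha')
  rw [Walk.length_append] at h2
  omega

/-- The vertices of `C ∖ X` joined to `B` in `C ∖ X`. -/
def sideOf (Γ : SimpleGraph W) (B C X : Set W) : Set W :=
  {x | ∃ K ⊆ C \ X, ConnIn Γ K ∧ x ∈ K ∧ Touch Γ K B}

theorem exists_piece [Finite W] [DecidableEq W] {T : Finset (Finset W)}
    (h : IsSphere Γ T) (hA : ConnIn Γ A) (hB : ConnIn Γ B)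
    (hC : ConnIn Γ C) (hAB : Disjoint A B) (hAC : Disjoint A C)
    (hBC : Disjoint B C) (hN : ∀ c ∈ C, ∀ x, Γ.Adj c x → x ∈ A ∨ x ∈ B ∨ x ∈ C)
    (tAB : Touch Γ A B) (tCA : Touch Γ C A) (tCB : Touch Γ C B) :
    ∃ X ⊆ C, ∃ idx : W → ℕ, ConnIn Γ X ∧ Touch Γ X A ∧ Touch Γ X B ∧
      (¬ ∃ K ⊆ C \ X, ConnIn Γ K ∧ Touch Γ K A ∧ Touch Γ K B) ∧ Set.InjOn idx X ∧
      (∀ a ∈ X, ∀ b ∈ X, idx a ≤ idx b → ∃ q : Γ.Walk a b, (∀ z ∈ q.support, z ∈ X) ∧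
        idx a + q.length = idx b) ∧
      (∀ a ∈ X, ∀ b ∈ X, ∀ p : Γ.Walk a b, (∀ z ∈ p.support, z ∈ C) → idx b ≤ idx a + p.length) ∧
      (∀ a ∈ X, ∀ b ∈ X, ∀ p : Γ.Walk a b, (∀ z ∈ p.support, z ∈ C) →
        ∀ y ∈ p.support, y ∉ X → y ∉ sideOf Γ B C X → idx b + 1 ≤ idx a + p.length) := by
  classical
  obtain ⟨v, hv, w, hw, ⟨a₀, ha₀, hva⟩, ⟨b₀, hb₀, hvb⟩, hS⟩ :=
    exists_poles h hA hB hC hAB hAC hBC hN tAB tCA tCB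
  obtain ⟨P, hP, hmax⟩ : ∃ P : Γ.Walk v w, IsGeod C P ∧ ∀ P' : Γ.Walk v w, IsGeod C P' →
      (sideOf Γ B C {z | z ∈ P'.support}).ncard ≤ (sideOf Γ B C {z | z ∈ P.support}).ncard := by
    obtain ⟨P0, h1, h2⟩ := exists_walk_innerDist (hC v hv w hw)
    have hfin : Set.Finite ((fun P : Γ.Walk v w => (sideOf Γ B C {z | z ∈ P.support}).ncard) ''
        {P | IsGeod C P}) := by
      refine (Set.finite_le_nat (Nat.card W)).subset ?_
      rintro _ ⟨P, -, rfl⟩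
      exact Set.ncard_le_card _
    obtain ⟨m, ⟨P, hP, rfl⟩, hm⟩ := Set.exists_max_image _ id hfin ⟨_, P0, ⟨h1, h2⟩, rfl⟩
    exact ⟨P, hP, fun P' hP' => hm _ ⟨P', hP', rfl⟩⟩
  set X : Set W := {z | z ∈ P.support} with hX
  have hXC : X ⊆ C := hP.mem
  have hvX : v ∈ X := P.start_mem_support
  have hlip : ∀ a ∈ X, ∀ b, ∀ p : Γ.Walk a b, (∀ z ∈ p.support, z ∈ C) →
      innerDist Γ C v b ≤ innerDist Γ C v a + p.length :=
    fun a ha b p hp => innerDist_triangle (hP.linked ha) p hp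
  have hno := (hS X hXC).1 ⟨P, fun _ h => h⟩
  refine ⟨X, hXC, innerDist Γ C v, connIn_support P, ⟨v, hvX, a₀, ha₀, hva⟩, ⟨v, hvX, b₀, hb₀, hvb⟩,
    hno, hP.injOn, fun a ha b hb hab => hP.exists_walk ha hb hab,
    fun a ha b _ => hlip a ha b, ?_⟩
  intro a ha b hb p hp y hy hyX hyB
  obtain ⟨b', hb', q₂, r₂, l₂, sq₂, sr₂, f₂, g₂⟩ := exists_first_hit (p.dropUntil y hy) hb
  obtain ⟨a', ha', q₁, r₁, l₁, sq₁, sr₁, f₁, g₁⟩ := exists_first_hit (p.takeUntil y hy).reverse ha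
  have hd : ∀ z ∈ (p.dropUntil y hy).support, z ∈ p.support := fun z hz =>
    p.support_dropUntil_subset_support hy hz
  have ht : ∀ z ∈ (p.takeUntil y hy).reverse.support, z ∈ p.support := fun z hz =>
    p.support_takeUntil_subset_support hy (by simpa using hz)
  have hlen := congrArg Walk.length (p.take_spec hy)
  rw [Walk.length_append] at hlen
  rw [Walk.length_reverse] at l₁
  have e1 : innerDist Γ C v a' ≤ innerDist Γ C v a + r₁.reverse.length :=
    hlip a ha a' r₁.reverse (fun z hz => hp z (ht z (sr₁ z (by simpa using hz))))
  have e2 := hlip b' hb' b r₂ (fun z hz => hp z (hd z (sr₂ z hz)))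
  rw [Walk.length_reverse] at e1
  by_contra hcon
  have hne1 : q₁.length ≠ 0 := fun h0 => hyX (Walk.eq_of_length_eq_zero h0 ▸ ha')
  have hne2 : q₂.length ≠ 0 := fun h0 => hyX (Walk.eq_of_length_eq_zero h0 ▸ hb')
  set mid := q₁.reverse.append q₂ with hmid
  have hmidlen : mid.length = q₁.length + q₂.length := by simp [hmid]
  have hmC : ∀ z ∈ mid.support, z ∈ C := by
    intro z hz
    rw [hmid, Walk.mem_support_append_iff, Walk.support_reverse, List.mem_reverse] at hz
    rcases hz with hz | hz
    exacts [hp z (ht z (sq₁ z hz)), hp z (hd z (sq₂ z hz))]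
  have hmX : ∀ z ∈ mid.support, z ∈ X → z = a' ∨ z = b' := by
    intro z hz hzX
    rw [hmid, Walk.mem_support_append_iff, Walk.support_reverse, List.mem_reverse] at hz
    exact hz.imp (fun h => f₁ z h hzX) (fun h => f₂ z h hzX)
  have hyq1 : y ∈ q₁.support := q₁.start_mem_support
  have hyq2 : y ∈ q₂.support := q₂.start_mem_support
  have hmB : ∀ z ∈ mid.support, z ∉ sideOf Γ B C X := by
    rintro z hz ⟨K, hKC, hKc, hzK, hKB⟩
    have hzX := (hKC hzK).2
    have hl : Linked Γ (C \ X) y z := by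
      rw [hmid, Walk.mem_support_append_iff, Walk.support_reverse, List.mem_reverse] at hz
      rcases hz with hz | hz
      · exact (g₁ z hz hzX).mono fun t h => ⟨hp t (ht t h.1), h.2⟩
      · exact (g₂ z hz hzX).mono fun t h => ⟨hp t (hd t h.1), h.2⟩
    obtain ⟨k, hk, b, hb, hkb⟩ := hKB
    exact hyB ⟨comp Γ (C \ X) y, comp_subset, connIn_comp, mem_comp_self hl.left_mem, k,
      hl.trans ((hKc z hzK k hk).mono hKC), b, hb, hkb⟩
  have e3 := hlip a' ha' b' mid hmC
  have e4 : innerDist Γ C v b' = innerDist Γ C v a' + mid.length := by omega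
  -- the rerouted path
  set P' := (P.takeUntil a' ha').append (mid.append (P.dropUntil b' hb')) with hP'
  have s1 := hP.length_takeUntil ha'
  have s2 := hP.length_takeUntil hb'
  have s3 := congrArg Walk.length (P.take_spec hb')
  rw [Walk.length_append] at s3
  have hmem' : ∀ z, z ∈ P'.support ↔ z ∈ (P.takeUntil a' ha').support ∨ z ∈ mid.support ∨
      z ∈ (P.dropUntil b' hb').support := by
    intro z
    simp only [hP', Walk.mem_support_append_iff]
  have hg' : IsGeod C P' := by
    refine ⟨fun z hz => ?_, ?_⟩
    · rcases (hmem' z).1 hz with h | h | h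
      exacts [hP.mem z (P.support_takeUntil_subset_support ha' h), hmC z h,
        hP.mem z (P.support_dropUntil_subset_support hb' h)]
    · have := hP.length
      simp only [hP', Walk.length_append]
      omega
  have hlow : ∀ z ∈ (P.takeUntil a' ha').support, innerDist Γ C v z ≤ innerDist Γ C v a' := by
    intro z hz
    rw [← s1]
    refine (innerDist_le ((P.takeUntil a' ha').takeUntil z hz) fun t h => hP.mem t
      (P.support_takeUntil_subset_support ha'
        (Walk.support_takeUntil_subset_support _ hz h))).trans ?_
    exact Walk.length_takeUntil_le_length _ hz
  have hhigh : ∀ z ∈ (P.dropUntil b' hb').support, innerDist Γ C v b' ≤ innerDist Γ C v z := by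
    intro z hz
    set D := P.dropUntil b' hb' with hD
    have hDC : ∀ t ∈ D.support, t ∈ C := fun t h =>
      hP.mem t (P.support_dropUntil_subset_support hb' h)
    have hzP : z ∈ P.support := P.support_dropUntil_subset_support hb' hz
    have h1 := innerDist_triangle (hP.linked hzP) (D.dropUntil z hz)
      (fun t h => hDC t (D.support_dropUntil_subset_support hz h))
    have h2 := congrArg Walk.length (D.take_spec hz)
    rw [Walk.length_append] at h2
    have := hP.length
    omega
  have hXP' : ∀ z ∈ X, z ∈ P'.support → innerDist Γ C v z ≤ innerDist Γ C v a' ∨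
      innerDist Γ C v b' ≤ innerDist Γ C v z := by
    intro z hzX hz
    rcases (hmem' z).1 hz with h | h | h
    · exact Or.inl (hlow z h)
    · rcases hmX z h hzX with rfl | rfl
      exacts [Or.inl le_rfl, Or.inr le_rfl]
    · exact Or.inr (hhigh z h)
  set m := P.getVert (innerDist Γ C v a' + 1) with hm
  have hmi : innerDist Γ C v m = innerDist Γ C v a' + 1 := hP.innerDist_getVert (by omega)
  have hmX' : m ∈ X := P.getVert_mem_support _
  have hmP' : m ∉ P'.support := fun h => by
    rcases hXP' m hmX' h with h | h <;> omega
  -- points on the `B` side stay on that side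
  have hUP : ∀ z ∈ sideOf Γ B C X, z ∉ P'.support := by
    intro z hz hzP
    rcases (hmem' z).1 hzP with h | h | h
    · obtain ⟨K, hK, -, hzK, -⟩ := hz
      exact (hK hzK).2 (P.support_takeUntil_subset_support ha' h)
    · exact hmB z h hz
    · obtain ⟨K, hK, -, hzK, -⟩ := hz
      exact (hK hzK).2 (P.support_dropUntil_subset_support hb' h)
  have hside : ∀ K ⊆ C \ X, ConnIn Γ K → Touch Γ K B → K ⊆ C \ {z | z ∈ P'.support} :=
    fun K hK hKc hKB z hz => ⟨(hK hz).1, hUP z ⟨K, hK, hKc, hz, hKB⟩⟩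
  have hle : sideOf Γ B C X ⊆ sideOf Γ B C {z | z ∈ P'.support} := by
    rintro z ⟨K, hK, hKc, hzK, hKB⟩
    exact ⟨K, hside K hK hKc hKB, hKc, hzK, hKB⟩
  have hmU : m ∈ sideOf Γ B C {z | z ∈ P'.support} := by
    have hnl : ¬ Linked Γ (X \ {m}) v w := by
      intro hq
      have hv0 : innerDist Γ C v v = 0 := Nat.eq_zero_of_le_zero (innerDist_le (.nil' v) (by simpa))
      have hwP : innerDist Γ C v w = P.length := hP.length.symm
      obtain ⟨x, y, hx, hxy, hyX, hya, -⟩ :=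
        hq.exists_exit (A := {z | innerDist Γ C v z ≤ innerDist Γ C v a'}) (by simp [hv0]) (by
          simp only [Set.mem_ofPred]
          omega)
      have hxX := hx.right_mem
      have h1 := hlip x hxX.1.1 y hxy.toWalk (by simp [hXC hxX.1.1, hXC hyX.1])
      have h2 := hxX.2
      simp only [Set.mem_ofPred] at h2 hya
      have h3 : hxy.toWalk.length = 1 := by simp
      exact hyX.2 (hP.injOn hyX.1 hmX' (by omega))
    have := (not_congr (hS (X \ {m}) (Set.sdiff_subset.trans hXC))).1 hnl
    push Not at this
    obtain ⟨K, hK, hKc, hKA, hKB⟩ := this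
    have hmK : m ∈ K := by
      by_contra hmK
      refine hno ⟨K, fun z hz => ⟨(hK hz).1, fun hzX => (hK hz).2 ⟨hzX, ?_⟩⟩, hKc, hKA, hKB⟩
      rintro rfl
      exact hmK hz
    obtain ⟨k, hk, b, hb, hkb⟩ := hKB
    by_cases hkm : k = m
    · refine ⟨{m}, ?_, connIn_singleton, rfl, m, rfl, b, hb, hkm ▸ hkb⟩
      rintro _ rfl
      exact ⟨hXC hmX', hmP'⟩
    · obtain ⟨x, y, hkx, hxy, hyK, hym, -⟩ := (hKc k hk m hmK).exists_exit (A := {m}ᶜ) hkm (by simp)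
      have hym' : y = m := by simpa using hym
      rw [hym'] at hxy
      have hsub : comp Γ (K ∩ {m}ᶜ) k ⊆ C \ X := fun z hz => by
        have h1 := comp_subset hz
        exact ⟨(hK h1.1).1, fun hzX => (hK h1.1).2 ⟨hzX, h1.2⟩⟩
      have hkc : Touch Γ (comp Γ (K ∩ {m}ᶜ) k) B := ⟨k, mem_comp_self ⟨hk, hkm⟩, b, hb, hkb⟩
      refine ⟨insert m (comp Γ (K ∩ {m}ᶜ) k), ?_, connIn_comp.insert hkx hxy, by simp,
        hkc.mono (Set.subset_insert _ _) subset_rfl⟩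
      exact Set.insert_subset ⟨hXC hmX', hmP'⟩ (hside _ hsub connIn_comp hkc)
  have hlt : (sideOf Γ B C X).ncard < (sideOf Γ B C {z | z ∈ P'.support}).ncard := by
    refine Set.ncard_lt_ncard ⟨hle, fun hsub => ?_⟩ (Set.toFinite _)
    obtain ⟨K, hK, -, hmK, -⟩ := hsub hmU
    exact (hK hmK).2 hmX'
  exact absurd (hmax P' hg') (not_le.2 hlt)

end PlanarDcol

namespace PlanarDcol

/-- The history of a region of the decomposition: its ancestors carry a region `C`, a geodesic
piece `X` removed from it, the component `D` of the rest that is followed, the saving `g`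
that walks through `D` are guaranteed, and the (at most two) parents bounding `C`. -/
inductive Anc (W : Type*) where
  | nil : Anc W
  | mk (C X D : Set W) (g : ℕ) (p q : Anc W) : Anc W

namespace Anc

variable {W : Type*}

/-- The region. -/
def C : Anc W → Set W
  | nil => Set.univ
  | mk C _ _ _ _ _ => C

/-- The piece. -/
def X : Anc W → Set W
  | nil => ∅
  | mk _ X _ _ _ _ => X

/-- The component that is followed. -/
def D : Anc W → Set W
  | nil => Set.univ
  | mk _ _ D _ _ _ => D

/-- The saving. -/
def g : Anc W → ℕ
  | nil => 0
  | mk _ _ _ g _ _ => g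

/-- The younger parent. -/
def p : Anc W → Anc W
  | nil => nil
  | mk _ _ _ _ p _ => p

/-- The elder parent. -/
def q : Anc W → Anc W
  | nil => nil
  | mk _ _ _ _ _ q => q

end Anc

variable {W : Type*} {Γ : SimpleGraph W}

/-- `C` is a region bounded by the pieces of `p` and `q`. -/
structure Bounded (Γ : SimpleGraph W) (C : Set W) (p q : Anc W) : Prop where
  nbr : ∀ c ∈ C, ∀ x, Γ.Adj c x → x ∈ p.X ∨ x ∈ q.X ∨ x ∈ C
  subp : C ⊆ p.D
  subq : C ⊆ q.D
  parent : q = .nil ∨ q = p.p ∨ q = p.q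
  saving : q = .nil ∨ 1 ≤ p.g + q.g

/-- `X` is a geodesic piece of `C`, indexed by `idx`. -/
structure IsPiece (Γ : SimpleGraph W) (C X : Set W) (idx : W → ℕ) : Prop where
  sub : X ⊆ C
  inj : Set.InjOn idx X
  walk : ∀ a ∈ X, ∀ b ∈ X, idx a ≤ idx b → ∃ q : Γ.Walk a b, (∀ z ∈ q.support, z ∈ X) ∧
    idx a + q.length = idx b
  le : ∀ a ∈ X, ∀ b ∈ X, ∀ p : Γ.Walk a b, (∀ z ∈ p.support, z ∈ C) → idx b ≤ idx a + p.length

/-- Walks of `C` between points of `X` that meet `D` are longer than needed by at least `g`. -/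
def Saves (Γ : SimpleGraph W) (C X D : Set W) (idx : W → ℕ) (g : ℕ) : Prop :=
  ∀ a ∈ X, ∀ b ∈ X, ∀ p : Γ.Walk a b, (∀ z ∈ p.support, z ∈ C) → ∀ y ∈ p.support, y ∈ D →
    idx b + g ≤ idx a + p.length

/-- Every level of the history satisfies the conditions of the decomposition. -/
def Anc.Valid (Γ : SimpleGraph W) : Anc W → Prop
  | nil => True
  | mk C X D g p q => Bounded Γ C p q ∧ (∃ idx, IsPiece Γ C X idx ∧ Saves Γ C X D idx g) ∧
      D ⊆ C \ X ∧ p.Valid Γ ∧ q.Valid Γ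

/-- In the order `L`, at each level the piece precedes the rest of the region. -/
def Anc.Below (L : LinearOrder W) : Anc W → Prop
  | nil => True
  | mk C X _ _ p q => (∀ u ∈ X, ∀ v ∈ C \ X, L.lt u v) ∧ p.Below L ∧ q.Below L

namespace Anc

theorem Valid.p {a : Anc W} (h : a.Valid Γ) : a.p.Valid Γ := by
  cases a
  · trivial
  · exact h.2.2.2.1

theorem Valid.q {a : Anc W} (h : a.Valid Γ) : a.q.Valid Γ := by
  cases a
  · trivial
  · exact h.2.2.2.2

theorem Valid.bounded {a : Anc W} (h : a.Valid Γ) : Bounded Γ a.C a.p a.q := by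
  cases a
  · exact ⟨fun _ _ _ _ => Or.inr (Or.inr trivial), fun _ _ => trivial, fun _ _ => trivial,
      Or.inl rfl, Or.inl rfl⟩
  · exact h.1

theorem Valid.exists_idx {a : Anc W} (h : a.Valid Γ) :
    ∃ idx, IsPiece Γ a.C a.X idx ∧ Saves Γ a.C a.X a.D idx a.g := by
  cases a
  · exact ⟨fun _ => 0, ⟨Set.empty_subset _, by simp [X], by simp [X], by simp [X]⟩,
      by simp [Saves, X]⟩
  · exact h.2.1

theorem Valid.D_subset {a : Anc W} (h : a.Valid Γ) : a.D ⊆ a.C \ a.X := by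
  cases a
  · exact fun _ _ => ⟨trivial, fun h => h⟩
  · exact h.2.2.1

theorem Valid.D_subset_C {a : Anc W} (h : a.Valid Γ) : a.D ⊆ a.C :=
  h.D_subset.trans Set.sdiff_subset

theorem Valid.X_subset {a : Anc W} (h : a.Valid Γ) : a.X ⊆ a.C := by
  obtain ⟨idx, h1, -⟩ := h.exists_idx
  exact h1.sub

theorem Valid.C_subset_p {a : Anc W} (h : a.Valid Γ) : a.C ⊆ a.p.C :=
  h.bounded.subp.trans h.p.D_subset_C

theorem Valid.C_subset_q {a : Anc W} (h : a.Valid Γ) : a.C ⊆ a.q.C :=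
  h.bounded.subq.trans h.q.D_subset_C

theorem Below.p {L : LinearOrder W} {a : Anc W} (h : a.Below L) : a.p.Below L := by
  cases a
  · trivial
  · exact h.2.1

theorem Below.q {L : LinearOrder W} {a : Anc W} (h : a.Below L) : a.q.Below L := by
  cases a
  · trivial
  · exact h.2.2

theorem Below.lt {L : LinearOrder W} {a : Anc W} (h : a.Below L) :
    ∀ u ∈ a.X, ∀ v ∈ a.C \ a.X, L.lt u v := by
  cases a
  · exact fun u hu => hu.elim
  · exact h.1

end Anc

/-- The points of the piece of `a` reached from the timed points of `R` inside the region. -/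
def ext (Γ : SimpleGraph W) (a : Anc W) (R : Set (ℕ × W)) : Set (ℕ × W) :=
  {z | z.2 ∈ a.X ∧ ∃ t v, (t, v) ∈ R ∧ ∃ p : Γ.Walk v z.2, (∀ u ∈ p.support, u ∈ a.C) ∧
    z.1 = t + p.length}

/-- Any two timed points of `R` are joined inside `U` by a walk that is shorter by `c` than the
sum of their times. -/
def Close (Γ : SimpleGraph W) (c : ℕ) (U : Set W) (R : Set (ℕ × W)) : Prop :=
  ∀ t v s w, (t, v) ∈ R → (s, w) ∈ R →
    ∃ p : Γ.Walk v w, (∀ z ∈ p.support, z ∈ U) ∧ p.length + c ≤ t + s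

/-- The points reached within four steps. -/
def hits (R : Set (ℕ × W)) : Set W := {x | ∃ t ≤ 4, (t, x) ∈ R}

/-- The points reached by leaving at most `k` nested regions. -/
def chase (Γ : SimpleGraph W) : ℕ → Anc W → Anc W → Set (ℕ × W) → Set (ℕ × W)
  | 0, _, _, _ => ∅
  | k + 1, p, q, R => (ext Γ p R ∪ chase Γ k p.p p.q (ext Γ p R)) ∪
      (ext Γ q R ∪ chase Γ k q.p q.q (ext Γ q R))

theorem ext_nil (R : Set (ℕ × W)) : ext Γ .nil R = ∅ := by
  ext z
  simp [ext, Anc.X]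

theorem ext_ext_subset {a b : Anc W} (h : b.C ⊆ a.C) (R : Set (ℕ × W)) :
    ext Γ a (ext Γ b R) ⊆ ext Γ a R := by
  rintro ⟨t, x⟩ ⟨hx, s, v, ⟨hv, s', v', hR, p', hp', hl'⟩, p, hp, hl⟩
  dsimp only at hl hl'
  refine ⟨hx, s', v', hR, p'.append p, fun u hu => ?_, by simp only [Walk.length_append]; omega⟩
  rw [Walk.mem_support_append_iff] at hu
  exact hu.elim (fun hu => h (hp' u hu)) (hp u)

theorem ext_mono {a : Anc W} {R R' : Set (ℕ × W)} (h : R ⊆ R') : ext Γ a R ⊆ ext Γ a R' := by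
  rintro z ⟨hx, s, v, hR, p⟩
  exact ⟨hx, s, v, h hR, p⟩

theorem Close.ext {c : ℕ} {U : Set W} {R : Set (ℕ × W)} (h : Close Γ c U R) {a : Anc W}
    (ha : a.Valid Γ) (hU : U ⊆ a.D) : Close Γ (c + a.g) a.X (ext Γ a R) := by
  obtain ⟨idx, hP, hS⟩ := ha.exists_idx
  have key : ∀ t v t' v', (t, v) ∈ PlanarDcol.ext Γ a R → (t', v') ∈ PlanarDcol.ext Γ a R →
      idx v ≤ idx v' → ∃ p : Γ.Walk v v', (∀ z ∈ p.support, z ∈ a.X) ∧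
        p.length + (c + a.g) ≤ t + t' := by
    rintro t x t' x' ⟨hx, s, v, hv, p, hp, hl⟩ ⟨hx', s', v', hv', p', hp', hl'⟩ hle
    obtain ⟨m, hm, hml⟩ := h _ _ _ _ hv hv'
    obtain ⟨w, hw, hwl⟩ := hP.walk x hx x' hx' hle
    refine ⟨w, hw, ?_⟩
    have := hS x hx x' hx' (p.reverse.append (m.append p')) (by
      intro z hz
      simp only [Walk.mem_support_append_iff, Walk.support_reverse, List.mem_reverse] at hz
      rcases hz with hz | hz | hz
      exacts [hp z hz, ha.D_subset_C (hU (hm z hz)), hp' z hz]) v (by simp)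
      (hU (hm v m.start_mem_support))
    simp only [Walk.length_append, Walk.length_reverse] at this
    dsimp only at hl hl'
    omega
  intro t v t' v' hv hv'
  rcases le_total (idx v) (idx v') with hle | hle
  · exact key t v t' v' hv hv' hle
  · obtain ⟨p, hp, hl⟩ := key t' v' t v hv' hv hle
    exact ⟨p.reverse, by simpa using hp, by simp; omega⟩

theorem Close.ncard_hits_le [Finite W] {c : ℕ} {U : Set W} {R : Set (ℕ × W)} (h : Close Γ c U R)
    {a : Anc W} (ha : a.Valid Γ) (hU : U ⊆ a.D) :
    (hits (PlanarDcol.ext Γ a R)).ncard ≤ 9 - (c + a.g) := by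
  obtain ⟨idx, hP, -⟩ := ha.exists_idx
  have hcl := h.ext ha hU
  set S := hits (PlanarDcol.ext Γ a R) with hS
  have hSX : S ⊆ a.X := by
    rintro x ⟨t, -, hx, -⟩
    exact hx
  have hd : ∀ x ∈ S, ∀ y ∈ S, idx y + (c + a.g) ≤ idx x + 8 := by
    rintro x ⟨t, ht, hx⟩ y ⟨t', ht', hy⟩
    obtain ⟨p, hp, hl⟩ := hcl _ _ _ _ hx hy
    have := hP.le x hx.1 y hy.1 p (fun z hz => hP.sub (hp z hz))
    omega
  rcases S.eq_empty_or_nonempty with h0 | hne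
  · rw [h0]; simp
  obtain ⟨x, hx, hmin⟩ := Set.exists_min_image S idx S.toFinite hne
  have h1 : (idx '' S).ncard = S.ncard := (hP.inj.mono hSX).ncard_image
  have h2 : idx '' S ⊆ (Finset.Icc (idx x) (idx x + 8 - (c + a.g)) : Finset ℕ) := by
    rintro _ ⟨y, hy, rfl⟩
    have := hd x hx y hy
    have := hmin y hy
    simp only [Finset.coe_Icc, Set.mem_Icc]
    omega
  have h3 := Set.ncard_le_ncard h2 (Finset.finite_toSet _)
  rw [Set.ncard_coe_finset, Nat.card_Icc] at h3
  have := hd x hx x hx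
  omega

end PlanarDcol

namespace PlanarDcol

section

variable {W : Type*} {Γ : SimpleGraph W}

/-- A walk that leaves `A` splits where it does so first. -/
theorem exists_exit_split {A : Set W} {v x : W} (w : Γ.Walk v x) (hv : v ∈ A) (hx : x ∉ A) :
    ∃ a ∈ A, ∃ b, Γ.Adj a b ∧ b ∉ A ∧ ∃ (w₁ : Γ.Walk v b) (w₂ : Γ.Walk b x),
      w₁.length + w₂.length = w.length ∧ 1 ≤ w₁.length ∧
      (∀ z ∈ w₁.support, z ∈ A ∨ z = b) ∧ ∀ z ∈ w₂.support, z ∈ w.support := by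
  induction w with
  | nil => exact absurd hv hx
  | @cons u m x h q ih =>
    by_cases hm : m ∈ A
    · obtain ⟨a, ha, b, hab, hb, w₁, w₂, h1, h2, h3, h4⟩ := ih hm hx
      refine ⟨a, ha, b, hab, hb, w₁.cons h, w₂, by simp only [Walk.length_cons]; omega,
        by simp, ?_, fun z hz => by simp [h4 z hz]⟩
      intro z hz
      rw [Walk.support_cons, List.mem_cons] at hz
      rcases hz with rfl | hz
      exacts [Or.inl hv, h3 z hz]
    · refine ⟨u, hv, m, h, hm, h.toWalk, q, by simp [Nat.add_comm], by simp, ?_,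
        fun z hz => by simp [hz]⟩
      intro z hz
      simp only [Walk.support_cons, Walk.support_nil, List.mem_cons, List.not_mem_nil,
        or_false] at hz
      rcases hz with rfl | rfl
      exacts [Or.inl hv, Or.inr rfl]

/-- A walk inside a region whose endpoint is its minimum never leaves the region. -/
theorem Bounded.mem_of_le {C : Set W} {p q : Anc W} {L : LinearOrder W} (h : Bounded Γ C p q)
    (hp : p.Valid Γ) (hq : q.Valid Γ) (hpL : p.Below L) (hqL : q.Below L) {v x : W} (hv : v ∈ C)
    (hx : x ∈ C) (w : Γ.Walk v x) (hw : ∀ z ∈ w.support, L.le x z) :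
    ∀ z ∈ w.support, z ∈ C := by
  classical
  intro z hz
  by_contra hzC
  obtain ⟨a, ha, b, hab, hb, w₁, w₂, -, -, -, h4⟩ :=
    exists_exit_split (w.takeUntil z hz) hv hzC
  have hxb : L.le x b := hw b (w.support_takeUntil_subset_support hz
    (h4 b w₂.start_mem_support))
  have hlt : L.lt b x := by
    rcases h.nbr a ha b hab with h1 | h1 | h1
    · exact hpL.lt b h1 x (hp.D_subset (h.subp hx))
    · exact hqL.lt b h1 x (hq.D_subset (h.subq hx))
    · exact absurd h1 hb
  exact absurd hxb (@not_le_of_gt _ L.toPreorder _ _ hlt)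

theorem mem_ext_or_chase {ℓ : Anc W} {L : LinearOrder W} {C : Set W} {R : Set (ℕ × W)} {k : ℕ}
    (hℓ : ℓ.Valid Γ) (hL : ℓ.Below L) (hC : C ⊆ ℓ.D) {t : ℕ} {v b x : W} (hR : (t, v) ∈ R)
    (hb : b ∈ ℓ.X) (w₁ : Γ.Walk v b) (w₂ : Γ.Walk b x) (h₁ : ∀ z ∈ w₁.support, z ∈ C ∨ z = b)
    (hx : ∀ z ∈ w₂.support, L.le x z)
    (ih : (t + w₁.length, b) ∈ ext Γ ℓ R → x ∉ ℓ.C →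
      (t + w₁.length + w₂.length, x) ∈ chase Γ k ℓ.p ℓ.q (ext Γ ℓ R)) :
    (t + w₁.length + w₂.length, x) ∈ ext Γ ℓ R ∪ chase Γ k ℓ.p ℓ.q (ext Γ ℓ R) := by
  have h₁' : ∀ z ∈ w₁.support, z ∈ ℓ.C := by
    intro z hz
    rcases h₁ z hz with h | rfl
    exacts [hℓ.D_subset_C (hC h), hℓ.X_subset hb]
  by_cases hxC : x ∈ ℓ.C
  · left
    have hin := hℓ.bounded.mem_of_le hℓ.p hℓ.q hL.p hL.q (hℓ.X_subset hb) hxC w₂ hx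
    refine ⟨?_, t, v, hR, w₁.append w₂, ?_, by simp only [Walk.length_append]; omega⟩
    · by_contra hxX
      exact absurd (hx b w₂.start_mem_support)
        (@not_le_of_gt _ L.toPreorder _ _ (hL.lt b hb x ⟨hxC, hxX⟩))
    · intro z hz
      rw [Walk.mem_support_append_iff] at hz
      exact hz.elim (h₁' z) (hin z)
  · exact Or.inr (ih ⟨hb, t, v, hR, w₁, h₁', rfl⟩ hxC)

/-- A short walk leaving a region for its minimum ends at a chased point. -/
theorem mem_chase {L : LinearOrder W} (k : ℕ) : ∀ {C : Set W} {p q : Anc W} {R : Set (ℕ × W)},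
    Bounded Γ C p q → p.Valid Γ → q.Valid Γ → p.Below L → q.Below L → ∀ {t : ℕ} {v x : W},
    (t, v) ∈ R → v ∈ C → ∀ w : Γ.Walk v x, w.length ≤ k → (∀ z ∈ w.support, L.le x z) → x ∉ C →
    (t + w.length, x) ∈ chase Γ k p q R := by
  induction k with
  | zero =>
    intro C p q R _ _ _ _ _ t v x _ hv w hw _ hx
    cases w with
    | nil => exact absurd hv hx
    | cons => simp at hw
  | succ k ih =>
    intro C p q R h hp hq hpL hqL t v x hR hv w hw hle hx
    obtain ⟨a, ha, b, hab, hb, w₁, w₂, h1, h2, h3, h4⟩ := exists_exit_split w hv hx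
    have hle₂ : ∀ z ∈ w₂.support, L.le x z := fun z hz => hle z (h4 z hz)
    have key : ∀ ℓ : Anc W, ℓ.Valid Γ → ℓ.Below L → C ⊆ ℓ.D → b ∈ ℓ.X →
        (t + w₁.length + w₂.length, x) ∈ ext Γ ℓ R ∪ chase Γ k ℓ.p ℓ.q (ext Γ ℓ R) := by
      intro ℓ hℓ hL hC hbX
      exact mem_ext_or_chase hℓ hL hC hR hbX w₁ w₂ h3 hle₂ fun h5 h6 =>
        ih hℓ.bounded hℓ.p hℓ.q hL.p hL.q h5 (hℓ.X_subset hbX) w₂ (by omega) hle₂ h6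
    rw [← h1, ← Nat.add_assoc]
    rcases h.nbr a ha b hab with hbX | hbX | hbX
    · exact Or.inl (key p hp hpL h.subp hbX)
    · exact Or.inr (key q hq hqL h.subq hbX)
    · exact absurd hbX hb

end

variable {W : Type} {Γ : SimpleGraph W}

/-- The points of `C` reached from `y` inside `C`, with the times of arrival. -/
def start (Γ : SimpleGraph W) (C : Set W) (y : W) : Set (ℕ × W) :=
  {z | ∃ w : Γ.Walk y z.2, (∀ u ∈ w.support, u ∈ C) ∧ z.1 = w.length}

theorem close_start (C : Set W) (y : W) : Close Γ 0 C (start Γ C y) := by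
  rintro t v t' v' ⟨w, hw, hl⟩ ⟨w', hw', hl'⟩
  dsimp only at hl hl'
  refine ⟨w.reverse.append w', fun z hz => ?_, ?_⟩
  · rw [Walk.mem_support_append_iff, Walk.support_reverse, List.mem_reverse] at hz
    exact hz.elim (hw z) (hw' z)
  · simp only [Walk.length_append, Walk.length_reverse]
    omega

theorem dReach_four_subset {C X : Set W} {p q : Anc W} {L : LinearOrder W} {idx : W → ℕ}
    (h : Bounded Γ C p q) (hp : p.Valid Γ) (hq : q.Valid Γ) (hpL : p.Below L) (hqL : q.Below L)
    (hX : IsPiece Γ C X idx) (hXL : ∀ u ∈ X, ∀ v ∈ C \ X, L.lt u v)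
    (hidx : ∀ u ∈ X, ∀ v ∈ X, idx u < idx v → L.lt u v) {y : W} (hy : y ∈ X) :
    DReach Γ L 4 y ⊆ {x ∈ X | idx x ≤ idx y ∧ idx y ≤ idx x + 4} ∪
      hits (chase Γ 3 p q (start Γ C y)) := by
  rintro x ⟨P, -, hlen, hmin, hfar⟩
  have hyC := hX.sub hy
  have hmin' : ∀ z ∈ P.reverse.support, L.le x z := by simpa using hmin
  by_cases hxC : x ∈ C
  · left
    have hin := h.mem_of_le hp hq hpL hqL hyC hxC P.reverse hmin'
    have hxX : x ∈ X := by
      by_contra hxX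
      exact absurd (hmin y P.end_mem_support)
        (@not_le_of_gt _ L.toPreorder _ _ (hXL y hy x ⟨hxC, hxX⟩))
    refine ⟨hxX, ?_, ?_⟩
    · by_contra hlt
      exact absurd (hmin y P.end_mem_support)
        (@not_le_of_gt _ L.toPreorder _ _ (hidx y hy x hxX (by omega)))
    · have := hX.le x hxX y hy P (by simpa using hin)
      omega
  · right
    rcases Nat.lt_or_ge P.length 4 with h3 | h4
    · refine ⟨P.length, hlen, ?_⟩
      have := mem_chase 3 h hp hq hpL hqL (t := 0) (R := start Γ C y) (v := y)
        ⟨Walk.nil, by simpa using hyC, rfl⟩ hyC P.reverse (by simp; omega) hmin' hxC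
      simpa using this
    · have hl : P.length = 4 := le_antisymm hlen h4
      have hz : L.le y (P.getVert 3) := by
        have := hfar 3 le_rfl (by omega)
        have hg : P.support.getD 3 y = P.getVert 3 := by
          rw [Walk.getVert_eq_support_getElem P (by omega), List.getD_eq_getElem]
        rwa [hg] at this
      have hadj : Γ.Adj (P.getVert 3) y := by
        have := P.adj_getVert_succ (i := 3) (by omega)
        rwa [show 3 + 1 = P.length by omega, Walk.getVert_length] at this
      have hzC : P.getVert 3 ∈ C := by
        rcases h.nbr y hyC _ hadj.symm with h1 | h1 | h1
        · exact absurd hz (@not_le_of_gt _ L.toPreorder _ _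
            (hpL.lt _ h1 y (hp.D_subset (h.subp hyC))))
        · exact absurd hz (@not_le_of_gt _ L.toPreorder _ _
            (hqL.lt _ h1 y (hq.D_subset (h.subq hyC))))
        · exact h1
      have hl3 : (P.take 3).length = 3 := by simp [hl]
      refine ⟨4, le_rfl, ?_⟩
      have := mem_chase 3 h hp hq hpL hqL (t := 1) (R := start Γ C y) (v := P.getVert 3)
        ⟨hadj.symm.toWalk, by simp [hyC, hzC], by simp⟩ hzC (P.take 3).reverse (by simp) ?_ hxC
      · simpa [hl] using this
      · intro z hz
        rw [Walk.support_reverse, List.mem_reverse] at hz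
        exact hmin z ((P.isSubwalk_take 3).support_subset hz)

theorem ncard_dReach_four_le [Finite W] {C X : Set W} {p q : Anc W} {L : LinearOrder W}
    {idx : W → ℕ}
    (h : Bounded Γ C p q) (hp : p.Valid Γ) (hq : q.Valid Γ) (hpL : p.Below L) (hqL : q.Below L)
    (hX : IsPiece Γ C X idx) (hXL : ∀ u ∈ X, ∀ v ∈ C \ X, L.lt u v)
    (hidx : ∀ u ∈ X, ∀ v ∈ X, idx u < idx v → L.lt u v) {y : W} (hy : y ∈ X) :
    (DReach Γ L 4 y).ncard ≤ 5 + (hits (chase Γ 3 p q (start Γ C y))).ncard := by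
  refine (Set.ncard_le_ncard (dReach_four_subset h hp hq hpL hqL hX hXL hidx hy)
    (Set.toFinite _)).trans ((Set.ncard_union_le _ _).trans (Nat.add_le_add_right ?_ _))
  set S := {x ∈ X | idx x ≤ idx y ∧ idx y ≤ idx x + 4} with hS
  have h1 : (idx '' S).ncard = S.ncard := (hX.inj.mono fun x hx => hx.1).ncard_image
  have h2 : idx '' S ⊆ (Finset.Icc (idx y - 4) (idx y) : Finset ℕ) := by
    rintro _ ⟨x, hx, rfl⟩
    have := hx.2
    simp only [Finset.coe_Icc, Set.mem_Icc]
    omega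
  have h3 := Set.ncard_le_ncard h2 (Finset.finite_toSet _)
  rw [Set.ncard_coe_finset, Nat.card_Icc] at h3
  omega

end PlanarDcol

namespace PlanarDcol

variable {W : Type*} {Γ : SimpleGraph W} {C : Set W} {R : Set (ℕ × W)}

namespace Anc

@[simp] theorem nil_p : (nil : Anc W).p = nil := rfl

@[simp] theorem nil_q : (nil : Anc W).q = nil := rfl

/-- The saving, cut off at one. -/
def s (a : Anc W) : ℕ := min a.g 1

/-- The ancestors up to the second generation. -/
def line (a : Anc W) : List (Anc W) := [a, a.p, a.q, a.p.p, a.p.q, a.q.p, a.q.q]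

/-- The region `C` lies in the followed component of a valid history. -/
def Over (Γ : SimpleGraph W) (C : Set W) (a : Anc W) : Prop := a.Valid Γ ∧ C ⊆ a.D

theorem Over.p {a : Anc W} (h : a.Over Γ C) : a.p.Over Γ C :=
  ⟨h.1.p, h.2.trans (h.1.D_subset_C.trans h.1.bounded.subp)⟩

theorem Over.q {a : Anc W} (h : a.Over Γ C) : a.q.Over Γ C :=
  ⟨h.1.q, h.2.trans (h.1.D_subset_C.trans h.1.bounded.subq)⟩

theorem one_le_s_add {a b : Anc W} (h : 1 ≤ a.g + b.g) : 1 ≤ a.s + b.s := by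
  unfold s
  omega

end Anc

theorem ncard_hits_ext_le [Finite W] (h : Close Γ 0 C R) {a : Anc W} (ha : a.Over Γ C) :
    (hits (ext Γ a R)).ncard + a.s ≤ 9 := by
  have := h.ncard_hits_le ha.1 ha.2
  unfold Anc.s
  omega

theorem ncard_hits_ext_ext_le [Finite W] (h : Close Γ 0 C R) {a b : Anc W} (ha : a.Over Γ C)
    (hb : b.Valid Γ) (hab : a.C ⊆ b.D) :
    (hits (ext Γ b (ext Γ a R))).ncard + (a.s + b.s) ≤ 9 := by
  have := (h.ext ha.1 ha.2).ncard_hits_le hb (ha.1.X_subset.trans hab)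
  unfold Anc.s
  omega

theorem ncard_hits_ext_ext_ext_le [Finite W] (h : Close Γ 0 C R) {a b c : Anc W}
    (ha : a.Over Γ C) (hb : b.Valid Γ) (hab : a.C ⊆ b.D) (hc : c.Valid Γ) (hbc : b.C ⊆ c.D) :
    (hits (ext Γ c (ext Γ b (ext Γ a R)))).ncard + (a.s + b.s + c.s) ≤ 9 := by
  have := ((h.ext ha.1 ha.2).ext hb (ha.1.X_subset.trans hab)).ncard_hits_le hc
    (hb.X_subset.trans hbc)
  unfold Anc.s
  omega

theorem ncard_hits_le_sum [Finite W] {S : Set (ℕ × W)} (l : List (Set (ℕ × W)))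
    (h : ∀ z ∈ S, ∃ T ∈ l, z ∈ T) : (hits S).ncard ≤ (l.map fun T => (hits T).ncard).sum := by
  induction l generalizing S with
  | nil =>
    have : S = ∅ := Set.eq_empty_of_forall_notMem fun z hz => by simpa using h z hz
    simp [this, hits]
  | cons T l ih =>
    rw [List.map_cons, List.sum_cons]
    have h1 : hits S ⊆ hits T ∪ hits {z ∈ S | ∃ T ∈ l, z ∈ T} := by
      rintro x ⟨t, ht, hx⟩
      obtain ⟨T', hT', hx'⟩ := h _ hx
      rcases List.mem_cons.1 hT' with rfl | hl
      · exact Or.inl ⟨t, ht, hx'⟩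
      · exact Or.inr ⟨t, ht, hx, T', hl, hx'⟩
    refine (Set.ncard_le_ncard h1 (Set.toFinite _)).trans ((Set.ncard_union_le _ _).trans ?_)
    exact Nat.add_le_add_left (ih fun z hz => hz.2) _

theorem ext_p_subset {a : Anc W} (ha : a.Valid Γ) : ext Γ a.p (ext Γ a R) ⊆ ext Γ a.p R :=
  ext_ext_subset ha.C_subset_p R

theorem ext_q_subset {a : Anc W} (ha : a.Valid Γ) : ext Γ a.q (ext Γ a R) ⊆ ext Γ a.q R :=
  ext_ext_subset ha.C_subset_q R

theorem mem_ext_line {a : Anc W} (ha : a.Valid Γ) {z : ℕ × W}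
    (hz : z ∈ ext Γ a R ∪ chase Γ 2 a.p a.q (ext Γ a R)) : ∃ b ∈ a.line, z ∈ ext Γ b R := by
  have hp := ext_p_subset (R := R) ha
  have hq := ext_q_subset (R := R) ha
  simp only [chase, Set.union_empty, Set.mem_union] at hz
  rcases hz with hz | (hz | hz | hz) | (hz | hz | hz)
  · exact ⟨a, by simp [Anc.line], hz⟩
  · exact ⟨a.p, by simp [Anc.line], hp hz⟩
  · exact ⟨a.p.p, by simp [Anc.line], ext_p_subset ha.p (ext_mono hp hz)⟩
  · exact ⟨a.p.q, by simp [Anc.line], ext_q_subset ha.p (ext_mono hp hz)⟩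
  · exact ⟨a.q, by simp [Anc.line], hq hz⟩
  · exact ⟨a.q.p, by simp [Anc.line], ext_p_subset ha.q (ext_mono hq hz)⟩
  · exact ⟨a.q.q, by simp [Anc.line], ext_q_subset ha.q (ext_mono hq hz)⟩

/-- If few ancestors are relevant, few points are chased. -/
theorem ncard_hits_chase_le_sum [Finite W] (h : Close Γ 0 C R) {p q : Anc W} (hp : p.Valid Γ)
    (hq : q.Valid Γ) (l : List (Anc W)) (hl : ∀ a ∈ l, a.Over Γ C)
    (hsub : ∀ a ∈ p.line ++ q.line, a = .nil ∨ a ∈ l) :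
    (hits (chase Γ 3 p q R)).ncard ≤ (l.map fun a => 9 - a.s).sum := by
  have h1 := ncard_hits_le_sum (S := chase Γ 3 p q R) (l.map fun a => ext Γ a R) ?_
  · refine h1.trans ?_
    rw [List.map_map]
    refine List.sum_le_sum fun a ha => ?_
    have := ncard_hits_ext_le h (hl a ha)
    simp only [Function.comp]
    omega
  · intro z hz
    have h2 : ∃ b ∈ p.line ++ q.line, z ∈ ext Γ b R := by
      rw [chase] at hz
      rcases hz with hz | hz
      · obtain ⟨b, hb, hz⟩ := mem_ext_line hp hz
        exact ⟨b, List.mem_append_left _ hb, hz⟩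
      · obtain ⟨b, hb, hz⟩ := mem_ext_line hq hz
        exact ⟨b, List.mem_append_right _ hb, hz⟩
    obtain ⟨b, hb, hz⟩ := h2
    rcases hsub b hb with rfl | hb
    · rw [ext_nil] at hz
      exact hz.elim
    · exact ⟨_, List.mem_map_of_mem hb, hz⟩

/-- The case in which the savings of longer excursions are needed. -/
theorem ncard_hits_chase_le_of_far [Finite W] (h : Close Γ 0 C R) {y : Anc W}
    (hy : y.Over Γ C) (hs : 1 ≤ y.g + y.q.g) (hn : y.q ≠ .nil) (hz : y.q = y.p.q)
    (hO : y.q.q = y.q.p.q) (hO0 : y.q.q ≠ .nil) (hO2 : y.q.q.q ≠ .nil) :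
    (hits (chase Γ 3 y y.q R)).ncard ≤ 71 := by
  have ho := hy.q
  have h1 := ncard_hits_le_sum (S := chase Γ 3 y y.q R)
    [ext Γ y R, ext Γ y.p (ext Γ y R), ext Γ y.p.p (ext Γ y.p (ext Γ y R)),
      ext Γ y.q R, ext Γ y.q.p (ext Γ y.q R), ext Γ y.q.q (ext Γ y.q R),
      ext Γ y.q.p.p (ext Γ y.q.p (ext Γ y.q R)), ext Γ y.q.q.p (ext Γ y.q.q (ext Γ y.q R)),
      ext Γ y.q.q.q (ext Γ y.q.q (ext Γ y.q R))] ?_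
  · simp only [List.map_cons, List.map_nil, List.sum_cons, List.sum_nil] at h1
    have a1 := ncard_hits_ext_le h hy
    have a2 := ncard_hits_ext_ext_le h hy hy.1.p hy.1.bounded.subp
    have a3 := ncard_hits_ext_ext_ext_le h hy hy.1.p hy.1.bounded.subp hy.1.p.p
      hy.1.p.bounded.subp
    have a4 := ncard_hits_ext_le h ho
    have a5 := ncard_hits_ext_ext_le h ho ho.1.p ho.1.bounded.subp
    have a6 := ncard_hits_ext_ext_le h ho ho.1.q ho.1.bounded.subq
    have a7 := ncard_hits_ext_ext_ext_le h ho ho.1.p ho.1.bounded.subp ho.1.p.p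
      ho.1.p.bounded.subp
    have a8 := ncard_hits_ext_ext_ext_le h ho ho.1.q ho.1.bounded.subq ho.1.q.p
      ho.1.q.bounded.subp
    have a9 := ncard_hits_ext_ext_ext_le h ho ho.1.q ho.1.bounded.subq ho.1.q.q
      ho.1.q.bounded.subq
    have s1 := Anc.one_le_s_add hs
    have s2 := Anc.one_le_s_add (hy.1.bounded.saving.resolve_left hn)
    have s3 := Anc.one_le_s_add (hy.1.p.bounded.saving.resolve_left (hz ▸ hn))
    have s4 := Anc.one_le_s_add (ho.1.bounded.saving.resolve_left hO0)
    have s5 := Anc.one_le_s_add (ho.1.p.bounded.saving.resolve_left (hO ▸ hO0))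
    have s6 := Anc.one_le_s_add (ho.1.q.bounded.saving.resolve_left hO2)
    rw [← hz] at s3
    rw [← hO] at s5
    omega
  · intro z hmem
    have c1 := ext_q_subset (R := R) hy.1
    have c2 : ext Γ y.q (ext Γ y.p (ext Γ y R)) ⊆ ext Γ y.q R := by
      rw [hz]
      exact (ext_q_subset hy.1.p).trans (hz ▸ c1)
    have c3 : ext Γ y.q.q (ext Γ y.q.p (ext Γ y.q R)) ⊆ ext Γ y.q.q (ext Γ y.q R) := by
      rw [hO]
      exact ext_q_subset ho.1.p
    simp only [chase, Set.union_empty, Set.mem_union, ← hz, ← hO] at hmem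
    simp only [List.mem_cons, List.not_mem_nil, or_false, exists_eq_or_imp, exists_eq_left]
    have c4 := @c1 z
    have c5 := @c2 z
    have c6 := @c3 z
    have c7 : ext Γ y.q.p (ext Γ y.q (ext Γ y R)) ⊆ _ := ext_mono c1
    have c8 : ext Γ y.q.q (ext Γ y.q (ext Γ y R)) ⊆ _ := ext_mono c1
    replace c7 := @c7 z
    replace c8 := @c8 z
    grind

set_option maxHeartbeats 1000000 in
theorem ncard_hits_chase_le [Finite W] {p q : Anc W} (h : Bounded Γ C p q) (hp : p.Valid Γ)
    (hq : q.Valid Γ) (hR : Close Γ 0 C R) : (hits (chase Γ 3 p q R)).ncard ≤ 71 := by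
  have op : p.Over Γ C := ⟨hp, h.subp⟩
  have key : ∀ l : List (Anc W), (∀ a ∈ l, a.Over Γ C) →
      (∀ a ∈ p.line ++ q.line, a = .nil ∨ a ∈ l) → (l.map fun a => 9 - a.s).sum ≤ 71 →
      (hits (chase Γ 3 p q R)).ncard ≤ 71 := fun l hl hs hn =>
    (ncard_hits_chase_le_sum hR hp hq l hl hs).trans hn
  by_cases hn : q = .nil
  · subst hn
    refine key p.line ?_ (by simp [Anc.line]) ?_
    · simp [Anc.line, op, op.p, op.q, op.p.p, op.p.q, op.q.p, op.q.q]
    · simp only [Anc.line, List.map_cons, List.map_nil, List.sum_cons, List.sum_nil]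
      omega
  have hs := h.saving.resolve_left hn
  have hs' := Anc.one_le_s_add hs
  rcases h.parent.resolve_left hn with rfl | rfl
  · rcases op.p.1.bounded.parent with e | e | e
    · refine key [p, p.p, p.p.p, p.p.p.p, p.p.p.q] ?_ ?_ ?_
      · simp [op, op.p, op.p.p, op.p.p.p, op.p.p.q]
      · rcases op.1.bounded.parent with e' | e' | e' <;> simp [Anc.line, e', e]
      · simp only [List.map_cons, List.map_nil, List.sum_cons, List.sum_nil]
        omega
    · refine key [p, p.p, p.p.p, p.p.q, p.p.p.q, p.p.q.p, p.p.q.q] ?_ ?_ ?_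
      · simp [op, op.p, op.p.p, op.p.p.q, op.p.q, op.p.q.p, op.p.q.q]
      · rcases op.1.bounded.parent with e' | e' | e' <;> simp [Anc.line, e', e]
      · simp only [List.map_cons, List.map_nil, List.sum_cons, List.sum_nil]
        omega
    · refine key [p, p.p, p.p.p, p.p.q, p.p.p.p, p.p.q.p, p.p.q.q] ?_ ?_ ?_
      · simp [op, op.p, op.p.p, op.p.p.p, op.p.q, op.p.q.p, op.p.q.q]
      · rcases op.1.bounded.parent with e' | e' | e' <;> simp [Anc.line, e', e]
      · simp only [List.map_cons, List.map_nil, List.sum_cons, List.sum_nil]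
        omega
  rcases op.1.bounded.parent.resolve_left hn with ez | ez
  · have oo : p.q.Over Γ C := op.q
    rcases oo.1.bounded.parent with e | e | e
    · refine key [p, p.p, p.q, p.q.p, p.q.p.p, p.q.p.q] ?_ ?_ ?_
      · simp [op, op.p, oo, oo.p, oo.p.p, oo.p.q]
      · rcases op.p.1.bounded.parent with e' | e' | e' <;> (try rw [← ez] at e') <;>
          simp [Anc.line, e', e, ← ez]
      · simp only [List.map_cons, List.map_nil, List.sum_cons, List.sum_nil]
        omega
    · refine key [p, p.p, p.q, p.q.p, p.q.q, p.q.p.q, p.q.q.p, p.q.q.q] ?_ ?_ ?_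
      · simp [op, op.p, oo, oo.p, oo.q, oo.p.q, oo.q.p, oo.q.q]
      · rcases op.p.1.bounded.parent with e' | e' | e' <;> (try rw [← ez] at e') <;>
          simp [Anc.line, e', e, ← ez]
      · simp only [List.map_cons, List.map_nil, List.sum_cons, List.sum_nil]
        omega
    · refine key [p, p.p, p.q, p.q.p, p.q.q, p.q.p.p, p.q.q.p, p.q.q.q] ?_ ?_ ?_
      · simp [op, op.p, oo, oo.p, oo.q, oo.p.p, oo.q.p, oo.q.q]
      · rcases op.p.1.bounded.parent with e' | e' | e' <;> (try rw [← ez] at e') <;>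
          simp [Anc.line, e', e, ← ez]
      · simp only [List.map_cons, List.map_nil, List.sum_cons, List.sum_nil]
        omega
  · have oo : p.q.Over Γ C := op.q
    rcases oo.1.bounded.parent with e | e | e
    · refine key [p, p.p, p.p.p, p.q, p.q.p, p.q.p.p, p.q.p.q] ?_ ?_ ?_
      · simp [op, op.p, op.p.p, oo, oo.p, oo.p.p, oo.p.q]
      · simp [Anc.line, ← ez, e]
      · simp only [List.map_cons, List.map_nil, List.sum_cons, List.sum_nil]
        omega
    · refine key [p, p.p, p.p.p, p.q, p.q.p, p.q.q, p.q.q.p, p.q.q.q] ?_ ?_ ?_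
      · simp [op, op.p, op.p.p, oo, oo.p, oo.q, oo.q.p, oo.q.q]
      · rcases oo.p.1.bounded.parent with e' | e' | e' <;> (try rw [← e] at e') <;>
          simp [Anc.line, e', ← e, ← ez]
      · simp only [List.map_cons, List.map_nil, List.sum_cons, List.sum_nil]
        omega
    · by_cases hO : p.q.q = .nil
      · refine key [p, p.p, p.p.p, p.q, p.q.p, p.q.p.p, p.q.p.q] ?_ ?_ ?_
        · simp [op, op.p, op.p.p, oo, oo.p, oo.p.p, oo.p.q]
        · simp [Anc.line, ← ez, hO]
        · simp only [List.map_cons, List.map_nil, List.sum_cons, List.sum_nil]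
          omega
      by_cases hO2 : p.q.q.q = .nil
      · refine key [p, p.p, p.p.p, p.q, p.q.p, p.q.q, p.q.p.p, p.q.q.p] ?_ ?_ ?_
        · simp [op, op.p, op.p.p, oo, oo.p, oo.q, oo.p.p, oo.q.p]
        · simp [Anc.line, ← ez, hO2, ← e]
        · simp only [List.map_cons, List.map_nil, List.sum_cons, List.sum_nil]
          omega
      exact ncard_hits_chase_le_of_far hR op hs hn ez e hO hO2

end PlanarDcol

namespace PlanarDcol

section

variable {W : Type*} {Γ : SimpleGraph W}

/-- The regions occurring in the decomposition: connected, and bounded by pieces that are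
connected and touch the region and each other. -/
structure Reg (Γ : SimpleGraph W) (C : Set W) (p q : Anc W) : Prop where
  conn : ConnIn Γ C
  bdd : Bounded Γ C p q
  vp : p.Valid Γ
  vq : q.Valid Γ
  cp : ConnIn Γ p.X
  tp : p ≠ .nil → Touch Γ C p.X
  cq : ConnIn Γ q.X
  tq : q ≠ .nil → Touch Γ C q.X ∧ Touch Γ p.X q.X

theorem Reg.disjoint_p {C : Set W} {p q : Anc W} (h : Reg Γ C p q) : Disjoint p.X C :=
  Set.disjoint_left.2 fun _ hx hC => (h.vp.D_subset (h.bdd.subp hC)).2 hx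

theorem Reg.disjoint_q {C : Set W} {p q : Anc W} (h : Reg Γ C p q) : Disjoint q.X C :=
  Set.disjoint_left.2 fun _ hx hC => (h.vq.D_subset (h.bdd.subq hC)).2 hx

theorem Reg.disjoint {C : Set W} {p q : Anc W} (h : Reg Γ C p q) : Disjoint p.X q.X := by
  rw [Set.disjoint_left]
  intro x hp hq
  have hx := h.vp.X_subset hp
  rcases h.bdd.parent with e | e | e <;> rw [e] at hq
  · exact hq
  · exact (h.vp.p.D_subset (h.vp.bounded.subp hx)).2 hq
  · exact (h.vp.q.D_subset (h.vp.bounded.subq hx)).2 hq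

theorem subset_comp_of_mem {S K : Set W} {u x : W} (hK : ConnIn Γ K) (hKS : K ⊆ S) (hx : x ∈ K)
    (hxu : x ∈ comp Γ S u) : K ⊆ comp Γ S u := by
  rw [← comp_eq_of_mem hxu]
  exact hK.subset_comp hx hKS

theorem touch_comp_sdiff {C X : Set W} (hC : ConnIn Γ C) (hX : X ⊆ C) (hne : X.Nonempty) {u : W}
    (hu : u ∈ C \ X) : Touch Γ (comp Γ (C \ X) u) X := by
  obtain ⟨x, hx⟩ := hne
  obtain ⟨a, ha, b, hb, hbn, hab⟩ := hC.exists_exit (A := comp Γ (C \ X) u) hu.1 (hX hx)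
    (mem_comp_self hu) fun h => (comp_subset h).2 hx
  refine ⟨a, ha.2, b, ?_, hab⟩
  by_contra hbX
  exact hbn (comp_closed ha.2 ⟨hb, hbX⟩ hab)

/-- Removing a piece from a region leaves regions. -/
theorem Reg.exists_child {C X : Set W} {p q a b : Anc W} {idx : W → ℕ} (h : Reg Γ C p q)
    (hab : a = p ∧ b = q ∨ a = q ∧ b = p) (hX : IsPiece Γ C X idx) (hXc : ConnIn Γ X)
    (hne : X.Nonempty) (ta : a ≠ .nil → Touch Γ X a.X) (tb : b ≠ .nil → Touch Γ X b.X)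
    (hno : ¬ ∃ K ⊆ C \ X, ConnIn Γ K ∧ Touch Γ K a.X ∧ Touch Γ K b.X)
    (hb : b ≠ .nil → 1 ≤ b.g)
    (hs : ∀ u, ¬ Touch Γ (comp Γ (C \ X) u) b.X → Saves Γ C X (comp Γ (C \ X) u) idx 1)
    {u : W} (hu : u ∈ C \ X) :
    ∃ g o, (o = .nil ∨ o = p ∨ o = q) ∧
      Reg Γ (comp Γ (C \ X) u) (.mk C X (comp Γ (C \ X) u) g p q) o := by
  set D := comp Γ (C \ X) u with hD
  have hDs : D ⊆ C \ X := comp_subset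
  have main : ∀ g o, (o = .nil ∨ o = a ∨ o = b) → Saves Γ C X D idx g →
      (o = .nil ∨ 1 ≤ g + o.g) → (∀ c ∈ D, ∀ x, Γ.Adj c x → x ∈ a.X ∨ x ∈ b.X → x ∈ o.X) →
      (o ≠ .nil → Touch Γ D o.X ∧ Touch Γ X o.X) →
      ∃ g o, (o = .nil ∨ o = p ∨ o = q) ∧ Reg Γ D (.mk C X D g p q) o := by
    intro g o ho hsv hg hcov ht
    have ho' : o = .nil ∨ o = p ∨ o = q := by
      rcases hab with ⟨rfl, rfl⟩ | ⟨rfl, rfl⟩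
      · exact ho
      · exact ho.imp_right Or.symm
    have hor : o.Valid Γ ∧ ConnIn Γ o.X ∧ C ⊆ o.D := by
      rcases ho' with rfl | rfl | rfl
      · exact ⟨trivial, fun _ hx => hx.elim, fun _ _ => trivial⟩
      · exact ⟨h.vp, h.cp, h.bdd.subp⟩
      · exact ⟨h.vq, h.cq, h.bdd.subq⟩
    refine ⟨g, o, ho', connIn_comp, ⟨fun c hc x hcx => ?_, subset_rfl,
      (hDs.trans Set.sdiff_subset).trans hor.2.2, ho', hg⟩,
      ⟨h.bdd, ⟨idx, hX, hsv⟩, hDs, h.vp, h.vq⟩, hor.1, hXc,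
      fun _ => touch_comp_sdiff h.conn hX.sub hne hu, hor.2.1, ht⟩
    by_cases hxX : x ∈ X
    · exact Or.inl hxX
    · have : x ∈ p.X ∨ x ∈ q.X ∨ x ∈ C := h.bdd.nbr c (hDs hc).1 x hcx
      have h2 : x ∈ a.X ∨ x ∈ b.X ∨ x ∈ C := by
        rcases hab with ⟨rfl, rfl⟩ | ⟨rfl, rfl⟩
        · exact this
        · exact or_left_comm.1 this
      rcases h2 with h2 | h2 | h2
      · exact Or.inr (Or.inl (hcov c hc x hcx (Or.inl h2)))
      · exact Or.inr (Or.inl (hcov c hc x hcx (Or.inr h2)))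
      · exact Or.inr (Or.inr (comp_closed hc ⟨h2, hxX⟩ hcx))
  have nil_of : ∀ {o : Anc W} {K : Set W}, Touch Γ K o.X → o ≠ .nil := by
    rintro o K ⟨-, -, x, hx, -⟩ rfl
    exact hx
  by_cases hDb : Touch Γ D b.X
  · have hbn := nil_of hDb
    refine main 0 b (Or.inr (Or.inr rfl)) ?_ (Or.inr (by simpa using hb hbn)) ?_
      fun _ => ⟨hDb, tb hbn⟩
    · intro x hx y hy w hw _ _ _
      exact hX.le x hx y hy w hw
    · rintro c hc x hcx (hx | hx)
      · exact absurd ⟨D, hDs, connIn_comp, ⟨c, hc, x, hx, hcx⟩, hDb⟩ hno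
      · exact hx
  · by_cases hDa : Touch Γ D a.X
    · have han := nil_of hDa
      refine main 1 a (Or.inr (Or.inl rfl)) (hs u hDb) (Or.inr (by omega)) ?_
        fun _ => ⟨hDa, ta han⟩
      rintro c hc x hcx (hx | hx)
      · exact hx
      · exact absurd ⟨c, hc, x, hx, hcx⟩ hDb
    · refine main 1 .nil (Or.inl rfl) (hs u hDb) (Or.inl rfl) ?_ fun hn => absurd rfl hn
      rintro c hc x hcx (hx | hx)
      · exact absurd ⟨c, hc, x, hx, hcx⟩ hDa
      · exact absurd ⟨c, hc, x, hx, hcx⟩ hDb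

theorem isPiece_singleton {C : Set W} {c : W} (hc : c ∈ C) : IsPiece Γ C {c} fun _ => 0 := by
  refine ⟨by simpa using hc, by simp, ?_, by simp⟩
  rintro a rfl b rfl -
  exact ⟨Walk.nil, by simp, by simp⟩

theorem saves_singleton {C D : Set W} {c : W} (hD : c ∉ D) :
    Saves Γ C {c} D (fun _ => 0) 1 := by
  rintro a rfl b rfl w - y hy hyD
  cases w with
  | nil =>
    rw [Walk.support_nil, List.mem_singleton] at hy
    exact absurd (hy ▸ hyD) hD
  | cons => simp

/-- The step of the decomposition. -/
theorem Reg.exists_step [Finite W] [DecidableEq W] {T : Finset (Finset W)} (hT : IsSphere Γ T)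
    {C : Set W} {p q : Anc W} (h : Reg Γ C p q) (hne : C.Nonempty) :
    ∃ X idx, IsPiece Γ C X idx ∧ X.Nonempty ∧ ∀ u ∈ C \ X, ∃ g o, (o = .nil ∨ o = p ∨ o = q) ∧
      Reg Γ (comp Γ (C \ X) u) (.mk C X (comp Γ (C \ X) u) g p q) o := by
  by_cases hq : q = .nil
  · obtain ⟨c, hc, ht⟩ : ∃ c ∈ C, p ≠ .nil → Touch Γ {c} p.X := by
      by_cases hp : p = .nil
      · obtain ⟨c, hc⟩ := hne
        exact ⟨c, hc, fun h => absurd hp h⟩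
      · obtain ⟨c, hc, x, hx, hcx⟩ := h.tp hp
        exact ⟨c, hc, fun _ => ⟨c, rfl, x, hx, hcx⟩⟩
    refine ⟨{c}, fun _ => 0, isPiece_singleton hc, ⟨c, rfl⟩, fun u hu => ?_⟩
    refine h.exists_child (a := p) (b := q) (Or.inl ⟨rfl, rfl⟩) (isPiece_singleton hc)
      connIn_singleton ⟨c, rfl⟩ ht (fun hn => absurd hq hn) ?_ (fun hn => absurd hq hn) ?_ hu
    · rintro ⟨K, -, -, -, -, -, x, hx, -⟩
      rw [hq] at hx
      exact hx
    · exact fun v _ => saves_singleton fun hc' => (comp_subset hc').2 rfl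
  · have hp : p ≠ .nil := by
      rintro rfl
      rcases h.bdd.parent with e | e | e <;> exact hq e
    have main : ∀ a b : Anc W, (a = p ∧ b = q ∨ a = q ∧ b = p) → 1 ≤ b.g →
        ConnIn Γ a.X → ConnIn Γ b.X → Disjoint a.X b.X → Disjoint a.X C → Disjoint b.X C →
        (∀ c ∈ C, ∀ x, Γ.Adj c x → x ∈ a.X ∨ x ∈ b.X ∨ x ∈ C) → Touch Γ a.X b.X →
        Touch Γ C a.X → Touch Γ C b.X →
        ∃ X idx, IsPiece Γ C X idx ∧ X.Nonempty ∧ ∀ u ∈ C \ X, ∃ g o,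
          (o = .nil ∨ o = p ∨ o = q) ∧
            Reg Γ (comp Γ (C \ X) u) (.mk C X (comp Γ (C \ X) u) g p q) o := by
      intro a b hab hb ca cb dab daC dbC hN tab tCa tCb
      obtain ⟨X, hXC, idx, hX, tXa, tXb, hno, hinj, hw, hle, hsv⟩ :=
        exists_piece hT ca cb h.conn dab daC dbC hN tab tCa tCb
      have hP : IsPiece Γ C X idx := ⟨hXC, hinj, hw, hle⟩
      have hXne : X.Nonempty := by
        obtain ⟨x, hx, -⟩ := tXa
        exact ⟨x, hx⟩
      refine ⟨X, idx, hP, hXne, fun u hu => ?_⟩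
      refine h.exists_child hab hP hX hXne (fun _ => tXa) (fun _ => tXb) hno (fun _ => hb) ?_ hu
      intro v hv x hx y hy w hwC z hz hzD
      refine hsv x hx y hy w hwC z hz (comp_subset hzD).2 ?_
      rintro ⟨K, hK, hKc, hzK, hKb⟩
      exact hv (hKb.mono (subset_comp_of_mem hKc hK hzK hzD) subset_rfl)
    have hs := h.bdd.saving.resolve_left hq
    rcases Nat.eq_zero_or_pos p.g with h0 | h1
    · exact main p q (Or.inl ⟨rfl, rfl⟩) (by omega) h.cp h.cq h.disjoint h.disjoint_p
        h.disjoint_q h.bdd.nbr (h.tq hq).2 (h.tp hp) (h.tq hq).1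
    · refine main q p (Or.inr ⟨rfl, rfl⟩) h1 h.cq h.cp h.disjoint.symm h.disjoint_q
        h.disjoint_p (fun c hc x hx => ?_) (h.tq hq).2.symm (h.tq hq).1 (h.tp hp)
      exact or_left_comm.1 (h.bdd.nbr c hc x hx)

end

variable {W : Type} {Γ : SimpleGraph W}

theorem Reg.exists_rank [Finite W] [DecidableEq W] {T : Finset (Finset W)} (hT : IsSphere Γ T)
    {C : Set W} {p q : Anc W} (h : Reg Γ C p q) :
    ∃ r : W → ℕ, ∀ L : LinearOrder W, p.Below L → q.Below L →
      (∀ u ∈ C, ∀ v ∈ C, r u < r v → L.lt u v) → ∀ y ∈ C, (DReach Γ L 4 y).ncard ≤ 76 := by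
  classical
  induction hn : C.ncard using Nat.strong_induction_on generalizing C p q with
  | _ n ih =>
  subst hn
  rcases C.eq_empty_or_nonempty with rfl | hne
  · exact ⟨fun _ => 0, fun _ _ _ _ y hy => hy.elim⟩
  obtain ⟨X, idx, hX, hXne, hstep⟩ := h.exists_step hT hne
  have hD : ∀ D : Set W, ∃ r : W → ℕ, ∀ u ∈ C \ X, D = comp Γ (C \ X) u →
      ∀ L : LinearOrder W, p.Below L → q.Below L → (∀ u ∈ X, ∀ v ∈ C \ X, L.lt u v) →
      (∀ u ∈ D, ∀ v ∈ D, r u < r v → L.lt u v) → ∀ y ∈ D, (DReach Γ L 4 y).ncard ≤ 76 := by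
    intro D
    by_cases hex : ∃ u ∈ C \ X, D = comp Γ (C \ X) u
    · obtain ⟨u, hu, rfl⟩ := hex
      obtain ⟨g, o, ho, hreg⟩ := hstep u hu
      have hlt : (comp Γ (C \ X) u).ncard < C.ncard := by
        refine Set.ncard_lt_ncard ⟨comp_subset.trans Set.sdiff_subset, fun hsub => ?_⟩
          (Set.toFinite _)
        obtain ⟨x, hx⟩ := hXne
        exact (comp_subset (hsub (hX.sub hx))).2 hx
      obtain ⟨r, hr⟩ := ih _ hlt hreg rfl
      refine ⟨r, fun _ _ _ L hp hq hL => hr L ⟨hL, hp, hq⟩ ?_⟩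
      rcases ho with rfl | rfl | rfl
      exacts [trivial, hp, hq]
    · exact ⟨fun _ => 0, fun u hu he => absurd ⟨u, hu, he⟩ hex⟩
  choose rD hrD using hD
  obtain ⟨N, hN⟩ : ∃ N, ∀ u ∈ X, idx u ≤ N := by
    obtain ⟨N, hN⟩ := (X.toFinite.image idx).bddAbove
    exact ⟨N, fun u hu => hN ⟨u, hu, rfl⟩⟩
  set r : W → ℕ := fun u => if u ∈ X then idx u else N + 1 + rD (comp Γ (C \ X) u) u with hr
  refine ⟨r, fun L hp hq hL y hy => ?_⟩
  have rX : ∀ u ∈ X, r u = idx u := fun u hu => if_pos hu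
  have rC : ∀ u ∈ C \ X, r u = N + 1 + rD (comp Γ (C \ X) u) u := fun u hu => if_neg hu.2
  have hXL : ∀ u ∈ X, ∀ v ∈ C \ X, L.lt u v := by
    intro u hu v hv
    refine hL u (hX.sub hu) v hv.1 ?_
    rw [rX u hu, rC v hv]
    have := hN u hu
    omega
  by_cases hyX : y ∈ X
  · have h1 := ncard_dReach_four_le h.bdd h.vp h.vq hp hq hX hXL
      (fun u hu v hv huv => hL u (hX.sub hu) v (hX.sub hv) (by rwa [rX u hu, rX v hv])) hyX
    have h2 := ncard_hits_chase_le h.bdd h.vp h.vq (close_start (Γ := Γ) C y)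
    omega
  · refine hrD _ y ⟨hy, hyX⟩ rfl L hp hq hXL ?_ y (mem_comp_self ⟨hy, hyX⟩)
    intro u hu v hv huv
    have hu' := comp_subset hu
    have hv' := comp_subset hv
    refine hL u hu'.1 v hv'.1 ?_
    rw [rC u hu', rC v hv', comp_eq_of_mem hu, comp_eq_of_mem hv]
    omega

theorem exists_linearOrder_of_rank [Finite W] (r : W → ℕ) :
    ∃ L : LinearOrder W, ∀ u v, r u < r v → L.lt u v := by
  let e := Finite.equivFin W
  have he : Function.Injective fun u => toLex (r u, e u) := fun u v h => by
    have := congrArg (fun z => (ofLex z).2) h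
    exact e.injective this
  refine ⟨LinearOrder.lift' (fun u => toLex (r u, e u)) he, fun u v huv => ?_⟩
  change toLex (r u, e u) < toLex (r v, e v)
  exact Prod.Lex.toLex_lt_toLex.2 (Or.inl huv)

theorem IsSphere.exists_order [Finite W] [DecidableEq W] {T : Finset (Finset W)}
    (hT : IsSphere Γ T) : ∃ L : LinearOrder W, ∀ y, (DReach Γ L 4 y).ncard ≤ 76 := by
  have hreg : ∀ u : W, Reg Γ (comp Γ Set.univ u) .nil .nil := fun u =>
    ⟨connIn_comp, ⟨fun c hc x hx => Or.inr (Or.inr (comp_closed hc trivial hx)),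
      fun _ _ => trivial, fun _ _ => trivial, Or.inl rfl, Or.inl rfl⟩, trivial, trivial,
      fun _ hx => hx.elim, fun h => absurd rfl h, fun _ hx => hx.elim, fun h => absurd rfl h⟩
  have hD : ∀ D : Set W, ∃ r : W → ℕ, ∀ u, D = comp Γ Set.univ u → ∀ L : LinearOrder W,
      (∀ u ∈ D, ∀ v ∈ D, r u < r v → L.lt u v) → ∀ y ∈ D, (DReach Γ L 4 y).ncard ≤ 76 := by
    intro D
    by_cases hex : ∃ u, D = comp Γ Set.univ u
    · obtain ⟨u, rfl⟩ := hex
      obtain ⟨r, hr⟩ := (hreg u).exists_rank hT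
      exact ⟨r, fun _ _ L hL => hr L trivial trivial hL⟩
    · exact ⟨fun _ => 0, fun u he => absurd ⟨u, he⟩ hex⟩
  choose rD hrD using hD
  obtain ⟨L, hL⟩ := exists_linearOrder_of_rank fun u => rD (comp Γ Set.univ u) u
  refine ⟨L, fun y => hrD _ y rfl L ?_ y (mem_comp_self trivial)⟩
  intro u hu v hv huv
  refine hL u v ?_
  rwa [comp_eq_of_mem hu, comp_eq_of_mem hv]

end PlanarDcol

namespace PlanarDcol

variable {V : Type*} [Fintype V]

/-- The boundary of an edge set, as a mod 2 function on the vertices. -/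
def bd (z : Sym2 V → ZMod 2) (v : V) : ZMod 2 := ∑ u, z s(v, u)

theorem bd_add (z z' : Sym2 V → ZMod 2) : bd (z + z') = bd z + bd z' := by
  ext v
  simp [bd, Finset.sum_add_distrib]

@[simp] theorem bd_zero : bd (0 : Sym2 V → ZMod 2) = 0 := by
  ext v
  simp [bd]

/-- The cycle space of `G` over the field with two elements. -/
def cycleSpace (G : SimpleGraph V) : Submodule (ZMod 2) (Sym2 V → ZMod 2) where
  carrier := {z | (∀ e, z e ≠ 0 → e ∈ G.edgeSet) ∧ bd z = 0}
  add_mem' := by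
    rintro a b ⟨ha, ha'⟩ ⟨hb, hb'⟩
    refine ⟨fun e he => ?_, by rw [bd_add, ha', hb', add_zero]⟩
    by_cases h : a e = 0
    · exact hb e fun h' => he (by simp [h, h'])
    · exact ha e h
  zero_mem' := ⟨fun e he => absurd rfl he, bd_zero⟩
  smul_mem' := by
    rintro c a ⟨ha, ha'⟩
    refine ⟨fun e he => ha e fun h => he (by simp [h]), ?_⟩
    ext v
    have := congrFun ha' v
    simp only [bd, Pi.smul_apply, ← Finset.smul_sum] at this ⊢
    rw [this, Pi.zero_apply, smul_zero]

variable {G H : SimpleGraph V}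

theorem cycleSpace_mono (h : G ≤ H) : cycleSpace G ≤ cycleSpace H := fun _ hz =>
  ⟨fun e he => SimpleGraph.edgeSet_mono h (hz.1 e he), hz.2⟩

theorem zmod_two_ne_zero {x : ZMod 2} : x ≠ 0 ↔ x = 1 := by
  revert x; decide

/-- The boundary sums over a vertex set to the number of edges leaving it. -/
theorem sum_bd {z : Sym2 V → ZMod 2} (hz : ∀ e, z e ≠ 0 → e ∈ G.edgeSet) (K : Finset V)
    [DecidableEq V] : ∑ v ∈ K, bd z v = ∑ v ∈ K, ∑ u ∈ Kᶜ, z s(v, u) := by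
  have h2 : ∑ v ∈ K, ∑ u ∈ K, z s(v, u) = 0 := by
    rw [← Finset.sum_product']
    refine Finset.sum_involution (fun x _ => x.swap) ?_ ?_ ?_ ?_
    · rintro ⟨a, b⟩ -
      simp only [Prod.swap, Sym2.eq_swap (a := b) (b := a)]
      exact CharTwo.add_self_eq_zero _
    · rintro ⟨a, b⟩ - hne heq
      simp only [Prod.swap, Prod.mk.injEq] at heq
      obtain ⟨rfl, -⟩ := heq
      exact G.loopless.irrefl _ (G.mem_edgeSet.1 (hz _ hne))
    · rintro ⟨a, b⟩ h
      simpa [and_comm] using h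
    · rintro ⟨a, b⟩ -
      rfl
  have h3 : ∀ v, bd z v = ∑ u ∈ K, z s(v, u) + ∑ u ∈ Kᶜ, z s(v, u) := fun v =>
    (Finset.sum_add_sum_compl K _).symm
  simp only [h3, Finset.sum_add_distrib, h2, zero_add]

/-- A cut contains an even number of edges of a cycle. -/
theorem sum_cut_eq_zero {z : Sym2 V → ZMod 2} (hz : z ∈ cycleSpace G) (K : Finset V)
    [DecidableEq V] : ∑ v ∈ K, ∑ u ∈ Kᶜ, z s(v, u) = 0 := by
  rw [← sum_bd hz.1]
  exact Finset.sum_eq_zero fun v _ => congrFun hz.2 v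

open Classical in
/-- The edge set of a walk, mod 2. -/
noncomputable def chain {u v : V} : G.Walk u v → Sym2 V → ZMod 2
  | .nil => 0
  | .cons (v := w) _ p => Pi.single s(u, w) 1 + chain p

variable {u v w : V}

omit [Fintype V] in
@[simp] theorem chain_nil : chain (Walk.nil : G.Walk u u) = 0 := by rw [chain]

open Classical in
omit [Fintype V] in
theorem chain_cons (h : G.Adj u v) (p : G.Walk v w) :
    chain (p.cons h) = Pi.single s(u, v) 1 + chain p := by rw [chain]

omit [Fintype V] in
theorem chain_append (p : G.Walk u v) (q : G.Walk v w) :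
    chain (p.append q) = chain p + chain q := by
  induction p with
  | nil => simp
  | cons h p ih => rw [Walk.cons_append, chain_cons, ih, chain_cons, add_assoc]

omit [Fintype V] in
theorem chain_reverse (p : G.Walk u v) : chain p.reverse = chain p := by
  induction p with
  | nil => simp
  | cons h p ih =>
    rw [Walk.reverse_cons, chain_append, ih, chain_cons, chain_cons, chain_nil, add_zero,
      Sym2.eq_swap, add_comm]

open Classical in
omit [Fintype V] in
theorem chain_apply (p : G.Walk u v) (e : Sym2 V) : chain p e = (p.edges.count e : ZMod 2) := by
  induction p with
  | nil => simp
  | @cons a b c h p ih =>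
    rw [chain_cons, Pi.add_apply, ih, Walk.edges_cons, List.count_cons]
    by_cases he : s(a, b) = e
    · subst he
      simp [add_comm]
    · simp [Ne.symm he, he]

omit [Fintype V] in
theorem mem_edges_of_chain_ne_zero {p : G.Walk u v} {e : Sym2 V} (h : chain p e ≠ 0) :
    e ∈ p.edges := by
  classical
  by_contra he
  rw [chain_apply, List.count_eq_zero_of_not_mem he] at h
  exact h rfl

omit [Fintype V] in
theorem chain_ne_zero_iff {p : G.Walk u v} (hp : p.IsTrail) {e : Sym2 V} :
    chain p e ≠ 0 ↔ e ∈ p.edges := by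
  classical
  refine ⟨mem_edges_of_chain_ne_zero, fun h => ?_⟩
  rw [chain_apply, List.count_eq_one_of_mem hp.edges_nodup h]
  simp

open Classical in
theorem bd_single (h : u ≠ v) : bd (Pi.single s(u, v) (1 : ZMod 2)) =
    Pi.single u 1 + Pi.single v 1 := by
  ext x
  simp only [bd, Pi.single_apply, Pi.add_apply]
  by_cases hxu : x = u
  · subst hxu
    simp [h]
  · by_cases hxv : x = v
    · subst hxv
      simp [hxu]
    · simp [hxu, hxv]

open Classical in
theorem bd_chain (p : G.Walk u v) : bd (chain p) = Pi.single u 1 + Pi.single v 1 := by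
  induction p with
  | nil =>
    rw [chain_nil, bd_zero]
    ext x
    exact (CharTwo.add_self_eq_zero _).symm
  | @cons a b c h p ih =>
    rw [chain_cons, bd_add, ih, bd_single h.ne]
    ext x
    simp only [Pi.add_apply]
    linear_combination CharTwo.add_self_eq_zero ((Pi.single b 1 : V → ZMod 2) x)

theorem chain_mem_cycleSpace (p : G.Walk u u) : chain p ∈ cycleSpace G := by
  classical
  refine ⟨fun e he => p.edges_subset_edgeSet (mem_edges_of_chain_ne_zero he), ?_⟩
  rw [bd_chain]
  ext x
  exact CharTwo.add_self_eq_zero _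

/-- Every edge of an element of the cycle space lies on a cycle inside it. -/
theorem exists_isCycle_of_mem_cycleSpace {z : Sym2 V → ZMod 2} (hz : z ∈ cycleSpace G)
    {e : Sym2 V} (he : z e ≠ 0) : ∃ (u : V) (c : G.Walk u u), c.IsCycle ∧ e ∈ c.edges ∧
      ∀ e' ∈ c.edges, z e' ≠ 0 := by
  classical
  induction e using Sym2.ind with
  | _ v w =>
  set H : SimpleGraph V := SimpleGraph.fromEdgeSet {e | z e ≠ 0} with hH
  have hHG : H ≤ G := by
    intro a b hab
    rw [SimpleGraph.fromEdgeSet_adj] at hab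
    exact hz.1 _ hab.1
  have hadj : ∀ a b, z s(a, b) ≠ 0 → H.Adj a b := fun a b h => by
    rw [SimpleGraph.fromEdgeSet_adj]
    exact ⟨h, (G.mem_edgeSet.1 (hz.1 _ h)).ne⟩
  have hreach : (H \ SimpleGraph.fromEdgeSet {s(v, w)}).Reachable v w := by
    by_contra hnr
    set K : Finset V := Finset.univ.filter fun a =>
      (H \ SimpleGraph.fromEdgeSet {s(v, w)}).Reachable v a with hK
    have hcut := sum_cut_eq_zero hz K
    have hone : ∀ a ∈ K, ∀ b ∈ Kᶜ, z s(a, b) ≠ 0 → a = v ∧ b = w := by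
      intro a ha b hb hab
      simp only [hK, Finset.mem_compl, Finset.mem_filter, Finset.mem_univ, true_and] at ha hb
      by_contra hne
      refine hb (ha.trans (SimpleGraph.Adj.reachable ?_))
      rw [SimpleGraph.sdiff_adj, SimpleGraph.fromEdgeSet_adj]
      refine ⟨hadj a b hab, fun h => ?_⟩
      rcases Sym2.eq_iff.1 h.1 with h' | h'
      · exact hne h'
      · exact hnr (h'.1 ▸ ha)
    have hvK : v ∈ K := by simp [hK]
    have hwK : w ∈ Kᶜ := by simpa [hK] using hnr
    rw [Finset.sum_eq_single_of_mem v hvK fun a ha hav => Finset.sum_eq_zero fun b hb => ?_,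
      Finset.sum_eq_single_of_mem w hwK fun b hb hbw => ?_] at hcut
    · exact he hcut
    · by_contra h
      exact hbw (hone v hvK b hb h).2
    · by_contra h
      exact hav (hone a ha b hb h).1
  obtain ⟨u, c, hc, hec⟩ :=
    SimpleGraph.adj_and_reachable_delete_edges_iff_exists_cycle.1 ⟨hadj v w he, hreach⟩
  refine ⟨u, c.mapLe hHG, hc.mapLe hHG, by simpa using hec, fun e' he' => ?_⟩
  have h1 : e' ∈ c.edges := by simpa using he'
  have h2 := c.edges_subset_edgeSet h1
  rw [SimpleGraph.edgeSet_fromEdgeSet] at h2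
  exact h2.1

end PlanarDcol

namespace PlanarDcol

variable {V : Type*} [Fintype V]

open Classical in
/-- The number of members of a list of edge sets that contain `e`. -/
noncomputable def cover (l : List (Sym2 V → ZMod 2)) (e : Sym2 V) : ℕ :=
  l.countP fun z => z e ≠ 0

omit [Fintype V] in
@[simp] theorem cover_nil (e : Sym2 V) : cover [] e = 0 := rfl

open Classical in
omit [Fintype V] in
theorem cover_cons (z : Sym2 V → ZMod 2) (l : List (Sym2 V → ZMod 2)) (e : Sym2 V) :
    cover (z :: l) e = cover l e + if z e ≠ 0 then 1 else 0 := by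
  simp [cover, List.countP_cons]

omit [Fintype V] in
theorem cover_append (l l' : List (Sym2 V → ZMod 2)) (e : Sym2 V) :
    cover (l ++ l') e = cover l e + cover l' e := List.countP_append

omit [Fintype V] in
theorem cover_perm {l l' : List (Sym2 V → ZMod 2)} (h : l.Perm l') (e : Sym2 V) :
    cover l e = cover l' e := h.countP_eq _

omit [Fintype V] in
theorem sum_apply_eq_cover (l : List (Sym2 V → ZMod 2)) (e : Sym2 V) :
    l.sum e = (cover l e : ZMod 2) := by
  induction l with
  | nil => simp
  | cons z l ih =>
    rw [List.sum_cons, Pi.add_apply, ih, cover_cons]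
    by_cases h : z e = 0
    · simp [h]
    · simp [zmod_two_ne_zero.1 h, add_comm]

/-- The span of a list. -/
def lspan (l : List (Sym2 V → ZMod 2)) : Submodule (ZMod 2) (Sym2 V → ZMod 2) :=
  Submodule.span (ZMod 2) {z | z ∈ l}

omit [Fintype V] in
theorem mem_lspan {l : List (Sym2 V → ZMod 2)} {z : Sym2 V → ZMod 2} (h : z ∈ l) : z ∈ lspan l :=
  Submodule.subset_span h

omit [Fintype V] in
theorem lspan_le {l : List (Sym2 V → ZMod 2)} {M : Submodule (ZMod 2) (Sym2 V → ZMod 2)} :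
    lspan l ≤ M ↔ ∀ z ∈ l, z ∈ M := Submodule.span_le

/-- The cycle space of `G` is spanned by cycles that cover every edge at most twice. -/
def MacLane (G : SimpleGraph V) : Prop :=
  ∃ l : List (Sym2 V → ZMod 2), (∀ z ∈ l, z ∈ cycleSpace G) ∧ cycleSpace G ≤ lspan l ∧
    ∀ e, cover l e ≤ 2

variable {G : SimpleGraph V}

omit [Fintype V] in
theorem length_le_sum_cover [Fintype (Sym2 V)] (l : List (Sym2 V → ZMod 2)) (h : ∀ z ∈ l, z ≠ 0) :
    l.length ≤ ∑ e, cover l e := by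
  induction l with
  | nil => simp
  | cons z l ih =>
    have h1 := ih fun y hy => h y (List.mem_cons_of_mem _ hy)
    obtain ⟨e, he⟩ := Function.ne_iff.1 (h z List.mem_cons_self)
    simp only [cover_cons, Finset.sum_add_distrib, List.length_cons]
    have h2 : 1 ≤ ∑ e, if z e ≠ 0 then 1 else 0 := by
      refine le_trans ?_ (Finset.single_le_sum (f := fun e => if z e ≠ 0 then 1 else 0)
        (fun _ _ => Nat.zero_le _) (Finset.mem_univ e))
      simp only [Pi.zero_apply] at he
      simp [he]
    exact Nat.add_le_add h1 (by convert h2)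

/-- A cycle double cover of the covered edges that spans the cycle space. -/
structure IsDouble (G : SimpleGraph V) (l : List (Sym2 V → ZMod 2)) : Prop where
  mem : ∀ z ∈ l, z ∈ cycleSpace G
  le : cycleSpace G ≤ lspan l
  cov : ∀ e, cover l e = 0 ∨ cover l e = 2
  ne : ∀ z ∈ l, z ≠ 0

theorem MacLane.exists_isDouble (h : MacLane G) : ∃ l, IsDouble G l := by
  classical
  obtain ⟨l, hl, hs, hc⟩ := h
  refine ⟨(l.sum :: l).filter fun z => z ≠ 0, ?_, ?_, ?_, ?_⟩
  · intro z hz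
    rcases List.mem_cons.1 (List.mem_of_mem_filter hz) with rfl | hz
    · exact list_sum_mem hl
    · exact hl z hz
  · refine hs.trans (lspan_le.2 fun z hz => ?_)
    by_cases h0 : z = 0
    · rw [h0]; exact zero_mem _
    · exact mem_lspan (List.mem_filter.2 ⟨List.mem_cons_of_mem _ hz, by simpa using h0⟩)
  · intro e
    have h1 : cover ((l.sum :: l).filter fun z => z ≠ 0) e = cover (l.sum :: l) e := by
      unfold cover
      rw [List.countP_filter]
      refine List.countP_congr fun z _ => ?_
      simp only [ne_eq, decide_not, Bool.and_eq_true, Bool.not_eq_eq_eq_not, Bool.not_true,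
        decide_eq_false_iff_not, and_iff_left_iff_imp]
      rintro h rfl
      exact h rfl
    rw [h1, cover_cons, sum_apply_eq_cover]
    have := hc e
    interval_cases cover l e
    · simp
    · simp
    · simp
      decide
  · intro z hz
    simpa using (List.mem_filter.1 hz).2

/-- A double cover can be taken to consist of cycles. -/
theorem MacLane.exists_cycles (h : MacLane G) : ∃ l : List (Sym2 V → ZMod 2),
    (∀ z ∈ l, ∃ (u : V) (c : G.Walk u u), c.IsCycle ∧ z = chain c) ∧ cycleSpace G ≤ lspan l ∧
    ∀ e, cover l e = 0 ∨ cover l e = 2 := by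
  classical
  have hbdd : ∀ l, IsDouble G l → l.length ≤ 2 * Fintype.card (Sym2 V) := by
    intro l hl
    refine (length_le_sum_cover l hl.ne).trans ?_
    rw [Nat.mul_comm, ← smul_eq_mul, ← Finset.card_univ]
    refine Finset.sum_le_card_nsmul _ _ _ fun e _ => ?_
    have := hl.cov e
    omega
  obtain ⟨l, hl, hmax⟩ : ∃ l, IsDouble G l ∧ ∀ l', IsDouble G l' → l'.length ≤ l.length := by
    obtain ⟨l₀, h₀⟩ := h.exists_isDouble
    have hne : {n | ∃ l, IsDouble G l ∧ l.length = n}.Nonempty := ⟨_, l₀, h₀, rfl⟩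
    have hb : BddAbove {n | ∃ l, IsDouble G l ∧ l.length = n} :=
      ⟨2 * Fintype.card (Sym2 V), by rintro _ ⟨l, hl, rfl⟩; exact hbdd l hl⟩
    obtain ⟨l, hl, hn⟩ := Nat.sSup_mem hne hb
    exact ⟨l, hl, fun l' hl' => hn ▸ le_csSup hb ⟨l', hl', rfl⟩⟩
  refine ⟨l, fun z hz => ?_, hl.le, hl.cov⟩
  obtain ⟨e, he⟩ := Function.ne_iff.1 (hl.ne z hz)
  obtain ⟨u, c, hc, hec, hcz⟩ := exists_isCycle_of_mem_cycleSpace (hl.mem z hz) he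
  refine ⟨u, c, hc, ?_⟩
  by_contra hne
  obtain ⟨l', hperm⟩ : ∃ l', l.Perm (z :: l') := ⟨l.erase z, List.perm_cons_erase hz⟩
  have hmem : ∀ y, y ∈ l ↔ y = z ∨ y ∈ l' := fun y => by rw [hperm.mem_iff, List.mem_cons]
  have hcc := chain_mem_cycleSpace c
  have hadd : z = chain c + (z + chain c) := by
    ext e
    simp only [Pi.add_apply]
    linear_combination - CharTwo.add_self_eq_zero (chain c e)
  have hd : IsDouble G (chain c :: (z + chain c) :: l') := by
    refine ⟨?_, ?_, ?_, ?_⟩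
    · intro y hy
      rw [List.mem_cons, List.mem_cons] at hy
      rcases hy with rfl | rfl | hy
      · exact hcc
      · exact add_mem (hl.mem z hz) hcc
      · exact hl.mem y ((hmem y).2 (Or.inr hy))
    · refine hl.le.trans (lspan_le.2 fun y hy => ?_)
      rcases (hmem y).1 hy with rfl | hy
      · have h5 := add_mem
          (mem_lspan (z := chain c) (l := chain c :: (y + chain c) :: l') (by simp))
          (mem_lspan (z := y + chain c) (by simp))
        rwa [← hadd] at h5
      · exact mem_lspan (by simp [hy])
    · intro e
      have h1 := hl.cov e
      rw [cover_perm hperm, cover_cons] at h1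
      rw [cover_cons, cover_cons, add_assoc]
      have h2 : ((if (z + chain c) e ≠ 0 then 1 else 0) + if chain c e ≠ 0 then 1 else 0) =
          if z e ≠ 0 then 1 else 0 := by
        by_cases h3 : chain c e = 0
        · simp [h3]
        · have h4 := hcz e (mem_edges_of_chain_ne_zero h3)
          have h5 : (z + chain c) e = 0 := by
            rw [Pi.add_apply, zmod_two_ne_zero.1 h3, zmod_two_ne_zero.1 h4]
            decide
          simp [h3, h4, h5]
      rw [h2]
      exact h1
    · intro y hy
      rw [List.mem_cons, List.mem_cons] at hy
      rcases hy with rfl | rfl | hy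
      · intro h0
        exact (chain_ne_zero_iff hc.isTrail).2 hec (congrFun h0 e)
      · intro h0
        refine hne ?_
        rw [hadd, h0, add_zero]
      · exact hl.ne y ((hmem y).2 (Or.inr hy))
  have := hmax _ hd
  rw [hperm.length_eq] at this
  simp at this

end PlanarDcol

namespace PlanarDcol

section Pairing

variable {V : Type*} [Fintype V] [DecidableEq V] {G : SimpleGraph V} {u v : V}

/-- The mod 2 pairing of edge functions, as a linear map in the second argument. -/
def pairing (ψ : Sym2 V → ZMod 2) : (Sym2 V → ZMod 2) →ₗ[ZMod 2] ZMod 2 where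
  toFun z := ∑ e, z e * ψ e
  map_add' := by simp [add_mul, Finset.sum_add_distrib]
  map_smul' := by simp [Finset.mul_sum, mul_assoc]

theorem pairing_single (ψ : Sym2 V → ZMod 2) (e : Sym2 V) :
    pairing ψ (Pi.single e 1) = ψ e := by
  simp only [pairing, LinearMap.coe_mk, AddHom.coe_mk]
  rw [Finset.sum_eq_single e]
  · simp
  · intro b _ hb
    simp [hb]
  · simp

theorem pairing_chain_cons (ψ : Sym2 V → ZMod 2) {w : V} (h : G.Adj u v) (p : G.Walk v w) :
    pairing ψ (chain (p.cons h)) = ψ s(u, v) + pairing ψ (chain p) := by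
  rw [chain_cons, map_add]
  congr 1
  convert pairing_single ψ s(u, v)

theorem pairing_chain (ψ : Sym2 V → ZMod 2) (g : V → ZMod 2) (p : G.Walk u v)
    (h : ∀ a b, s(a, b) ∈ p.edges → ψ s(a, b) = g a + g b) :
    pairing ψ (chain p) = g u + g v := by
  induction p with
  | nil => simp [CharTwo.add_self_eq_zero]
  | @cons a b c hab p ih =>
    rw [pairing_chain_cons, ih fun x y hxy => h x y (by simp [hxy]), h a b (by simp)]
    linear_combination CharTwo.add_self_eq_zero (g b)

omit [Fintype V] [DecidableEq V] in
theorem walk_const {α : Type*} (g : V → α) (p : G.Walk u v)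
    (h : ∀ a b, s(a, b) ∈ p.edges → g a = g b) : ∀ x ∈ p.support, g x = g u := by
  induction p with
  | nil => simp
  | @cons a b c hab p ih =>
    intro x hx
    rw [Walk.support_cons, List.mem_cons] at hx
    rcases hx with rfl | hx
    · rfl
    · rw [ih (fun a b hab => h a b (by simp [hab])) x hx, h a b (by simp)]

/-- An edge function that pairs to zero with all cycles is a coboundary. -/
theorem exists_potential (ψ : Sym2 V → ZMod 2) (h : ∀ z ∈ cycleSpace G, pairing ψ z = 0) :
    ∃ U : V → ZMod 2, ∀ a b, G.Adj a b → ψ s(a, b) = U a + U b := by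
  have hw : ∀ v, ∃ r, r = (G.connectedComponentMk v).out ∧ Nonempty (G.Walk r v) := fun v =>
    ⟨_, rfl, ConnectedComponent.exact (Quot.out_eq (G.connectedComponentMk v))⟩
  choose r hr hp using hw
  refine ⟨fun v => pairing ψ (chain (hp v).some), fun a b hab => ?_⟩
  have hrr : r a = r b := by
    rw [hr, hr, ConnectedComponent.connectedComponentMk_eq_of_adj hab]
  have key : ∀ (x y : V) (p : G.Walk x a) (q : G.Walk y b), x = y →
      ψ s(a, b) = pairing ψ (chain p) + pairing ψ (chain q) := by
    rintro x y p q rfl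
    have h1 := h _ (chain_mem_cycleSpace (p.append (q.reverse.cons hab)))
    rw [chain_append, map_add, pairing_chain_cons, chain_reverse] at h1
    linear_combination (exp := 1) h1 - CharTwo.add_self_eq_zero (pairing ψ (chain p)) -
      CharTwo.add_self_eq_zero (pairing ψ (chain q))
  exact key _ _ _ _ hrr

end Pairing

section Stellation

variable {V ι : Type*}

/-- The graph obtained from `G` by adding a new vertex for each edge set `F f`, adjacent to
the ends of the edges in `F f`. -/
def stellation (G : SimpleGraph V) (F : ι → Sym2 V → ZMod 2) : SimpleGraph (V ⊕ ι) where
  Adj x y := match x, y with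
    | .inl a, .inl b => G.Adj a b
    | .inl a, .inr f => ∃ b, F f s(a, b) ≠ 0
    | .inr f, .inl a => ∃ b, F f s(a, b) ≠ 0
    | .inr _, .inr _ => False
  symm := ⟨by
    rintro (a | f) (b | f') h
    · exact SimpleGraph.Adj.symm h
    · exact h
    · exact h
    · exact h⟩
  loopless := ⟨by
    rintro (a | f) h
    · exact G.loopless.irrefl a h
    · exact h⟩

open Classical in
/-- The triangles of the stellation. -/
noncomputable def stellationTri [Fintype V] [Fintype ι] [DecidableEq (V ⊕ ι)]
    (F : ι → Sym2 V → ZMod 2) : Finset (Finset (V ⊕ ι)) :=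
  Finset.univ.filter fun t => ∃ a b f, F f s(a, b) ≠ 0 ∧ t = {.inl a, .inl b, .inr f}

open Classical in
theorem isSphere_stellation [Fintype V] [Fintype ι] [DecidableEq (V ⊕ ι)] {G : SimpleGraph V}
    {F : ι → Sym2 V → ZMod 2}
    (hF : ∀ f, ∃ (u : V) (c : G.Walk u u), c.IsCycle ∧ F f = chain c)
    (hcov : ∀ e, (Finset.univ.filter fun f => F f e ≠ 0).card = 0 ∨
      (Finset.univ.filter fun f => F f e ≠ 0).card = 2)
    (hspan : cycleSpace G ≤ Submodule.span (ZMod 2) (Set.range F)) :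
    IsSphere (stellation G F) (stellationTri F) := by
  have hadj : ∀ {f a b}, F f s(a, b) ≠ 0 → G.Adj a b := by
    intro f a b h
    obtain ⟨u, c, hc, hfc⟩ := hF f
    rw [hfc] at h
    exact c.edges_subset_edgeSet (mem_edges_of_chain_ne_zero h)
  refine ⟨?_, ?_, ?_⟩
  · intro t ht
    obtain ⟨a, b, f, hab, rfl⟩ := (Finset.mem_filter.1 ht).2
    exact ⟨.inl a, .inl b, .inr f, hadj hab, ⟨a, by rwa [Sym2.eq_swap]⟩, ⟨b, hab⟩, rfl⟩
  · have hedge : ∀ a f, (∃ b, F f s(a, b) ≠ 0) → ((stellationTri F).filter fun t =>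
        Sum.inl a ∈ t ∧ Sum.inr f ∈ t).card = 2 := by
      rintro a f ⟨b, hb⟩
      obtain ⟨u, c, hc, hfc⟩ := hF f
      have hiff : ∀ w, F f s(a, w) ≠ 0 ↔ s(a, w) ∈ c.edges := fun w => by
        rw [hfc]; exact chain_ne_zero_iff hc.isTrail
      have ha : a ∈ c.support := c.fst_mem_support_of_mem_edges ((hiff b).1 hb)
      have h2 := hc.ncard_neighborSet_toSubgraph_eq_two ha
      have h3 : c.toSubgraph.neighborSet a = {w | F f s(a, w) ≠ 0} := by
        ext w
        rw [Subgraph.mem_neighborSet, Walk.adj_toSubgraph_iff_mem_edges, Set.mem_ofPred_eq, hiff]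
      rw [h3, Set.ncard_eq_toFinset_card'] at h2
      rw [← h2]
      symm
      refine Finset.card_bij (fun w _ => {Sum.inl a, Sum.inl w, Sum.inr f}) ?_ ?_ ?_
      · intro w hw
        simp only [Set.mem_toFinset, Set.mem_ofPred_eq] at hw
        simp only [stellationTri, Finset.mem_filter, Finset.mem_univ, true_and]
        exact ⟨⟨a, w, f, hw, rfl⟩, by simp, by simp⟩
      · intro w hw w' hw' h
        simp only [Set.mem_toFinset, Set.mem_ofPred_eq] at hw hw'
        have h4 : (Sum.inl w : V ⊕ ι) ∈ ({Sum.inl a, Sum.inl w', Sum.inr f} : Finset (V ⊕ ι)) := by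
          rw [← h]; simp
        simp only [Finset.mem_insert, Finset.mem_singleton, Sum.inl.injEq, reduceCtorEq,
          or_false] at h4
        exact h4.resolve_left (hadj hw).ne'
      · intro t ht
        obtain ⟨h5, h6, h7⟩ := Finset.mem_filter.1 ht
        obtain ⟨x, y, g, hxy, rfl⟩ := (Finset.mem_filter.1 h5).2
        simp only [Finset.mem_insert, Finset.mem_singleton, Sum.inl.injEq, reduceCtorEq,
          or_false, Sum.inr.injEq, false_or] at h6 h7
        subst h7
        rcases h6 with rfl | rfl
        · exact ⟨y, by simpa using hxy, rfl⟩
        · refine ⟨x, by rw [Sym2.eq_swap] at hxy; simpa using hxy, ?_⟩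
          exact Finset.insert_comm _ _ _
    rintro (a | f) (b | g) hab
    · have : (Finset.univ.filter fun f => F f s(a, b) ≠ 0).card = ((stellationTri F).filter fun t =>
          Sum.inl a ∈ t ∧ Sum.inl b ∈ t).card := by
        have hne : a ≠ b := G.ne_of_adj hab
        refine Finset.card_bij (fun f _ => {Sum.inl a, Sum.inl b, Sum.inr f}) ?_ ?_ ?_
        · intro f hf
          simp only [Finset.mem_filter, Finset.mem_univ, true_and] at hf
          simp only [stellationTri, Finset.mem_filter, Finset.mem_univ, true_and]
          exact ⟨⟨a, b, f, hf, rfl⟩, by simp, by simp⟩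
        · intro f _ g _ h
          have h4 : (Sum.inr f : V ⊕ ι) ∈
              ({Sum.inl a, Sum.inl b, Sum.inr g} : Finset (V ⊕ ι)) := by
            rw [← h]; simp
          simpa using h4
        · intro t ht
          obtain ⟨h5, h6, h7⟩ := Finset.mem_filter.1 ht
          obtain ⟨x, y, g, hxy, rfl⟩ := (Finset.mem_filter.1 h5).2
          simp only [Finset.mem_insert, Finset.mem_singleton, Sum.inl.injEq, reduceCtorEq,
            or_false] at h6 h7
          rcases h6 with rfl | rfl <;> rcases h7 with rfl | rfl
          · exact absurd rfl hne
          · exact ⟨g, by simpa using hxy, rfl⟩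
          · exact ⟨g, by rw [Sym2.eq_swap] at hxy; simpa using hxy, Finset.insert_comm _ _ _⟩
          · exact absurd rfl hne
      rw [← this]
      exact hcov _
    · exact Or.inr (hedge a g hab)
    · right
      rw [← hedge b f hab]
      congr 1
      ext t
      simp only [Finset.mem_filter, and_comm]
    · exact hab.elim
  · intro φ hφ
    let ψ : Sym2 V → ZMod 2 := fun e => φ (e.map Sum.inl)
    let A : ι → V → ZMod 2 := fun f u => φ s(Sum.inl u, Sum.inr f)
    have hψ : ∀ f a b, F f s(a, b) ≠ 0 → ψ s(a, b) = A f a + A f b := by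
      intro f a b hab
      have h1 := hφ (Sum.inl a) (Sum.inl b) (Sum.inr f) (hadj hab)
        ⟨a, by rwa [Sym2.eq_swap]⟩ ⟨b, hab⟩
        (Finset.mem_filter.2 ⟨Finset.mem_univ _, a, b, f, hab, rfl⟩)
      change ψ s(a, b) + A f b + A f a = 0 at h1
      linear_combination h1 - CharTwo.add_self_eq_zero (A f b) - CharTwo.add_self_eq_zero (A f a)
    have hzero : ∀ z ∈ cycleSpace G, pairing ψ z = 0 := by
      intro z hz
      have h1 : Submodule.span (ZMod 2) (Set.range F) ≤ LinearMap.ker (pairing ψ) := by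
        rw [Submodule.span_le]
        rintro _ ⟨f, rfl⟩
        obtain ⟨u, c, hc, hfc⟩ := hF f
        change pairing ψ (F f) = 0
        rw [hfc, pairing_chain ψ (A f) c]
        · exact CharTwo.add_self_eq_zero _
        · intro a b hab
          exact hψ f a b (by rw [hfc]; exact (chain_ne_zero_iff hc.isTrail).2 hab)
      exact h1 (hspan hz)
    obtain ⟨U, hU⟩ := exists_potential ψ hzero
    have hconst : ∀ f, ∃ k, ∀ a b, F f s(a, b) ≠ 0 → A f a + U a = k := by
      intro f
      obtain ⟨u, c, hc, hfc⟩ := hF f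
      refine ⟨A f u + U u, fun a b hab => ?_⟩
      have hiff : ∀ a w, F f s(a, w) ≠ 0 ↔ s(a, w) ∈ c.edges := fun a w => by
        rw [hfc]; exact chain_ne_zero_iff hc.isTrail
      refine walk_const (fun a => A f a + U a) c ?_ a
        (c.fst_mem_support_of_mem_edges ((hiff a b).1 hab))
      intro x y hxy
      have h1 := hψ f x y ((hiff x y).2 hxy)
      rw [hU x y (hadj ((hiff x y).2 hxy))] at h1
      linear_combination h1 + CharTwo.add_self_eq_zero (A f x) - CharTwo.add_self_eq_zero (U y)
    choose k hk using hconst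
    refine ⟨Sum.elim U k, ?_⟩
    have hlr : ∀ a f, (∃ b, F f s(a, b) ≠ 0) → φ s(Sum.inl a, Sum.inr f) = U a + k f := by
      rintro a f ⟨b, hb⟩
      have h1 := hk f a b hb
      change A f a = _
      linear_combination h1 - CharTwo.add_self_eq_zero (U a)
    rintro (a | f) (b | g) hab
    · exact hU a b hab
    · exact hlr a g hab
    · rw [Sym2.eq_swap, hlr b f hab]
      exact add_comm _ _
    · exact hab.elim

end Stellation

theorem ncard_dReach_le_of_embedding {V W : Type} [Finite W] {G : SimpleGraph V}
    {Γ : SimpleGraph W} (i : V ↪ W) (hi : ∀ a b, G.Adj a b → Γ.Adj (i a) (i b))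
    (L : LinearOrder W) (k : ℕ) (y : V) :
    (DReach G (@LinearOrder.lift' V W L i i.injective) k y).ncard ≤
      (DReach Γ L k (i y)).ncard := by
  refine Set.ncard_le_ncard_of_injOn i ?_ i.injective.injOn (Set.toFinite _)
  rintro x ⟨p, hp, hl, h1, h2⟩
  let φ : G →g Γ := ⟨i, fun {a b} h => hi a b h⟩
  refine ⟨p.map φ, Walk.IsPath.map (f := φ) i.injective hp, by simpa using hl, ?_, ?_⟩
  · intro z hz
    rw [Walk.support_map, List.mem_map] at hz
    obtain ⟨w, hw, rfl⟩ := hz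
    exact h1 w hw
  · intro j hj hj'
    rw [Walk.length_map] at hj'
    have h3 := h2 j hj hj'
    rw [Walk.support_map]
    have h4 : (p.support.map φ).getD j (i y) = i (p.support.getD j y) := by
      have : i y = φ y := rfl
      rw [this, List.getD_map]
      rfl
    rw [h4]
    exact h3

theorem MacLane.dcol_le {V : Type} [Fintype V] {G : SimpleGraph V} (h : MacLane G) :
    dcol G 4 ≤ 76 := by
  classical
  obtain ⟨l, hl, hspan, hcov⟩ := h.exists_cycles
  let F : Fin l.length → Sym2 V → ZMod 2 := fun i => l[i]
  have hcard : ∀ e, (Finset.univ.filter fun f => F f e ≠ 0).card = cover l e := by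
    intro e
    have : ∀ l : List (Sym2 V → ZMod 2), (l.map fun z => if z e ≠ 0 then 1 else 0).sum =
        cover l e := by
      intro l
      induction l with
      | nil => simp
      | cons z l ih => rw [cover_cons, List.map_cons, List.sum_cons, ih, add_comm]
    rw [← this, Finset.card_filter, ← Fin.sum_univ_fun_getElem]
    rfl
  have hS := isSphere_stellation (F := F) (fun f => hl _ (l.getElem_mem f.2))
    (fun e => by rw [hcard]; exact hcov e) (hspan.trans (Submodule.span_mono fun z hz => by
      obtain ⟨i, hi, rfl⟩ := List.getElem_of_mem hz
      exact ⟨⟨i, hi⟩, rfl⟩))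
  obtain ⟨L, hL⟩ := hS.exists_order
  refine (ciInf_le ⟨0, fun _ _ => Nat.zero_le _⟩
    (@LinearOrder.lift' V _ L Sum.inl Sum.inl_injective)).trans ?_
  rcases isEmpty_or_nonempty V with hV | hV
  · simp
  · exact ciSup_le fun y => (ncard_dReach_le_of_embedding ⟨Sum.inl, Sum.inl_injective⟩
      (fun a b hab => hab) L 4 y).trans (hL _)

end PlanarDcol

namespace PlanarDcol

variable {V : Type*} {G : SimpleGraph V}

/-- `S` is the vertex set of an induced cycle. -/
def IndCycle (G : SimpleGraph V) (S : Set V) : Prop :=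
  ∃ (u : V) (c : G.Walk u u), c.IsCycle ∧ (∀ v, v ∈ c.support ↔ v ∈ S) ∧
    ∀ a ∈ S, ∀ b ∈ S, G.Adj a b → s(a, b) ∈ c.edges

/-- `X` is the interior of an arc with ends `t` and `r` on `S`. -/
structure IsArc (G : SimpleGraph V) (S : Set V) (t r : V) (X : Set V) : Prop where
  sub : X ⊆ S
  left_notMem : t ∉ X
  right_notMem : r ∉ X
  conn : ConnIn G X
  link : Linked G (X ∪ {t, r}) t r
  touch_left : X.Nonempty → Touch G X {t}
  touch_right : X.Nonempty → Touch G X {r}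

theorem _root_.SimpleGraph.Walk.IsPath.isArc {t r : V} {p : G.Walk t r} (hp : p.IsPath)
    (htr : t ≠ r) {S : Set V} (hS : ∀ v ∈ p.support, v ∈ S) :
    IsArc G S t r {v | v ∈ p.support ∧ v ≠ t ∧ v ≠ r} := by
  have hlink : Linked G ({v | v ∈ p.support ∧ v ≠ t ∧ v ≠ r} ∪ {t, r}) t r :=
    ⟨p, fun z hz => by
      by_cases h1 : z = t
      · exact Or.inr (Or.inl h1)
      by_cases h2 : z = r
      · exact Or.inr (Or.inr h2)
      exact Or.inl ⟨hz, h1, h2⟩⟩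
  suffices h : ConnIn G {v | v ∈ p.support ∧ v ≠ t ∧ v ≠ r} ∧
      ({v | v ∈ p.support ∧ v ≠ t ∧ v ≠ r}.Nonempty →
        Touch G {v | v ∈ p.support ∧ v ≠ t ∧ v ≠ r} {t} ∧
        Touch G {v | v ∈ p.support ∧ v ≠ t ∧ v ≠ r} {r}) from
    ⟨fun v hv => hS v hv.1, fun h => h.2.1 rfl, fun h => h.2.2 rfl, h.1, hlink,
      fun hn => (h.2 hn).1, fun hn => (h.2 hn).2⟩
  cases p with
  | nil => exact absurd rfl htr
  | @cons _ t' _ hadj p' =>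
    rw [Walk.cons_isPath_iff] at hp
    obtain ⟨q, hq⟩ : ∃ q, q = p'.reverse := ⟨_, rfl⟩
    have hqs : ∀ v, v ∈ p'.support ↔ v ∈ q.support := by simp [hq]
    have hqp : q.IsPath := by rw [hq]; exact hp.1.reverse
    cases q with
    | nil =>
      have hemp : {v | v ∈ (Walk.cons hadj p').support ∧ v ≠ t ∧ v ≠ r} = ∅ := by
        ext v
        simp only [Walk.support_cons, List.mem_cons, hqs, Walk.support_nil, List.not_mem_nil,
          or_false, Set.mem_ofPred_eq, Set.mem_empty_iff_false, iff_false]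
        tauto
      rw [hemp]
      exact ⟨fun u hu => hu.elim, fun h => absurd rfl h.ne_empty⟩
    | @cons _ r' _ hadj' q' =>
      rw [Walk.cons_isPath_iff] at hqp
      have heq : {v | v ∈ (Walk.cons hadj p').support ∧ v ≠ t ∧ v ≠ r} =
          {v | v ∈ q'.support} := by
        ext v
        have h1 : t ∉ q'.support := fun h => hp.2 ((hqs t).2 (by simp [h]))
        simp only [Walk.support_cons, List.mem_cons, hqs, Set.mem_ofPred_eq]
        constructor
        · rintro ⟨h2 | h2 | h2, h3, h4⟩
          exacts [absurd h2 h3, absurd h2 h4, h2]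
        · intro h
          exact ⟨Or.inr (Or.inr h), fun h' => h1 (h' ▸ h), fun h' => hqp.2 (h' ▸ h)⟩
      rw [heq]
      exact ⟨connIn_support q', fun _ => ⟨⟨t', q'.end_mem_support, t, rfl, hadj.symm⟩,
        ⟨r', q'.start_mem_support, r, rfl, hadj'.symm⟩⟩⟩

/-- Two vertices of an induced cycle split it into two arcs. -/
theorem IndCycle.exists_arcs {S : Set V} (hS : IndCycle G S) {t r : V} (ht : t ∈ S) (hr : r ∈ S)
    (htr : t ≠ r) : ∃ X Z, IsArc G S t r X ∧ IsArc G S t r Z ∧ Disjoint X Z ∧ ¬ Touch G X Z ∧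
      S ⊆ X ∪ Z ∪ {t, r} := by
  classical
  obtain ⟨u, c₀, hc₀, hs₀, hi₀⟩ := hS
  obtain ⟨c, hc, hs, hi⟩ : ∃ c : G.Walk t t, c.IsCycle ∧ (∀ v, v ∈ c.support ↔ v ∈ S) ∧
      ∀ a ∈ S, ∀ b ∈ S, G.Adj a b → s(a, b) ∈ c.edges := by
    have ht' := (hs₀ t).2 ht
    refine ⟨c₀.rotate t ht', hc₀.rotate ht', fun v => ?_, fun a ha b hb hab => ?_⟩
    · rw [← hs₀, Walk.mem_support_rotate_iff]
    · exact (c₀.rotate_edges t ht').mem_iff.2 (hi₀ a ha b hb hab)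
  have hr' := (hs r).2 hr
  obtain ⟨p, q, hpq⟩ : ∃ (p : G.Walk t r) (q : G.Walk r t), p.append q = c :=
    ⟨_, _, c.take_spec hr'⟩
  have hnd := hc.support_nodup
  rw [← hpq, Walk.tail_support_append, List.nodup_append] at hnd
  obtain ⟨hn1, hn2, hn3⟩ := hnd
  have htq : t ∈ q.support.tail := by
    have := q.end_mem_support
    rw [Walk.mem_support_iff] at this
    exact this.resolve_left htr
  have hrp : r ∈ p.support.tail := by
    have := p.end_mem_support
    rw [Walk.mem_support_iff] at this
    exact this.resolve_left htr.symm
  have hp : p.IsPath := by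
    rw [Walk.isPath_def, ← Walk.cons_tail_support, List.nodup_cons]
    exact ⟨fun h => hn3 _ h _ htq rfl, hn1⟩
  have hq : q.IsPath := by
    rw [Walk.isPath_def, ← Walk.cons_tail_support, List.nodup_cons]
    exact ⟨fun h => hn3 _ hrp _ h rfl, hn2⟩
  have hsupp : ∀ v, v ∈ S ↔ v ∈ p.support ∨ v ∈ q.support := fun v => by
    rw [← hs, ← hpq, Walk.mem_support_append_iff]
  have hmem : ∀ v, v ∈ p.support → v ∈ q.support → v ≠ t → v ≠ r → False := by
    intro v hv hv' h1 h2
    rw [Walk.mem_support_iff] at hv hv'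
    exact hn3 _ (hv.resolve_left h1) _ (hv'.resolve_left h2) rfl
  have hq' : ∀ v, v ∈ q.reverse.support ↔ v ∈ q.support := by simp
  refine ⟨_, _, hp.isArc htr fun v hv => (hsupp v).2 (Or.inl hv),
    hq.reverse.isArc htr fun v hv => (hsupp v).2 (Or.inr ((hq' v).1 hv)), ?_, ?_, ?_⟩
  · rw [Set.disjoint_left]
    rintro v ⟨h1, h2, h3⟩ ⟨h4, -⟩
    exact hmem v h1 ((hq' v).1 h4) h2 h3
  · rintro ⟨a, ⟨ha, ha1, ha2⟩, b, ⟨hb, hb1, hb2⟩, hab⟩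
    rw [hq'] at hb
    have h1 := hi a ((hsupp a).2 (Or.inl ha)) b ((hsupp b).2 (Or.inr hb)) hab
    rw [← hpq, Walk.edges_append, List.mem_append] at h1
    rcases h1 with h1 | h1
    · exact hmem b (p.snd_mem_support_of_mem_edges h1) hb hb1 hb2
    · exact hmem a ha (q.fst_mem_support_of_mem_edges h1) ha1 ha2
  · intro v hv
    by_cases h1 : v = t
    · exact Or.inr (Or.inl h1)
    by_cases h2 : v = r
    · exact Or.inr (Or.inr h2)
    rcases (hsupp v).1 hv with h | h
    · exact Or.inl (Or.inl ⟨h, h1, h2⟩)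
    · exact Or.inl (Or.inr ⟨(hq' v).2 h, h1, h2⟩)

theorem IndCycle.connIn {S : Set V} (hS : IndCycle G S) : ConnIn G S := by
  obtain ⟨u, c, hc, hs, hi⟩ := hS
  have := connIn_support c
  rwa [show {z | z ∈ c.support} = S from Set.ext hs] at this

theorem IndCycle.exists_adj {S : Set V} (hS : IndCycle G S) {v : V} (hv : v ∈ S) :
    ∃ w ∈ S, G.Adj v w := by
  obtain ⟨u, c, hc, hs, hi⟩ := hS
  have h2 := hc.ncard_neighborSet_toSubgraph_eq_two ((hs v).2 hv)
  have h3 : (c.toSubgraph.neighborSet v).Nonempty := by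
    rw [← Set.ncard_pos (Set.finite_of_ncard_ne_zero (by omega))]; omega
  obtain ⟨w, hw⟩ := h3
  rw [Subgraph.mem_neighborSet] at hw
  exact ⟨w, (hs w).1 (c.mem_verts_toSubgraph.1 hw.snd_mem), hw.adj_sub⟩

/-- No cycle lies properly inside an induced cycle. -/
theorem IndCycle.subset_of_isCycle {S : Set V} (hS : IndCycle G S) {u : V} {c : G.Walk u u}
    (hc : c.IsCycle) (hcS : ∀ v ∈ c.support, v ∈ S) : ∀ v ∈ S, v ∈ c.support := by
  have hconn := hS.connIn
  obtain ⟨u₀, c₀, hc₀, hs₀, hi₀⟩ := hS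
  intro v hv
  refine (hconn u (hcS u c.start_mem_support) v hv).mem_of_closed (A := {v | v ∈ c.support})
    c.start_mem_support ?_
  intro a ha b hb hab
  have h1 := hc.ncard_neighborSet_toSubgraph_eq_two ha
  have h2 := hc₀.ncard_neighborSet_toSubgraph_eq_two ((hs₀ a).2 (hcS a ha))
  have hsub : c.toSubgraph.neighborSet a ⊆ c₀.toSubgraph.neighborSet a := by
    intro w hw
    rw [Subgraph.mem_neighborSet] at hw ⊢
    rw [Walk.adj_toSubgraph_iff_mem_edges]
    exact hi₀ a (hcS a ha) w (hcS w (c.mem_verts_toSubgraph.1 hw.snd_mem)) hw.adj_sub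
  have heq := Set.eq_of_subset_of_ncard_le hsub (by omega)
    (Set.finite_of_ncard_ne_zero (by omega))
  have hb' : b ∈ c.toSubgraph.neighborSet a := by
    rw [heq, Subgraph.mem_neighborSet, Walk.adj_toSubgraph_iff_mem_edges]
    exact hi₀ a (hcS a ha) b hb hab
  rw [Subgraph.mem_neighborSet] at hb'
  exact c.mem_verts_toSubgraph.1 hb'.snd_mem

/-- Two internally disjoint connections of `t` and `r` inside an induced cycle cover it. -/
theorem IndCycle.subset_of_theta [Fintype V] {S A Z : Set V} (hS : IndCycle G S) {t r : V}
    (ht : t ∈ S) (hr : r ∈ S) (htr : t ≠ r) (hA : ConnIn G A) (hAS : A ⊆ S) (hZS : Z ⊆ S)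
    (hAZ : Disjoint A Z) (htA : t ∉ A) (hrA : r ∉ A) (hAt : Touch G A {t}) (hAr : Touch G A {r})
    (hZ : Linked G (Z ∪ {t, r}) t r) : S ⊆ A ∪ Z ∪ {t, r} := by
  obtain ⟨a, ha, _, rfl, hat⟩ := hAt
  obtain ⟨b, hb, _, rfl, hbr⟩ := hAr
  rename_i t r
  obtain ⟨p₀, hp₀⟩ := hA a ha b hb
  obtain ⟨q, hq⟩ := hZ
  set p : G.Walk t r := (p₀.concat hbr).cons hat.symm with hp
  have hpe : ∀ e, e ∈ p.edges ↔ e = s(t, a) ∨ e ∈ p₀.edges ∨ e = s(b, r) := by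
    intro e; simp [hp, Walk.edges_concat]
  have hps : ∀ v ∈ p.support, v ∈ A ∪ {t, r} := by
    intro v hv
    simp only [hp, Walk.support_cons, Walk.support_concat, List.mem_cons,
      List.mem_append, List.not_mem_nil, or_false] at hv
    rcases hv with rfl | hv | rfl
    exacts [Or.inr (Or.inl rfl), Or.inl (hp₀ _ hv), Or.inr (Or.inr rfl)]
  obtain ⟨x, hx⟩ : ∃ x, chain p s(t, x) ≠ 0 := by
    by_contra! hcon
    have h1 := congrFun (bd_chain p) t
    rw [bd, Finset.sum_eq_zero fun x _ => hcon x] at h1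
    simp [htr] at h1
  have hxp := mem_edges_of_chain_ne_zero hx
  have hxA : x ∈ A := by
    rcases (hpe _).1 hxp with h | h | h
    · rw [Sym2.eq_iff] at h
      rcases h with ⟨-, rfl⟩ | ⟨rfl, rfl⟩
      · exact ha
      · exact absurd ha htA
    · exact absurd (hp₀ _ (p₀.fst_mem_support_of_mem_edges h)) htA
    · rw [Sym2.eq_iff] at h
      rcases h with ⟨rfl, -⟩ | ⟨rfl, -⟩
      · exact absurd hb htA
      · exact absurd rfl htr
  have hxq : chain q s(t, x) = 0 := by
    by_contra h
    have h1 := hq _ (q.snd_mem_support_of_mem_edges (mem_edges_of_chain_ne_zero h))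
    rcases h1 with h1 | rfl | h1
    · exact Set.disjoint_left.1 hAZ hxA h1
    · exact htA hxA
    · exact hrA (h1 ▸ hxA)
  have hz : chain (p.append q.reverse) s(t, x) ≠ 0 := by
    rw [chain_append, chain_reverse, Pi.add_apply, hxq, add_zero]
    exact hx
  obtain ⟨u, c, hc, -, hce⟩ := exists_isCycle_of_mem_cycleSpace (chain_mem_cycleSpace _) hz
  have hcs : ∀ v ∈ c.support, v ∈ A ∪ Z ∪ {t, r} := by
    intro v hv
    have h2 := hc.ncard_neighborSet_toSubgraph_eq_two hv
    have h3 : (c.toSubgraph.neighborSet v).Nonempty := by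
      rw [← Set.ncard_pos (Set.finite_of_ncard_ne_zero (by omega))]; omega
    obtain ⟨w, hw⟩ := h3
    rw [Subgraph.mem_neighborSet, Walk.adj_toSubgraph_iff_mem_edges] at hw
    have h4 := Walk.fst_mem_support_of_mem_edges _ (mem_edges_of_chain_ne_zero (hce _ hw))
    rw [Walk.mem_support_append_iff, Walk.support_reverse, List.mem_reverse] at h4
    rcases h4 with h4 | h4
    · rcases hps v h4 with h | h
      exacts [Or.inl (Or.inl h), Or.inr h]
    · rcases hq v h4 with h | h
      exacts [Or.inl (Or.inr h), Or.inr h]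
  intro v hv
  refine hcs v (hS.subset_of_isCycle hc (fun w hw => ?_) v hv)
  rcases hcs w hw with (h | h) | rfl | h
  exacts [hAS h, hZS h, ht, h ▸ hr]

/-- A connected proper part of an induced cycle has at most two neighbors on it. -/
theorem IndCycle.exists_two_ends [Fintype V] {S A : Set V} (hS : IndCycle G S) (hAS : A ⊆ S)
    (hA : ConnIn G A) {v₀ : V} (hv₀ : v₀ ∈ S) (hvA : v₀ ∉ A) : ∃ a ∈ S, ∃ b ∈ S, a ∉ A ∧ b ∉ A ∧
      ∀ v ∈ S, v ∉ A → Touch G A {v} → v = a ∨ v = b := by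
  by_cases h1 : ∃ t ∈ S, t ∉ A ∧ Touch G A {t}
  · obtain ⟨t, ht, htA, hAt⟩ := h1
    by_cases h2 : ∃ r ∈ S, r ∉ A ∧ Touch G A {r} ∧ r ≠ t
    · obtain ⟨r, hr, hrA, hAr, hrt⟩ := h2
      refine ⟨t, ht, r, hr, htA, hrA, fun b hb hbA hAb => ?_⟩
      by_contra! hne
      obtain ⟨X, Z, hX, hZ, hXZ, hT, hSX⟩ := hS.exists_arcs ht hr hrt.symm
      obtain ⟨y, hy, -⟩ := id hAb
      have key : ∀ X Z, IsArc G S t r X → IsArc G S t r Z → Disjoint X Z → ¬ Touch G X Z →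
          S ⊆ X ∪ Z ∪ {t, r} → y ∈ X → False := by
        intro X Z hX hZ hXZ hT hSX hyX
        have hAX : A ⊆ X := by
          intro z hz
          refine (hA y hy z hz).mem_of_closed hyX fun p hp q hq hpq => ?_
          rcases hSX (hAS hq) with (h | h) | rfl | h
          · exact h
          · exact absurd ⟨p, hp, q, h, hpq⟩ hT
          · exact absurd hq htA
          · exact absurd (h ▸ hq) hrA
        have hb' := hS.subset_of_theta ht hr hrt.symm hA hAS hZ.sub (hXZ.mono_left hAX) htA hrA
          hAt hAr hZ.link hb
        obtain ⟨a, ha, _, rfl, hab⟩ := hAb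
        rcases hb' with (h | h) | rfl | h
        · exact hbA h
        · exact hT ⟨a, hAX ha, _, h, hab⟩
        · exact hne.1 rfl
        · exact hne.2 h
      rcases hSX (hAS hy) with (h | h) | rfl | h
      · exact key X Z hX hZ hXZ hT hSX h
      · exact key Z X hZ hX hXZ.symm (fun h => hT h.symm)
          (hSX.trans (by rw [Set.union_comm X Z])) h
      · exact htA hy
      · exact hrA (h ▸ hy)
    · push Not at h2
      exact ⟨t, ht, t, ht, htA, htA, fun v hv hvA hAv => Or.inl (h2 v hv hvA hAv)⟩
  · push Not at h1
    exact ⟨v₀, hv₀, v₀, hv₀, hvA, hvA, fun v hv hvA hAv => absurd hAv (h1 v hv hvA)⟩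

/-- The two ends of an edge of an induced cycle cut off a single nonempty arc. -/
theorem IndCycle.isArc_of_adj [Fintype V] {S : Set V} (hS : IndCycle G S) {x y : V} (hx : x ∈ S)
    (hy : y ∈ S) (hxy : G.Adj x y) : IsArc G S x y (S \ {x, y}) ∧ (S \ {x, y}).Nonempty := by
  have hne : (S \ {x, y}).Nonempty := by
    by_contra hcon
    rw [Set.not_nonempty_iff_eq_empty, Set.sdiff_eq_empty] at hcon
    obtain ⟨u, c, hc, hs, hi⟩ := hS
    have h2 := hc.ncard_neighborSet_toSubgraph_eq_two ((hs x).2 hx)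
    have h3 : c.toSubgraph.neighborSet x ⊆ {y} := by
      intro w hw
      rw [Subgraph.mem_neighborSet] at hw
      rcases hcon ((hs w).1 (c.mem_verts_toSubgraph.1 hw.snd_mem)) with h | h
      · exact absurd h.symm (G.ne_of_adj hw.adj_sub)
      · exact h
    have h4 := Set.ncard_le_ncard h3
    rw [Set.ncard_singleton] at h4
    omega
  obtain ⟨X, Z, hX, hZ, hXZ, hT, hSX⟩ := hS.exists_arcs hx hy hxy.ne
  have key : ∀ X, IsArc G S x y X → X.Nonempty → IsArc G S x y (S \ {x, y}) := by
    intro X hX hXne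
    have h1 := hS.subset_of_theta hx hy hxy.ne hX.conn hX.sub (Set.empty_subset _)
      (Set.disjoint_empty _) hX.left_notMem hX.right_notMem (hX.touch_left hXne)
      (hX.touch_right hXne) (Linked.of_adj hxy (by simp) (by simp))
    have h2 : S \ {x, y} = X := by
      ext v
      constructor
      · rintro ⟨hv, hv'⟩
        rcases h1 hv with (h | h) | h
        exacts [h, h.elim, absurd h hv']
      · intro hv
        refine ⟨hX.sub hv, ?_⟩
        rintro (rfl | h)
        exacts [hX.left_notMem hv, hX.right_notMem (h ▸ hv)]
    rwa [h2]
  refine ⟨?_, hne⟩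
  obtain ⟨v, hv, hv'⟩ := hne
  rcases hSX hv with (h | h) | h
  · exact key X hX ⟨v, h⟩
  · exact key Z hZ ⟨v, h⟩
  · exact absurd h hv'

/-- An induced cycle stays connected after removing a vertex. -/
theorem IndCycle.connIn_diff_singleton [Fintype V] {S : Set V} (hS : IndCycle G S) {t : V}
    (ht : t ∈ S) : ConnIn G (S \ {t}) := by
  obtain ⟨r, hr, htr⟩ := hS.exists_adj ht
  obtain ⟨h1, h2⟩ := hS.isArc_of_adj ht hr htr
  have h3 := h1.conn.union connIn_singleton (h1.touch_right h2)
  have h4 : S \ {t, r} ∪ {r} = S \ {t} := by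
    ext v
    have := htr.ne
    constructor
    · rintro (⟨hv, hv'⟩ | rfl)
      · exact ⟨hv, fun h => hv' (Or.inl h)⟩
      · exact ⟨hr, fun h => this h.symm⟩
    · rintro ⟨hv, hv'⟩
      by_cases h : v = r
      · exact Or.inr h
      · exact Or.inl ⟨hv, by rintro (h' | h'); exacts [hv' h', h h']⟩
  rwa [h4] at h3

/-- If two arcs cover an induced cycle then there is no edge between them. -/
theorem IndCycle.not_touch [Fintype V] {S A Z : Set V} (hS : IndCycle G S) {t r : V}
    (ht : t ∈ S) (hr : r ∈ S) (htr : t ≠ r) (hA : ConnIn G A) (hZ : ConnIn G Z)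
    (hAS : A ⊆ S) (hZS : Z ⊆ S) (hAZ : Disjoint A Z) (htA : t ∉ A) (hrA : r ∉ A) (htZ : t ∉ Z)
    (hrZ : r ∉ Z) (hAt : Touch G A {t}) (hAr : Touch G A {r})
    (hAZ' : S ⊆ A ∪ Z ∪ {t, r}) : ¬ Touch G A Z := by
  intro hT
  obtain ⟨X, Y, hX, hY, hXY, hnT, hSX⟩ := hS.exists_arcs ht hr htr
  have hAZc := hA.union hZ hT
  obtain ⟨a, ha, z, hz, haz⟩ := hT
  have key : ∀ X Y, IsArc G S t r X → IsArc G S t r Y → Disjoint X Y → ¬ Touch G X Y →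
      S ⊆ X ∪ Y ∪ {t, r} → a ∈ X → False := by
    intro X Y hX hY hXY hnT hSX haX
    have hsub : A ∪ Z ⊆ X := by
      intro w hw
      refine (hAZc a (Or.inl ha) w hw).mem_of_closed haX fun p hp q hq hpq => ?_
      have hqS : q ∈ S := hq.elim (fun h => hAS h) fun h => hZS h
      rcases hSX hqS with (h | h) | rfl | h
      · exact h
      · exact absurd ⟨p, hp, q, h, hpq⟩ hnT
      · exact (hq.elim htA htZ).elim
      · exact (hq.elim (fun h' => hrA (h ▸ h')) fun h' => hrZ (h ▸ h')).elim
    have hY0 : Y = ∅ := by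
      rw [Set.eq_empty_iff_forall_notMem]
      intro y hy
      rcases hAZ' (hY.sub hy) with h | rfl | h
      · exact Set.disjoint_left.1 hXY (hsub h) hy
      · exact hY.left_notMem hy
      · exact hY.right_notMem (h ▸ hy)
    have hlink := hY.link
    rw [hY0] at hlink
    rcases hS.subset_of_theta ht hr htr hA hAS (Set.empty_subset _) (Set.disjoint_empty _) htA hrA
      hAt hAr hlink (hZS hz) with (h | h) | rfl | h
    · exact Set.disjoint_left.1 hAZ h hz
    · exact h
    · exact htZ hz
    · exact hrZ (h ▸ hz)
  rcases hSX (hAS ha) with (h | h) | rfl | h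
  · exact key X Y hX hY hXY hnT hSX h
  · exact key Y X hY hX hXY.symm (fun h => hnT h.symm)
      (hSX.trans (by rw [Set.union_comm X Y])) h
  · exact htA ha
  · exact hrA (h ▸ ha)

end PlanarDcol

namespace PlanarDcol

section

variable {V : Type*} {G : SimpleGraph V}

/-- The non-isolated vertices. -/
def core (G : SimpleGraph V) : Set V := {v | ∃ w, G.Adj v w}

/-- Deleting at most two vertices does not disconnect the non-isolated vertices. -/
def ThreeConn (G : SimpleGraph V) : Prop := ∀ a b, ConnIn G (core G \ {a, b})

/-- An induced cycle whose removal does not disconnect the non-isolated vertices. -/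
structure Peripheral (G : SimpleGraph V) (S : Set V) : Prop where
  cycle : IndCycle G S
  conn : ConnIn G (core G \ S)

theorem IndCycle.subset_core {S : Set V} (hS : IndCycle G S) : S ⊆ core G := fun v hv => by
  obtain ⟨w, -, h⟩ := hS.exists_adj hv
  exact ⟨w, h⟩

theorem IndCycle.eq_of_subset {S T : Set V} (hS : IndCycle G S) (hT : IndCycle G T)
    (h : S ⊆ T) : S = T := by
  refine h.antisymm fun v hv => ?_
  obtain ⟨u, c, hc, hs, -⟩ := hS
  exact (hs v).1 (hT.subset_of_isCycle hc (fun w hw => h ((hs w).1 hw)) v hv)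

/-- In a connected set containing vertices of two sets without edges between them, some
component of the rest touches both. -/
theorem ConnIn.exists_between {S X Z : Set V} (hS : ConnIn G S) {p q : V} (hpS : p ∈ S)
    (hqS : q ∈ S) (hpX : p ∈ X) (hqZ : q ∈ Z) (hXZ : Disjoint X Z) (hT : ¬ Touch G X Z) :
    ∃ d ∈ S \ (X ∪ Z), Touch G (comp G (S \ (X ∪ Z)) d) X ∧ Touch G (comp G (S \ (X ∪ Z)) d) Z := by
  by_contra! hcon
  have hmem : q ∈ X ∪ {v | v ∈ S \ (X ∪ Z) ∧ Touch G (comp G (S \ (X ∪ Z)) v) X} := by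
    refine (hS p hpS q hqS).mem_of_closed (Or.inl hpX) ?_
    rintro a (ha | ⟨ha, haX⟩) b hb hab
    · by_cases hbX : b ∈ X
      · exact Or.inl hbX
      by_cases hbZ : b ∈ Z
      · exact absurd ⟨a, ha, b, hbZ, hab⟩ hT
      have hb' : b ∈ S \ (X ∪ Z) := ⟨hb, fun h => h.elim hbX hbZ⟩
      exact Or.inr ⟨hb', b, mem_comp_self hb', a, ha, hab.symm⟩
    · by_cases hbX : b ∈ X
      · exact Or.inl hbX
      by_cases hbZ : b ∈ Z
      · exact absurd ⟨a, mem_comp_self ha, b, hbZ, hab⟩ (hcon a ha haX)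
      have hb' : b ∈ S \ (X ∪ Z) := ⟨hb, fun h => h.elim hbX hbZ⟩
      refine Or.inr ⟨hb', ?_⟩
      rwa [comp_eq_of_mem (comp_closed (mem_comp_self ha) hb' hab)]
  rcases hmem with h | h
  · exact Set.disjoint_left.1 hXZ h hqZ
  · exact h.1.2 (Or.inr hqZ)

/-- A component of `S \ T` touches `T` if `S` is connected and meets `T`. -/
theorem ConnIn.touch_comp {S T : Set V} (hS : ConnIn G S) {d t : V} (hd : d ∈ S \ T)
    (htS : t ∈ S) (ht : t ∈ T) : Touch G (comp G (S \ T) d) T := by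
  obtain ⟨a, ⟨-, ha⟩, b, hb, hbA, hab⟩ := hS.exists_exit (A := comp G (S \ T) d) hd.1 htS
    (mem_comp_self hd) fun h => (comp_subset h).2 ht
  refine ⟨a, ha, b, ?_, hab⟩
  by_contra hbT
  exact hbA (comp_closed ha ⟨hb, hbT⟩ hab)

end

variable {V : Type} {G : SimpleGraph V}

theorem _root_.IsPlanar.false_of_branchSets_bipartite (hG : IsPlanar G) (B : Fin 3 ⊕ Fin 3 → Set V)
    (hc : ∀ i, ConnIn G (B i)) (hd : Pairwise (Function.onFun Disjoint B))
    (hT : ∀ i j, Touch G (B (.inl i)) (B (.inr j))) : False := by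
  have hne : ∀ i, (B i).Nonempty := by
    rintro (i | i)
    · obtain ⟨a, ha, -⟩ := hT i 0
      exact ⟨a, ha⟩
    · obtain ⟨a, -, b, hb, -⟩ := hT 0 i
      exact ⟨b, hb⟩
  refine hG.2 ⟨B, hne, fun i => (hc i).induce_connected (hne i), hd, ?_⟩
  rintro (i | i) (j | j) hij
  · simp at hij
  · exact hT i j
  · exact (hT j i).symm
  · simp at hij

theorem _root_.IsPlanar.false_of_touch_three (hG : IsPlanar G) {t r : V} {D X Y Z : Set V}
    (htr : t ≠ r) (hD : ConnIn G D) (hX : ConnIn G X) (hY : ConnIn G Y) (hZ : ConnIn G Z)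
    (htD : t ∉ D) (htX : t ∉ X) (htY : t ∉ Y) (htZ : t ∉ Z)
    (hrD : r ∉ D) (hrX : r ∉ X) (hrY : r ∉ Y) (hrZ : r ∉ Z)
    (hDX : Disjoint D X) (hDY : Disjoint D Y) (hDZ : Disjoint D Z)
    (hXY : Disjoint X Y) (hXZ : Disjoint X Z) (hYZ : Disjoint Y Z)
    (hXt : Touch G X {t}) (hYt : Touch G Y {t}) (hZt : Touch G Z {t})
    (hXr : Touch G X {r}) (hYr : Touch G Y {r}) (hZr : Touch G Z {r})
    (hXD : Touch G D X) (hYD : Touch G D Y) (hZD : Touch G D Z) : False := by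
  refine hG.false_of_branchSets_bipartite (Sum.elim ![{t}, {r}, D] ![X, Y, Z]) ?_ ?_ ?_
  · rintro (i | i) <;> fin_cases i
    exacts [connIn_singleton, connIn_singleton, hD, hX, hY, hZ]
  · have key : ∀ i j, i < j → Disjoint (Sum.elim (![{t}, {r}, D] : Fin 3 → Set V) ![X, Y, Z]
        (finSumFinEquiv.symm i)) (Sum.elim (![{t}, {r}, D] : Fin 3 → Set V) ![X, Y, Z]
        (finSumFinEquiv.symm j)) := by
      intro i j hij
      fin_cases i <;> fin_cases j <;> first | exact absurd hij (by decide) | skip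
      exacts [Set.disjoint_singleton.2 htr, Set.disjoint_singleton_left.2 htD,
        Set.disjoint_singleton_left.2 htX, Set.disjoint_singleton_left.2 htY,
        Set.disjoint_singleton_left.2 htZ, Set.disjoint_singleton_left.2 hrD,
        Set.disjoint_singleton_left.2 hrX, Set.disjoint_singleton_left.2 hrY,
        Set.disjoint_singleton_left.2 hrZ, hDX, hDY, hDZ, hXY, hXZ, hYZ]
    intro i j hij
    have h1 : finSumFinEquiv i ≠ finSumFinEquiv j := fun h => hij (finSumFinEquiv.injective h)
    rcases lt_or_gt_of_ne h1 with h | h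
    · simpa using key _ _ h
    · simpa using (key _ _ h).symm
  · intro i j
    fin_cases i <;> fin_cases j
    exacts [hXt.symm, hYt.symm, hZt.symm, hXr.symm, hYr.symm, hZr.symm, hXD, hYD, hZD]

theorem _root_.IsPlanar.false_of_five (hG : IsPlanar G) {t r : V} {X Y Z : Set V}
    (htr : G.Adj t r) (hX : ConnIn G X) (hY : ConnIn G Y) (hZ : ConnIn G Z)
    (htX : t ∉ X) (htY : t ∉ Y) (htZ : t ∉ Z) (hrX : r ∉ X) (hrY : r ∉ Y) (hrZ : r ∉ Z)
    (hXY : Disjoint X Y) (hXZ : Disjoint X Z) (hYZ : Disjoint Y Z)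
    (hXt : Touch G X {t}) (hYt : Touch G Y {t}) (hZt : Touch G Z {t})
    (hXr : Touch G X {r}) (hYr : Touch G Y {r}) (hZr : Touch G Z {r})
    (hXY' : Touch G X Y) (hXZ' : Touch G X Z) (hYZ' : Touch G Y Z) : False := by
  have hne : ∀ {X : Set V}, Touch G X {t} → X.Nonempty := fun ⟨a, ha, _⟩ => ⟨a, ha⟩
  have hsymm : ∀ {P : Fin 5 → Fin 5 → Prop}, (∀ i j, P i j → P j i) → (∀ i j, i < j → P i j) →
      ∀ i j, i ≠ j → P i j := fun hs hlt i j hij =>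
    (lt_or_gt_of_ne hij).elim (hlt i j) fun h => hs _ _ (hlt j i h)
  have hc : ∀ i, ConnIn G ((![{t}, {r}, X, Y, Z] : Fin 5 → Set V) i) := by
    intro i
    fin_cases i
    exacts [connIn_singleton, connIn_singleton, hX, hY, hZ]
  have hnon : ∀ i, ((![{t}, {r}, X, Y, Z] : Fin 5 → Set V) i).Nonempty := by
    intro i
    fin_cases i
    exacts [Set.singleton_nonempty _, Set.singleton_nonempty _, hne hXt, hne hYt, hne hZt]
  refine hG.1 ⟨![{t}, {r}, X, Y, Z], hnon, fun i => (hc i).induce_connected (hnon i), ?_, ?_⟩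
  · refine @(hsymm (P := fun i j => Disjoint ((![{t}, {r}, X, Y, Z] : Fin 5 → Set V) i)
      ((![{t}, {r}, X, Y, Z] : Fin 5 → Set V) j)) (fun i j h => h.symm) ?_)
    intro i j hij
    fin_cases i <;> fin_cases j <;> first | exact absurd hij (by decide) | skip
    exacts [Set.disjoint_singleton.2 htr.ne, Set.disjoint_singleton_left.2 htX,
      Set.disjoint_singleton_left.2 htY, Set.disjoint_singleton_left.2 htZ,
      Set.disjoint_singleton_left.2 hrX, Set.disjoint_singleton_left.2 hrY,
      Set.disjoint_singleton_left.2 hrZ, hXY, hXZ, hYZ]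
  · refine hsymm (P := fun i j => Touch G ((![{t}, {r}, X, Y, Z] : Fin 5 → Set V) i)
      ((![{t}, {r}, X, Y, Z] : Fin 5 → Set V) j)) (fun i j h => h.symm) ?_
    intro i j hij
    fin_cases i <;> fin_cases j <;> first | exact absurd hij (by decide) | skip
    exacts [⟨t, rfl, r, rfl, htr⟩, hXt.symm, hYt.symm, hZt.symm, hXr.symm, hYr.symm, hZr.symm,
      hXY', hXZ', hYZ']

end PlanarDcol

namespace PlanarDcol

variable {V : Type} [Fintype V] {G : SimpleGraph V}

omit [Fintype V] in
/-- The case of `Peripheral.inter_subset` where some vertex outside both cycles links the three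
arcs. -/
theorem IsPlanar.false_of_arcs (hG : IsPlanar G) {S T X Z : Set V} {t r d w : V}
    (hP : Peripheral G S) (ht : t ∈ S) (hr : r ∈ S) (htr : t ≠ r)
    (hX : IsArc G S t r X) (hZ : IsArc G S t r Z) (hXZ : Disjoint X Z) (hT : ConnIn G T)
    (hTS : Disjoint T S) (hTU : T ⊆ core G) (hTt : Touch G T {t}) (hTr : Touch G T {r})
    (hd : d ∈ (core G \ S) \ T) (hw : w ∈ T)
    (hDX : Touch G (comp G ((core G \ S) \ T) d) X)
    (hDZ : Touch G (comp G ((core G \ S) \ T) d) Z) : False := by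
  have hD := comp_subset (G := G) (S := (core G \ S) \ T) (u := d)
  have hDT := hP.conn.touch_comp hd ⟨hTU hw, Set.disjoint_left.1 hTS hw⟩ hw
  have hne : ∀ {A B : Set V}, Touch G A B → B.Nonempty := fun ⟨_, _, b, hb, _⟩ => ⟨b, hb⟩
  refine hG.false_of_touch_three htr connIn_comp hX.conn hZ.conn hT
    (fun h => (hD h).1.2 ht) hX.left_notMem hZ.left_notMem
    (fun h => Set.disjoint_left.1 hTS h ht) (fun h => (hD h).1.2 hr) hX.right_notMem
    hZ.right_notMem (fun h => Set.disjoint_left.1 hTS h hr) ?_ ?_ ?_ hXZ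
    (hTS.symm.mono_left hX.sub) (hTS.symm.mono_left hZ.sub)
    (hX.touch_left (hne hDX)) (hZ.touch_left (hne hDZ)) hTt (hX.touch_right (hne hDX))
    (hZ.touch_right (hne hDZ)) hTr hDX hDZ hDT
  · exact Set.disjoint_left.2 fun v hv hv' => (hD hv).1.2 (hX.sub hv')
  · exact Set.disjoint_left.2 fun v hv hv' => (hD hv).1.2 (hZ.sub hv')
  · exact Set.disjoint_left.2 fun v hv hv' => (hD hv).2 hv'

/-- Two peripheral cycles through an edge meet only in that edge. -/
theorem Peripheral.inter_subset (hG : IsPlanar G) (h3 : ThreeConn G) {S₁ S₂ : Set V}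
    (h₁ : Peripheral G S₁) (h₂ : Peripheral G S₂) (hne : S₁ ≠ S₂) {x y : V} (hxy : G.Adj x y)
    (hx₁ : x ∈ S₁) (hx₂ : x ∈ S₂) (hy₁ : y ∈ S₁) (hy₂ : y ∈ S₂) : S₁ ∩ S₂ ⊆ {x, y} := by
  obtain ⟨s, hs₂, hs₁⟩ : ∃ s ∈ S₂, s ∉ S₁ := by
    by_contra! hcon
    exact hne (h₂.cycle.eq_of_subset h₁.cycle hcon).symm
  have hs : s ∈ S₂ \ S₁ := ⟨hs₂, hs₁⟩
  obtain ⟨T, hTdef⟩ : ∃ T, T = comp G (S₂ \ S₁) s := ⟨_, rfl⟩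
  have hsT : s ∈ T := hTdef ▸ mem_comp_self hs
  have hTsub : T ⊆ S₂ \ S₁ := hTdef ▸ comp_subset
  have hTconn : ConnIn G T := hTdef ▸ connIn_comp
  have hTcl : ∀ a ∈ T, ∀ b ∈ S₂, G.Adj a b → b ∉ T → b ∈ S₁ ∩ S₂ := by
    intro a ha b hb hab hbT
    refine ⟨?_, hb⟩
    by_contra hb1
    rw [hTdef] at ha hbT
    exact hbT (comp_closed ha ⟨hb, hb1⟩ hab)
  have hatt : ∀ t ∈ S₂, t ∉ T → ∃ r ∈ S₁ ∩ S₂, r ≠ t ∧ Touch G T {r} := by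
    intro t ht htT
    obtain ⟨v, hv₁, hv₂, hvt⟩ : ∃ v, v ∈ S₁ ∧ v ∈ S₂ ∧ v ≠ t := by
      by_cases h : x = t
      · exact ⟨y, hy₁, hy₂, fun h' => hxy.ne (h.trans h'.symm)⟩
      · exact ⟨x, hx₁, hx₂, h⟩
    obtain ⟨a, ⟨-, ha⟩, b, ⟨hb, hbt⟩, hbT, hab⟩ :=
      (h₂.cycle.connIn_diff_singleton ht).exists_exit (A := T) (u := s) (v := v)
      ⟨hs₂, fun h => htT (h ▸ hsT)⟩ ⟨hv₂, hvt⟩ hsT fun h => (hTsub h).2 hv₁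
    exact ⟨b, hTcl a ha b hb hab hbT, hbt, a, ha, b, rfl, hab⟩
  obtain ⟨t, ht, -, hTt⟩ := hatt x hx₂ fun h => (hTsub h).2 hx₁
  obtain ⟨r, hr, hrt, hTr⟩ := hatt t ht.2 fun h => (hTsub h).2 ht.1
  have htr := hrt.symm
  have htT : t ∉ T := fun h => (hTsub h).2 ht.1
  have hrT : r ∉ T := fun h => (hTsub h).2 hr.1
  have hTS : Disjoint T S₁ := Set.disjoint_left.2 fun v hv => (hTsub hv).2
  have hTS₂ : T ⊆ S₂ := fun v hv => (hTsub hv).1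
  have hTU : T ⊆ core G := fun v hv => h₂.cycle.subset_core (hTS₂ hv)
  obtain ⟨X, Z, hX, hZ, hXZ, hT, hSX⟩ := h₁.cycle.exists_arcs ht.1 hr.1 htr
  by_cases hcase : X ⊆ S₂ ∨ Z ⊆ S₂
  · have key : ∀ X Z, IsArc G S₁ t r X → IsArc G S₁ t r Z → Disjoint X Z → ¬ Touch G X Z →
        S₁ ⊆ X ∪ Z ∪ {t, r} → Z ⊆ S₂ → S₁ ∩ S₂ ⊆ {x, y} := by
      clear hcase hX hZ hXZ hT hSX X Z
      intro X Z hX hZ hXZ hT hSX hZS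
      have hTZ : Disjoint T Z := hTS.mono_right hZ.sub
      have hcov := h₂.cycle.subset_of_theta ht.2 hr.2 htr hTconn hTS₂ hZS hTZ htT hrT hTt hTr
        hZ.link
      have hcov' : S₁ ∩ S₂ ⊆ Z ∪ {t, r} := by
        rintro v ⟨hv₁, hv₂⟩
        rcases hcov hv₂ with (h | h) | h
        · exact absurd hv₁ (hTsub h).2
        · exact Or.inl h
        · exact Or.inr h
      rcases Z.eq_empty_or_nonempty with hZe | ⟨z, hz⟩
      · rw [hZe, Set.empty_union] at hcov'
        refine hcov'.trans ?_
        have h1 := hcov' ⟨hx₁, hx₂⟩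
        have h2 := hcov' ⟨hy₁, hy₂⟩
        have h3 := hxy.ne
        intro v hv
        simp only [Set.mem_insert_iff, Set.mem_singleton_iff] at h1 h2 hv ⊢
        grind
      · exfalso
        have hTnZ := h₂.cycle.not_touch ht.2 hr.2 htr hTconn hZ.conn hTS₂ hZS hTZ htT hrT
          hZ.left_notMem hZ.right_notMem hTt hTr hcov
        have hmemU : ∀ v ∈ core G, v ∉ ({t, r} : Set V) → v ∈ core G \ {t, r} :=
          fun v h1 h2 => ⟨h1, h2⟩
        obtain ⟨z₀, ⟨-, hz₀⟩, u, ⟨huU, hutr⟩, huZ, hzu⟩ := (h3 t r).exists_exit (A := Z)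
          (u := z) (v := s)
          (hmemU z (h₁.cycle.subset_core (hZ.sub hz)) (by
            rintro (rfl | h)
            exacts [hZ.left_notMem hz, hZ.right_notMem (h ▸ hz)]))
          (hmemU s (hTU hsT) (by
            rintro (rfl | h)
            exacts [htT hsT, hrT (h ▸ hsT)])) hz
          (fun h => hs₁ (hZ.sub h))
        have hu₁ : u ∉ S₁ := fun h => by
          rcases hSX h with (h' | h') | h'
          · exact hT ⟨u, h', z₀, hz₀, hzu.symm⟩
          · exact huZ h'
          · exact hutr h'
        have huT : u ∉ T := fun h => hTnZ ⟨u, h, z₀, hz₀, hzu.symm⟩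
        have hu₂ : u ∉ S₂ := fun h => by
          rcases hcov h with (h' | h') | h'
          exacts [huT h', huZ h', hutr h']
        have hu : u ∈ (core G \ S₁) \ T := ⟨⟨huU, hu₁⟩, huT⟩
        have hXS : ∀ v ∈ X, v ∉ S₂ := by
          intro v hv hv₂
          rcases hcov' ⟨hX.sub hv, hv₂⟩ with h | rfl | h
          · exact Set.disjoint_left.1 hXZ hv h
          · exact hX.left_notMem hv
          · exact hX.right_notMem (h ▸ hv)
        obtain ⟨x', hx'⟩ : X.Nonempty := by
          rw [Set.nonempty_iff_ne_empty]
          intro hXe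
          have hl := hX.link
          rw [hXe] at hl
          rcases h₂.cycle.subset_of_theta ht.2 hr.2 htr hTconn hTS₂ (Set.empty_subset _)
            (Set.disjoint_empty _) htT hrT hTt hTr hl (hZS hz) with (h | h) | rfl | h
          · exact Set.disjoint_left.1 hTZ h hz
          · exact h
          · exact hZ.left_notMem hz
          · exact hZ.right_notMem (h ▸ hz)
        refine IsPlanar.false_of_arcs hG h₁ ht.1 hr.1 htr hX hZ hXZ hTconn hTS hTU hTt hTr hu hsT
          ?_ ⟨u, mem_comp_self hu, z₀, hz₀, hzu.symm⟩
        obtain ⟨a, ⟨-, ha⟩, b, ⟨hbU, hb₂⟩, hbD, hab⟩ := h₂.conn.exists_exit (u := u) (v := x')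
          (A := comp G ((core G \ S₁) \ T) u) ⟨huU, hu₂⟩
          ⟨h₁.cycle.subset_core (hX.sub hx'), hXS x' hx'⟩
          (mem_comp_self hu) (fun h => (comp_subset h).1.2 (hX.sub hx'))
        refine ⟨a, ha, b, ?_, hab⟩
        have hb₁ : b ∈ S₁ := by
          by_contra hb₁
          exact hbD (comp_closed ha ⟨⟨hbU, hb₁⟩, fun h => hb₂ (hTS₂ h)⟩ hab)
        rcases hSX hb₁ with (h | h) | rfl | h
        · exact h
        · exact absurd (hZS h) hb₂
        · exact absurd ht.2 hb₂
        · exact absurd (h ▸ hr.2) hb₂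
    rcases hcase with h | h
    · exact key Z X hZ hX hXZ.symm (fun h => hT h.symm)
        (hSX.trans (by rw [Set.union_comm X Z])) h
    · exact key X Z hX hZ hXZ hT hSX h
  · exfalso
    push Not at hcase
    obtain ⟨hcX, hcZ⟩ := hcase
    obtain ⟨p, hpX, hp₂⟩ := Set.not_subset.1 hcX
    obtain ⟨q, hqZ, hq₂⟩ := Set.not_subset.1 hcZ
    have hU := h₁.cycle.subset_core
    obtain ⟨d, ⟨⟨hdU, hd₂⟩, hdXZ⟩, hdX, hdZ⟩ := h₂.conn.exists_between (p := p) (q := q)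
      ⟨hU (hX.sub hpX), hp₂⟩ ⟨hU (hZ.sub hqZ), hq₂⟩ hpX hqZ hXZ hT
    have hsub : (core G \ S₂) \ (X ∪ Z) ⊆ (core G \ S₁) \ T := by
      rintro v ⟨⟨hvU, hv₂⟩, hvXZ⟩
      refine ⟨⟨hvU, fun hv₁ => ?_⟩, fun h => hv₂ (hTS₂ h)⟩
      rcases hSX hv₁ with h | rfl | h
      · exact hvXZ h
      · exact hv₂ ht.2
      · exact hv₂ (h ▸ hr.2)
    have hmono : comp G ((core G \ S₂) \ (X ∪ Z)) d ⊆ comp G ((core G \ S₁) \ T) d :=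
      fun v hv => Linked.mono hv hsub
    exact IsPlanar.false_of_arcs hG h₁ ht.1 hr.1 htr hX hZ hXZ hTconn hTS hTU hTt hTr
      (hsub ⟨⟨hdU, hd₂⟩, hdXZ⟩) hsT (hdX.mono hmono subset_rfl) (hdZ.mono hmono subset_rfl)

/-- Every edge lies in at most two peripheral cycles. -/
theorem Peripheral.not_three (hG : IsPlanar G) (h3 : ThreeConn G) {S : Fin 3 → Set V}
    (hS : ∀ i, Peripheral G (S i)) (hinj : Function.Injective S) {x y : V} (hxy : G.Adj x y)
    (hx : ∀ i, x ∈ S i) (hy : ∀ i, y ∈ S i) : False := by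
  obtain ⟨Q, hQdef⟩ : ∃ Q : Fin 3 → Set V, ∀ i, Q i = S i \ {x, y} := ⟨_, fun _ => rfl⟩
  obtain ⟨R, hR⟩ : ∃ R : Set V, R = {v | v ∈ core G ∧ ∀ i, v ∉ S i} := ⟨_, rfl⟩
  have hQ : ∀ i, IsArc G (S i) x y (Q i) ∧ (Q i).Nonempty := fun i => by
    rw [hQdef]; exact (hS i).cycle.isArc_of_adj (hx i) (hy i) hxy
  have hdis : ∀ i j, i ≠ j → Disjoint (Q i) (Q j) := by
    intro i j hij
    rw [Set.disjoint_left]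
    intro v hi hj
    rw [hQdef] at hi hj
    exact hi.2 (Peripheral.inter_subset hG h3 (hS i) (hS j) (hinj.ne hij) hxy (hx i) (hx j) (hy i)
      (hy j) ⟨hi.1, hj.1⟩)
  have hdS : ∀ i j, i ≠ j → ∀ v ∈ Q i, v ∉ S j := by
    intro i j hij v hv hvj
    have h1 := hdis i j hij
    rw [Set.disjoint_left] at h1
    refine h1 hv ?_
    rw [hQdef] at hv ⊢
    exact ⟨hvj, hv.2⟩
  have hRQ : ∀ i, ∀ d, Disjoint (comp G R d) (Q i) := by
    intro i d
    rw [Set.disjoint_left]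
    intro v hv hvi
    have h1 := comp_subset hv
    rw [hR] at h1
    exact h1.2 i ((hQ i).1.sub hvi)
  have hnot : ∀ d, ¬ (Touch G (comp G R d) (Q 0) ∧ Touch G (comp G R d) (Q 1) ∧
      Touch G (comp G R d) (Q 2)) := by
    rintro d ⟨h0, h1, h2⟩
    have hxR : ∀ d, x ∉ comp G R d := fun d h => by
      have := comp_subset h; rw [hR] at this; exact this.2 0 (hx 0)
    have hyR : ∀ d, y ∉ comp G R d := fun d h => by
      have := comp_subset h; rw [hR] at this; exact this.2 0 (hy 0)
    refine hG.false_of_touch_three hxy.ne connIn_comp (hQ 0).1.conn (hQ 1).1.conn (hQ 2).1.conn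
      (hxR d) (hQ 0).1.left_notMem (hQ 1).1.left_notMem (hQ 2).1.left_notMem
      (hyR d) (hQ 0).1.right_notMem (hQ 1).1.right_notMem (hQ 2).1.right_notMem
      (hRQ 0 d) (hRQ 1 d) (hRQ 2 d) (hdis 0 1 (by decide)) (hdis 0 2 (by decide))
      (hdis 1 2 (by decide)) ((hQ 0).1.touch_left (hQ 0).2) ((hQ 1).1.touch_left (hQ 1).2)
      ((hQ 2).1.touch_left (hQ 2).2) ((hQ 0).1.touch_right (hQ 0).2)
      ((hQ 1).1.touch_right (hQ 1).2) ((hQ 2).1.touch_right (hQ 2).2) h0 h1 h2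
  have hbridge : ∀ i j k, i ≠ j → j ≠ k → i ≠ k → (∀ l : Fin 3, l = i ∨ l = j ∨ l = k) →
      ∃ D, ConnIn G D ∧ D ⊆ R ∧ ConnIn G (Q i ∪ D) ∧ Touch G (Q i ∪ D) (Q j) ∧
        ∀ d ∈ D, D = comp G R d ∧ Touch G D (Q i) ∧ Touch G D (Q j) := by
    intro i j k hij hjk hik hall
    by_cases hT : Touch G (Q i) (Q j)
    · refine ⟨∅, fun _ h => h.elim, Set.empty_subset _, ?_, ?_, fun d h => h.elim⟩
      · rw [Set.union_empty]; exact (hQ i).1.conn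
      · rwa [Set.union_empty]
    · obtain ⟨p, hp⟩ := (hQ i).2
      obtain ⟨q, hq⟩ := (hQ j).2
      have hset : (core G \ S k) \ (Q i ∪ Q j) = R := by
        rw [hR]
        ext v
        constructor
        · rintro ⟨⟨h1, h2⟩, h3⟩
          have h4 : v ∉ ({x, y} : Set V) := by
            rintro (rfl | h)
            exacts [h2 (hx k), h2 (h ▸ hy k)]
          refine ⟨h1, fun l hl => ?_⟩
          rcases hall l with rfl | rfl | rfl
          · exact h3 (Or.inl (by rw [hQdef]; exact ⟨hl, h4⟩))
          · exact h3 (Or.inr (by rw [hQdef]; exact ⟨hl, h4⟩))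
          · exact h2 hl
        · rintro ⟨h1, h2⟩
          exact ⟨⟨h1, h2 k⟩, fun h => h.elim (fun h => h2 i ((hQ i).1.sub h))
            fun h => h2 j ((hQ j).1.sub h)⟩
      obtain ⟨d, hd, hdi, hdj⟩ := (hS k).conn.exists_between (p := p) (q := q)
        ⟨(hS i).cycle.subset_core ((hQ i).1.sub hp), hdS i k hik p hp⟩
        ⟨(hS j).cycle.subset_core ((hQ j).1.sub hq), hdS j k hjk q hq⟩ hp hq (hdis i j hij) hT
      rw [hset] at hd hdi hdj
      refine ⟨comp G R d, connIn_comp, comp_subset, (hQ i).1.conn.union connIn_comp hdi.symm,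
        hdj.mono Set.subset_union_right subset_rfl, fun d' hd' => ⟨?_, hdi, hdj⟩⟩
      exact (comp_eq_of_mem hd').symm
  obtain ⟨D₁, hc₁, hR₁, hQ₁, hT₁, hD₁⟩ := hbridge 0 1 2 (by decide) (by decide) (by decide)
    (by decide)
  obtain ⟨D₂, hc₂, hR₂, hQ₂, hT₂, hD₂⟩ := hbridge 0 2 1 (by decide) (by decide) (by decide)
    (by decide)
  obtain ⟨D₃, hc₃, hR₃, hQ₃, hT₃, hD₃⟩ := hbridge 1 2 0 (by decide) (by decide) (by decide)
    (by decide)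
  have hRi : ∀ i, ∀ v ∈ R, v ∉ Q i := by
    intro i v hv hvi
    rw [hR] at hv
    exact hv.2 i ((hQ i).1.sub hvi)
  have hxR : x ∉ R := fun h => by rw [hR] at h; exact h.2 0 (hx 0)
  have hyR : y ∉ R := fun h => by rw [hR] at h; exact h.2 0 (hy 0)
  have hd13 : Disjoint D₁ D₃ := by
    rw [Set.disjoint_left]
    intro d h1 h3
    obtain ⟨e1, a1, b1⟩ := hD₁ d h1
    obtain ⟨e3, a3, b3⟩ := hD₃ d h3
    rw [e1] at a1 b1
    rw [e3] at b3
    exact hnot d ⟨a1, b1, b3⟩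
  have hd23 : Disjoint D₂ D₃ := by
    rw [Set.disjoint_left]
    intro d h1 h3
    obtain ⟨e1, a1, b1⟩ := hD₂ d h1
    obtain ⟨e3, a3, b3⟩ := hD₃ d h3
    rw [e1] at a1 b1
    rw [e3] at a3
    exact hnot d ⟨a1, a3, b1⟩
  have hdQ : ∀ {D : Set V}, D ⊆ R → ∀ i, Disjoint D (Q i) := fun hD i =>
    Set.disjoint_left.2 fun v hv => hRi i v (hD hv)
  have hX : ConnIn G ((Q 0 ∪ D₁) ∪ (Q 0 ∪ D₂)) := by
    obtain ⟨q, hq⟩ := (hQ 0).2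
    exact hQ₁.union_of_mem hQ₂ (u := q) (Or.inl hq) (Or.inl hq)
  refine hG.false_of_five hxy (X := (Q 0 ∪ D₁) ∪ (Q 0 ∪ D₂)) (Y := Q 1 ∪ D₃) (Z := Q 2)
    hX hQ₃ (hQ 2).1.conn ?_ ?_ (hQ 2).1.left_notMem ?_ ?_ (hQ 2).1.right_notMem ?_ ?_ ?_
    (((hQ 0).1.touch_left (hQ 0).2).mono (fun v hv => Or.inl (Or.inl hv)) subset_rfl)
    (((hQ 1).1.touch_left (hQ 1).2).mono (fun v hv => Or.inl hv) subset_rfl)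
    ((hQ 2).1.touch_left (hQ 2).2)
    (((hQ 0).1.touch_right (hQ 0).2).mono (fun v hv => Or.inl (Or.inl hv)) subset_rfl)
    (((hQ 1).1.touch_right (hQ 1).2).mono (fun v hv => Or.inl hv) subset_rfl)
    ((hQ 2).1.touch_right (hQ 2).2)
    (hT₁.mono Set.subset_union_left Set.subset_union_left)
    (hT₂.mono Set.subset_union_right subset_rfl) hT₃
  · rintro ((h | h) | (h | h))
    exacts [(hQ 0).1.left_notMem h, hxR (hR₁ h), (hQ 0).1.left_notMem h, hxR (hR₂ h)]
  · rintro (h | h)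
    exacts [(hQ 1).1.left_notMem h, hxR (hR₃ h)]
  · rintro ((h | h) | (h | h))
    exacts [(hQ 0).1.right_notMem h, hyR (hR₁ h), (hQ 0).1.right_notMem h, hyR (hR₂ h)]
  · rintro (h | h)
    exacts [(hQ 1).1.right_notMem h, hyR (hR₃ h)]
  · simp only [Set.disjoint_union_left, Set.disjoint_union_right]
    have h1 := hdis 0 1 (by decide)
    have h2 := (hdQ hR₃ 0).symm
    exact ⟨⟨⟨h1, hdQ hR₁ 1⟩, h1, hdQ hR₂ 1⟩, ⟨h2, hd13⟩, h2, hd23⟩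
  · simp only [Set.disjoint_union_left]
    exact ⟨⟨hdis 0 2 (by decide), hdQ hR₁ 2⟩, hdis 0 2 (by decide), hdQ hR₂ 2⟩
  · simp only [Set.disjoint_union_left]
    exact ⟨hdis 1 2 (by decide), hdQ hR₃ 2⟩

end PlanarDcol

namespace PlanarDcol

variable {V : Type} [Fintype V] {G : SimpleGraph V}

omit [Fintype V] in
theorem ThreeConn.exists_touch (h3 : ThreeConn G) {S : Set V} {d t a b : V} (ha : a ∈ S)
    (hb : b ∈ S) (hd : d ∈ core G \ S) (ht : t ∈ core G \ S) (htd : t ∉ comp G (core G \ S) d) :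
    ∃ v ∈ S, v ≠ a ∧ v ≠ b ∧ Touch G (comp G (core G \ S) d) {v} := by
  have hmem : ∀ v ∈ core G \ S, v ∈ core G \ {a, b} := by
    rintro v ⟨h1, h2⟩
    refine ⟨h1, ?_⟩
    rintro (rfl | rfl)
    exacts [h2 ha, h2 hb]
  obtain ⟨x, ⟨-, hx⟩, y, hy, hyD, hxy⟩ := (h3 a b).exists_exit (hmem d hd) (hmem t ht)
    (mem_comp_self hd) htd
  refine ⟨y, ?_, fun h => hy.2 (Or.inl h), fun h => hy.2 (Or.inr h), x, hx, y, rfl, hxy⟩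
  by_contra hyS
  exact hyD (comp_closed hx ⟨hy.1, hyS⟩ hxy)

/-- If every bridge of an induced cycle other than `B` has an arc that avoids it and dominates
the feet of `B`, then some two vertices separate the graph. -/
theorem ThreeConn.false_of_dominating_arcs (h3 : ThreeConn G) {S : Set V} (hS : IndCycle G S)
    {b₀ d₀ : V} (hb₀ : b₀ ∈ core G \ S) (hd₀ : d₀ ∈ core G \ S)
    (hd₀B : d₀ ∉ comp G (core G \ S) b₀)
    (hA : ∀ d ∈ core G \ S, d ∉ comp G (core G \ S) b₀ → ∃ A ⊆ S, ConnIn G A ∧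
      (∀ v ∈ A, ¬ Touch G (comp G (core G \ S) d) {v}) ∧
      ∀ v ∈ S, Touch G (comp G (core G \ S) b₀) {v} → v ∈ A ∨ Touch G A {v}) : False := by
  set B := comp G (core G \ S) b₀ with hB
  set nB : Set V := {v | v ∈ S ∧ Touch G B {v}} with hnB
  have hb₀D : b₀ ∉ comp G (core G \ S) d₀ := fun h => hd₀B h.symm
  obtain ⟨u₀, hu₀⟩ : S.Nonempty := by
    obtain ⟨u, c, -, hs, -⟩ := hS
    exact ⟨u, (hs u).1 c.start_mem_support⟩
  obtain ⟨y₀, hy₀S, hy₀B⟩ : ∃ y ∈ S, y ∉ nB := by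
    obtain ⟨A, hAS, hAc, hAD, hAB⟩ := hA d₀ hd₀ hd₀B
    obtain ⟨v₀, hv₀, -, -, hv₀D⟩ := h3.exists_touch hu₀ hu₀ hd₀ hb₀ hb₀D
    obtain ⟨a, ha, b, hb, -, -, hab⟩ := hS.exists_two_ends hAS hAc hv₀ fun h => hAD v₀ h hv₀D
    obtain ⟨y, hy, hya, hyb, hyD⟩ := h3.exists_touch ha hb hd₀ hb₀ hb₀D
    have hyA : y ∉ A := fun h => hAD y h hyD
    refine ⟨y, hy, fun h => ?_⟩
    rcases hAB y hy h.2 with h' | h'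
    · exact hyA h'
    · exact (hab y hy hyA h').elim hya hyb
  set Y := comp G (S \ nB) y₀ with hY
  have hYS : Y ⊆ S \ nB := comp_subset
  have hy₀Y : y₀ ∈ Y := mem_comp_self ⟨hy₀S, hy₀B⟩
  obtain ⟨v₀, hv₀, -, -, hv₀B⟩ := h3.exists_touch hu₀ hu₀ hb₀ hd₀ hd₀B
  obtain ⟨s, hs, t, ht, hsY, htY, hst⟩ := hS.exists_two_ends (fun v hv => (hYS hv).1)
    (connIn_comp : ConnIn G Y) hv₀ fun h => (hYS h).2 ⟨hv₀, hv₀B⟩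
  obtain ⟨b', hb'S, hb's, hb't, hb'B⟩ := h3.exists_touch hs ht hb₀ hd₀ hd₀B
  have hmem : b' ∈ Y ∪ {v | v ∈ core G \ S ∧ v ∉ B ∧ Touch G (comp G (core G \ S) v) Y} := by
    refine (h3 s t y₀ ⟨hS.subset_core hy₀S, ?_⟩ b' ⟨hS.subset_core hb'S, ?_⟩).mem_of_closed
      (Or.inl hy₀Y) ?_
    · rintro (rfl | rfl)
      exacts [hsY hy₀Y, htY hy₀Y]
    · rintro (rfl | rfl)
      exacts [hb's rfl, hb't rfl]
    rintro a (haY | ⟨haS, haB, haY⟩) b ⟨hbc, hbst⟩ hab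
    · by_cases hbS : b ∈ S
      · left
        by_contra hbY
        exact hbst (hst b hbS hbY ⟨a, haY, b, rfl, hab⟩)
      · have hbB : b ∉ B := fun h => (hYS haY).2 ⟨(hYS haY).1, b, h, a, rfl, hab.symm⟩
        exact Or.inr ⟨⟨hbc, hbS⟩, hbB, b, mem_comp_self ⟨hbc, hbS⟩, a, haY, hab.symm⟩
    · by_cases hbS : b ∈ S
      · left
        by_contra hbY
        obtain ⟨x, hx, y, hy, hxy⟩ := haY
        obtain ⟨A, hAS, hAc, hAD, hAB⟩ := hA a haS haB
        have hyA : y ∉ A := fun h => hAD y h ⟨x, hx, y, rfl, hxy⟩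
        have hbA : b ∉ A := fun h => hAD b h ⟨a, mem_comp_self haS, b, rfl, hab⟩
        have hyb : y ≠ b := fun h => hbY (h ▸ hy)
        have key : ∀ X Z : Set V, IsArc G S y b Z → Disjoint X Z → ¬ Touch G X Z → A ⊆ X →
            False := by
          intro X Z hZ hXZ hT hAX
          have hZB : ∀ v ∈ Z ∪ {y}, v ∈ S \ nB := by
            rintro v (hv | rfl)
            · refine ⟨hZ.sub hv, fun h => ?_⟩
              rcases hAB v h.1 h.2 with h' | h'
              · exact Set.disjoint_left.1 hXZ (hAX h') hv
              · exact hT (h'.mono hAX (by simpa using hv))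
            · exact hYS hy
          obtain ⟨p, q, h1, h2, h3, h4, -⟩ := hZ.link.exists_exit (A := Z ∪ {y}) (Or.inr rfl)
            fun h => h.elim hZ.right_notMem fun h => hyb h.symm
          have hqb : q = b := by
            rcases h3 with h3 | h3 | h3
            exacts [absurd (Or.inl h3) h4, absurd (Or.inr h3) h4, h3]
          subst hqb
          have hp : p ∈ Y := Linked.trans hy (h1.mono fun v hv => hZB v hv.2)
          exact hbst (hst q hbS hbY ⟨p, hp, q, rfl, h2⟩)
        obtain ⟨X, Z, hX, hZ, hXZ, hT, hSXZ⟩ := hS.exists_arcs (hYS hy).1 hbS hyb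
        by_cases hAX : ∃ v ∈ A, v ∈ X
        · obtain ⟨v, hvA, hvX⟩ := hAX
          refine key X Z hZ hXZ hT fun w hw => (hAc v hvA w hw).mem_of_closed hvX ?_
          intro p hp q hq hpq
          rcases hSXZ (hAS hq) with (h | h) | h | h
          · exact h
          · exact absurd ⟨p, hp, q, h, hpq⟩ hT
          · exact absurd (h ▸ hq) hyA
          · exact absurd (h ▸ hq) hbA
        · refine key Z X hX hXZ.symm (fun h => hT h.symm) fun w hw => ?_
          rcases hSXZ (hAS hw) with (h | h) | h | h
          · exact absurd ⟨w, hw, h⟩ hAX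
          · exact h
          · exact absurd (h ▸ hw) hyA
          · exact absurd (h ▸ hw) hbA
      · have hbD : b ∈ comp G (core G \ S) a := comp_closed (mem_comp_self haS) ⟨hbc, hbS⟩ hab
        refine Or.inr ⟨⟨hbc, hbS⟩, fun h => haB ?_, ?_⟩
        · exact comp_closed h haS hab.symm
        · rwa [comp_eq_of_mem hbD]
  rcases hmem with h | h
  · exact (hYS h).2 ⟨hb'S, hb'B⟩
  · exact h.1.2 hb'S

end PlanarDcol

namespace PlanarDcol

variable {V : Type} [Fintype V] {G : SimpleGraph V}

/-- The number of edges in the support. -/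
noncomputable def weight (z : Sym2 V → ZMod 2) : ℕ := {e | z e ≠ 0}.ncard

/-- The edges of `z` avoid the vertices of `B`. -/
def Avoids (z : Sym2 V → ZMod 2) (B : Set V) : Prop := ∀ v ∈ B, ∀ u, z s(v, u) = 0

theorem weight_lt {z y : Sym2 V → ZMod 2} {e : Sym2 V} (h : ∀ e, y e ≠ 0 → z e ≠ 0)
    (he : z e ≠ 0) (hy : y e = 0) : weight y < weight z :=
  Set.ncard_lt_ncard ⟨h, fun h' => h' he hy⟩ (Set.toFinite _)

omit [Fintype V] in
theorem add_ne_zero_of {z y : Sym2 V → ZMod 2} (h : ∀ e, y e ≠ 0 → z e ≠ 0) {e : Sym2 V}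
    (he : (z + y) e ≠ 0) : z e ≠ 0 := by
  by_cases hy : y e = 0
  · simpa [hy] using he
  · exact h e hy

theorem weight_add_lt {z y : Sym2 V → ZMod 2} {e : Sym2 V} (h : ∀ e, y e ≠ 0 → z e ≠ 0)
    (he : y e ≠ 0) : weight (z + y) < weight z := by
  refine weight_lt (e := e) (fun e he => add_ne_zero_of h he) (h e he) ?_
  rw [Pi.add_apply, zmod_two_ne_zero.1 he, zmod_two_ne_zero.1 (h e he)]
  rfl

theorem weight_chain_le {u v : V} (p : G.Walk u v) : weight (chain p) ≤ p.length := by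
  classical
  calc weight (chain p) ≤ (p.edges.toFinset : Set (Sym2 V)).ncard :=
        Set.ncard_le_ncard (fun e he => by
          simpa using mem_edges_of_chain_ne_zero he) (Set.toFinite _)
    _ = p.edges.toFinset.card := Set.ncard_coe_finset _
    _ ≤ p.edges.length := List.toFinset_card_le _
    _ = p.length := p.length_edges

omit [Fintype V] in
theorem weight_chain_eq {u v : V} {p : G.Walk u v} (hp : p.IsTrail) :
    weight (chain p) = p.length := by
  classical
  have : {e | chain p e ≠ 0} = (p.edges.toFinset : Set (Sym2 V)) := by
    ext e
    simp [chain_ne_zero_iff hp]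
  rw [weight, this, Set.ncard_coe_finset, List.toFinset_card_of_nodup hp.edges_nodup,
    p.length_edges]

omit [Fintype V] in
theorem Avoids.of_imp {z y : Sym2 V → ZMod 2} {B : Set V} (hz : Avoids z B)
    (h : ∀ e, y e ≠ 0 → z e ≠ 0) : Avoids y B := fun v hv u => by
  by_contra hne
  exact h _ hne (hz v hv u)

omit [Fintype V] in
theorem Avoids.add {z y : Sym2 V → ZMod 2} {B : Set V} (hz : Avoids z B) (hy : Avoids y B) :
    Avoids (z + y) B := fun v hv u => by
  rw [Pi.add_apply, hz v hv u, hy v hv u, add_zero]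

omit [Fintype V] in
theorem chain_rotate [DecidableEq V] {u a : V} (c : G.Walk u u) (h : a ∈ c.support) :
    chain (c.rotate a h) = chain c := by
  conv_rhs => rw [← c.take_spec h]
  rw [Walk.rotate, chain_append, chain_append, add_comm]

/-- An element of the cycle space that is not a sum of smaller ones is an induced cycle. -/
theorem mem_or_eq_chain {M : Submodule (ZMod 2) (Sym2 V → ZMod 2)} {z : Sym2 V → ZMod 2}
    {B : Set V} (hz : z ∈ cycleSpace G) (hzB : Avoids z B)
    (hM : ∀ y ∈ cycleSpace G, Avoids y B → weight y < weight z → y ∈ M) :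
    z ∈ M ∨ ∃ (u : V) (c : G.Walk u u), c.IsCycle ∧ z = chain c ∧
      ∀ a ∈ c.support, ∀ b ∈ c.support, G.Adj a b → s(a, b) ∈ c.edges := by
  classical
  by_cases hz0 : z = 0
  · exact Or.inl (hz0 ▸ M.zero_mem)
  obtain ⟨e, he⟩ := Function.ne_iff.1 hz0
  obtain ⟨u, c, hc, hec, hcz⟩ := exists_isCycle_of_mem_cycleSpace hz he
  have hsub : ∀ e, chain c e ≠ 0 → z e ≠ 0 := fun e h => hcz e (mem_edges_of_chain_ne_zero h)
  by_cases heq : z = chain c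
  swap
  · left
    obtain ⟨f, hf⟩ := Function.ne_iff.1 heq
    have hf0 : chain c f = 0 := by
      by_contra h
      exact hf (by rw [zmod_two_ne_zero.1 h, zmod_two_ne_zero.1 (hsub f h)])
    have h1 : chain c ∈ M := hM _ (chain_mem_cycleSpace c) (hzB.of_imp hsub)
      (weight_lt hsub (fun h => hf (h.trans hf0.symm)) hf0)
    have h2 : z + chain c ∈ M := hM _ (add_mem hz (chain_mem_cycleSpace c))
      (hzB.add (hzB.of_imp hsub)) (weight_add_lt hsub ((chain_ne_zero_iff hc.isTrail).2 hec))
    have := sub_mem h2 h1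
    rwa [add_sub_cancel_right] at this
  by_cases hchord : ∀ a ∈ c.support, ∀ b ∈ c.support, G.Adj a b → s(a, b) ∈ c.edges
  · exact Or.inr ⟨u, c, hc, heq, hchord⟩
  left
  push Not at hchord
  obtain ⟨a, ha, b, hb, hab, hnot⟩ := hchord
  set c' := c.rotate a ha with hc'
  have hcc' : c'.IsCycle := hc.rotate ha
  have hch : z = chain c' := by rw [heq, hc', chain_rotate]
  have hedges : ∀ e, e ∈ c'.edges ↔ e ∈ c.edges := fun e => (c.rotate_edges a ha).mem_iff
  have hnot' : s(a, b) ∉ c'.edges := fun h => hnot ((hedges _).1 h)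
  have hb' : b ∈ c'.support := by
    rw [hc', Walk.mem_support_rotate_iff]; exact hb
  have hnB : ∀ x ∈ c'.support, x ∉ B := by
    intro x hx h
    have h2 := hcc'.ncard_neighborSet_toSubgraph_eq_two hx
    obtain ⟨w, hw⟩ : (c'.toSubgraph.neighborSet x).Nonempty := by
      rw [← Set.ncard_pos (Set.toFinite _)]; omega
    have h3 := (Walk.mem_edges_toSubgraph c').1 (Subgraph.mem_edgeSet.2 hw)
    exact (chain_ne_zero_iff hcc'.isTrail).2 h3 (hch ▸ hzB x h w)
  have hB : a ∉ B ∧ b ∉ B := ⟨hnB a c'.start_mem_support, hnB b hb'⟩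
  have hspec := c'.take_spec hb'
  set p := c'.takeUntil b hb' with hp
  set q := c'.dropUntil b hb' with hq
  have hlen : weight z = p.length + q.length := by
    rw [hch, weight_chain_eq hcc'.isTrail, ← hspec, Walk.length_append]
  have hpq : z = chain p + chain q := by rw [hch, ← hspec, chain_append]
  have hpe : ∀ e ∈ p.edges, e ∈ c'.edges := fun e h => by
    rw [← hspec, Walk.edges_append]; exact List.mem_append_left _ h
  have hqe : ∀ e ∈ q.edges, e ∈ c'.edges := fun e h => by
    rw [← hspec, Walk.edges_append]; exact List.mem_append_right _ h
  have key : ∀ {x y : V} (r : G.Walk x y), x ≠ y → s(x, y) ∉ c'.edges →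
      (∀ e ∈ r.edges, e ∈ c'.edges) → 2 ≤ r.length := by
    intro x y r hxy hn hr
    cases r with
    | nil => exact absurd rfl hxy
    | cons h r =>
      cases r with
      | nil => exact absurd (hr _ (by simp)) hn
      | cons h' r => simp
  have hp2 := key p hab.ne hnot' hpe
  have hq2 := key q hab.ne' (by rwa [Sym2.eq_swap]) hqe
  have hav : ∀ {x y : V} (r : G.Walk x y) (h : G.Adj y x), x ∉ B → y ∉ B →
      (∀ e ∈ r.edges, e ∈ c'.edges) → Avoids (chain (r.cons h)) B := by
    intro x y r h hx hy hr v hv w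
    by_contra hne
    have h1 := mem_edges_of_chain_ne_zero hne
    rw [Walk.edges_cons, List.mem_cons] at h1
    rcases h1 with h1 | h1
    · rcases Sym2.eq_iff.1 h1 with h1 | h1
      exacts [hy (h1.1 ▸ hv), hx (h1.1 ▸ hv)]
    · exact (chain_ne_zero_iff hcc'.isTrail).2 (hr _ h1) (hch ▸ hzB v hv w)
  have h1 := hM _ (chain_mem_cycleSpace (p.cons hab.symm)) (hav p hab.symm hB.1 hB.2 hpe)
    ((weight_chain_le _).trans_lt (by rw [hlen, Walk.length_cons]; omega))
  have h2 := hM _ (chain_mem_cycleSpace (q.cons hab)) (hav q hab hB.2 hB.1 hqe)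
    ((weight_chain_le _).trans_lt (by rw [hlen, Walk.length_cons]; omega))
  have h3 := add_mem h1 h2
  rw [chain_cons, chain_cons, Sym2.eq_swap] at h3
  have h4 : z = Pi.single s(a, b) 1 + chain p + (Pi.single s(a, b) 1 + chain q) := by
    ext e
    rw [hpq]
    simp only [Pi.add_apply]
    linear_combination - CharTwo.add_self_eq_zero ((Pi.single s(a, b) 1 : Sym2 V → ZMod 2) e)
  rwa [h4]

end PlanarDcol

namespace PlanarDcol

variable {V : Type} [Fintype V] {G : SimpleGraph V}

/-- Complete `z` by paths `f u` from a common vertex to the vertices `u` of odd degree. -/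
noncomputable def fill (f : V → Sym2 V → ZMod 2) (z : Sym2 V → ZMod 2) : Sym2 V → ZMod 2 :=
  z + ∑ u, bd z u • f u

theorem fill_add (f : V → Sym2 V → ZMod 2) (z y : Sym2 V → ZMod 2) :
    fill f (z + y) = fill f z + fill f y := by
  simp only [fill, bd_add, Pi.add_apply, add_smul, Finset.sum_add_distrib]
  abel

theorem fill_eq_self {f : V → Sym2 V → ZMod 2} {z : Sym2 V → ZMod 2} (hz : bd z = 0) :
    fill f z = z := by
  simp [fill, hz]

theorem fill_ne_zero {f : V → Sym2 V → ZMod 2} {z : Sym2 V → ZMod 2} {e : Sym2 V}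
    (h : fill f z e ≠ 0) : z e ≠ 0 ∨ ∃ u, bd z u ≠ 0 ∧ f u e ≠ 0 := by
  by_contra! hcon
  refine h ?_
  rw [fill, Pi.add_apply, hcon.1, Finset.sum_apply, zero_add]
  refine Finset.sum_eq_zero fun u _ => ?_
  by_cases hu : bd z u = 0
  · simp [hu]
  · simp [hcon.2 u hu]

theorem bd_smul (a : ZMod 2) (z : Sym2 V → ZMod 2) : bd (a • z) = a • bd z := by
  ext v
  simp [bd, Finset.mul_sum]

theorem bd_sum {ι : Type*} (s : Finset ι) (f : ι → Sym2 V → ZMod 2) :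
    bd (∑ i ∈ s, f i) = ∑ i ∈ s, bd (f i) := by
  classical
  induction s using Finset.induction_on with
  | empty => simp
  | insert i s hi ih => rw [Finset.sum_insert hi, Finset.sum_insert hi, bd_add, ih]

open Classical in
theorem fill_mem {f : V → Sym2 V → ZMod 2} {z : Sym2 V → ZMod 2} {d : V}
    (hz : ∀ e, z e ≠ 0 → e ∈ G.edgeSet)
    (hf : ∀ u, bd z u ≠ 0 → (bd (f u) = Pi.single d 1 + Pi.single u 1) ∧
      ∀ e, f u e ≠ 0 → e ∈ G.edgeSet) : fill f z ∈ cycleSpace G := by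
  refine ⟨fun e he => ?_, ?_⟩
  · rcases fill_ne_zero he with h | ⟨u, hu, h⟩
    exacts [hz e h, (hf u hu).2 e h]
  · have h1 : ∀ u, bd (bd z u • f u) = bd z u • (Pi.single d 1 + Pi.single u 1) := by
      intro u
      by_cases hu : bd z u = 0
      · simp [hu]
      · rw [bd_smul, (hf u hu).1]
    have h2 : ∑ u, bd z u = 0 := by
      rw [sum_bd hz]
      simp
    ext v
    rw [fill, bd_add, bd_sum]
    simp only [h1, Pi.add_apply, Finset.sum_apply, Pi.smul_apply, smul_eq_mul, mul_add,
      Finset.sum_add_distrib, ← Finset.sum_mul, h2, zero_mul, zero_add, Pi.zero_apply]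
    rw [Finset.sum_eq_single v (fun u _ hu => by simp [hu.symm]) (by simp)]
    simp only [Pi.single_eq_same, mul_one]
    exact CharTwo.add_self_eq_zero _

/-- An induced cycle is a sum of smaller pieces completed through the bridge at `d₀`, unless some
arc that avoids this bridge dominates the feet of the bridge at `b₀`. -/
theorem ThreeConn.chain_mem_or_exists (h3 : ThreeConn G) {M : Submodule (ZMod 2) (Sym2 V → ZMod 2)}
    {u : V} {c : G.Walk u u} {S : Set V} (hsupp : ∀ v, v ∈ c.support ↔ v ∈ S)
    {b₀ d₀ : V} (hb₀ : b₀ ∈ core G \ S) (hd₀ : d₀ ∈ core G \ S)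
    (hd₀B : d₀ ∉ comp G (core G \ S) b₀)
    (hM : ∀ y ∈ cycleSpace G, ∀ b' ∈ S, Touch G (comp G (core G \ S) b₀) {b'} →
      Avoids y (insert b' (comp G (core G \ S) b₀)) → y ∈ M) :
    chain c ∈ M ∨ ∃ A ⊆ S, ConnIn G A ∧
      (∀ v ∈ A, ¬ Touch G (comp G (core G \ S) d₀) {v}) ∧
      ∀ v ∈ S, Touch G (comp G (core G \ S) b₀) {v} → v ∈ A ∨ Touch G A {v} := by
  classical
  by_contra! hcon
  obtain ⟨hcM, hA⟩ := hcon
  set B := comp G (core G \ S) b₀ with hB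
  set D := comp G (core G \ S) d₀ with hD
  set nD : Set V := {v | v ∈ S ∧ Touch G D {v}} with hnD
  have hBS : ∀ v ∈ B, v ∉ S := fun v hv => (comp_subset hv).2
  have hDS : ∀ v ∈ D, v ∉ S := fun v hv => (comp_subset hv).2
  have hBD : ∀ v ∈ B, v ∉ D := fun v hv hvD => hd₀B (Linked.trans hv (Linked.symm hvD))
  have hf : ∀ v ∈ nD, ∃ f : Sym2 V → ZMod 2, bd f = Pi.single d₀ 1 + Pi.single v 1 ∧
      ∀ e, f e ≠ 0 → e ∈ G.edgeSet ∧ ∀ x ∈ e, x ∈ D ∨ x = v := by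
    rintro v ⟨-, x, hx, _, rfl, hxv⟩
    obtain ⟨p, hp⟩ := Linked.in_comp hx
    refine ⟨chain (p.append hxv.toWalk), bd_chain _, fun e he => ?_⟩
    have he := mem_edges_of_chain_ne_zero he
    refine ⟨Walk.edges_subset_edgeSet _ he, fun y hy => ?_⟩
    have hy := Walk.mem_support_of_mem_edges he hy
    rw [Walk.mem_support_append_iff] at hy
    rcases hy with hy | hy
    · exact Or.inl (hp y hy)
    · simp only [Walk.support_cons, Walk.support_nil, List.mem_cons, List.not_mem_nil,
        or_false] at hy
      rcases hy with rfl | rfl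
      exacts [Or.inl (hx), Or.inr rfl]
  choose! f hfb hfe using hf
  have hcS : ∀ e ∈ c.edges, ∀ x ∈ e, x ∈ S := fun e he x hx =>
    (hsupp x).1 (Walk.mem_support_of_mem_edges he hx)
  have piece : ∀ y : Sym2 V → ZMod 2, (∀ e, y e ≠ 0 → e ∈ c.edges) →
      (∀ v, v ∉ nD → bd y v = 0) → ∀ b' ∈ S, Touch G B {b'} → (∀ w, y s(b', w) = 0) →
      fill f y ∈ M := by
    intro y hy hyD b' hb' hb'B hyb
    have hyu : ∀ v, bd y v ≠ 0 → v ∈ nD := fun v hv => by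
      by_contra h
      exact hv (hyD v h)
    refine hM _ (fill_mem (d := d₀) (fun e he => c.edges_subset_edgeSet (hy e he)) fun v hv =>
      ⟨hfb v (hyu v hv), fun e he => (hfe v (hyu v hv) e he).1⟩) b' hb' hb'B ?_
    rintro v hv w
    by_contra hne
    have hbd : bd y b' = 0 := Finset.sum_eq_zero fun w _ => hyb w
    rcases fill_ne_zero hne with h | ⟨x, hx, h⟩
    · rcases hv with rfl | hv
      · exact h (hyb w)
      · exact hBS v hv (hcS _ (hy _ h) v (Sym2.mem_mk_left v w))
    · have hx' := hyu x hx
      rcases (hfe x hx' _ h).2 v (Sym2.mem_mk_left v w) with h' | rfl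
      · rcases hv with rfl | hv
        exacts [hDS v h' hb', hBD v hv h']
      · rcases hv with rfl | hv
        exacts [hx hbd, hBS v hv hx'.1]
  have main : ∀ n, ∀ z : Sym2 V → ZMod 2, weight z = n → (∀ e, z e ≠ 0 → e ∈ c.edges) →
      (∀ v, v ∉ nD → bd z v = 0) → fill f z ∈ M := by
    intro n
    induction n using Nat.strong_induction_on with
    | _ n ih =>
    rintro z rfl hz hzD
    by_cases hz0 : z = 0
    · subst hz0
      rw [fill_eq_self bd_zero]
      exact M.zero_mem
    obtain ⟨e, he⟩ := Function.ne_iff.1 hz0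
    have step : ∀ y : Sym2 V → ZMod 2, (∀ e, y e ≠ 0 → z e ≠ 0) → y e ≠ 0 →
        (∀ v, v ∉ nD → bd y v = 0) → (∃ b' ∈ S, Touch G B {b'} ∧ ∀ w, y s(b', w) = 0) →
        fill f z ∈ M := by
      rintro y hyz hye hyD ⟨b', hb', hb'B, hyb⟩
      have h1 := piece y (fun e h => hz e (hyz e h)) hyD b' hb' hb'B hyb
      have h2 := ih _ (weight_add_lt hyz hye) (z + y) rfl
        (fun e h => hz e (add_ne_zero_of hyz h)) fun v hv => by
          rw [bd_add, Pi.add_apply, hzD v hv, hyD v hv, add_zero]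
      rw [fill_add] at h2
      have := sub_mem h2 h1
      rwa [add_sub_cancel_right] at this
    have side : ∀ v w : V, e = s(v, w) → v ∉ nD → fill f z ∈ M := by
      rintro v w rfl hv
      have hvS : v ∈ S := hcS _ (hz _ he) v (Sym2.mem_mk_left v w)
      set A := comp G (S \ nD) v with hAdef
      have hvA : v ∈ A := mem_comp_self ⟨hvS, hv⟩
      have hAS : A ⊆ S \ nD := comp_subset
      set y : Sym2 V → ZMod 2 := fun e => if ∃ a ∈ A, a ∈ e then z e else 0 with hy
      have hyz : ∀ e, y e ≠ 0 → z e ≠ 0 ∧ ∃ a ∈ A, a ∈ e := by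
        intro e h
        simp only [hy] at h
        split_ifs at h with h'
        · exact ⟨h, h'⟩
        · exact absurd rfl h
      have hout : ∀ x w, y s(x, w) ≠ 0 → x ∉ A → w ∈ A ∧ s(x, w) ∈ c.edges := by
        intro x w h hx
        obtain ⟨h1, a, ha, hae⟩ := hyz _ h
        rcases Sym2.mem_iff.1 hae with rfl | rfl
        · exact absurd ha hx
        · exact ⟨ha, hz _ h1⟩
      refine step y (fun e h => (hyz e h).1) ?_ ?_ ?_
      · simp only [hy]
        rwa [if_pos ⟨v, hvA, Sym2.mem_mk_left v w⟩]
      · intro x hx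
        by_cases hxA : x ∈ A
        · rw [← hzD x hx]
          refine Finset.sum_congr rfl fun w _ => ?_
          simp only [hy]
          rw [if_pos ⟨x, hxA, Sym2.mem_mk_left x w⟩]
        · refine Finset.sum_eq_zero fun w _ => ?_
          by_contra hne
          obtain ⟨hw, hxw⟩ := hout x w hne hxA
          have hxS : x ∈ S := hcS _ hxw x (Sym2.mem_mk_left x w)
          exact hxA (comp_closed hw ⟨hxS, hx⟩ (c.adj_of_mem_edges hxw).symm)
      · obtain ⟨b', hb', hb'B, hb'A, hb't⟩ := hA A (fun v hv => (hAS hv).1) connIn_comp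
          fun v hv h => (hAS hv).2 ⟨(hAS hv).1, h⟩
        refine ⟨b', hb', hb'B, fun w => ?_⟩
        by_contra hne
        obtain ⟨hw, hxw⟩ := hout b' w hne hb'A
        exact hb't ⟨w, hw, b', rfl, (c.adj_of_mem_edges hxw).symm⟩
    induction e using Sym2.ind with
    | _ v w =>
    by_cases hv : v ∈ nD
    swap
    · exact side v w rfl hv
    by_cases hw : w ∈ nD
    swap
    · exact side w v Sym2.eq_swap hw
    have hvw : v ≠ w := (c.adj_of_mem_edges (hz _ he)).ne
    obtain ⟨b', hb', hbv, hbw, hb'B⟩ := h3.exists_touch hv.1 hw.1 hb₀ hd₀ hd₀B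
    refine step (Pi.single s(v, w) 1) ?_ (by simp) ?_ ⟨b', hb', hb'B, fun x => ?_⟩
    · intro e h
      by_cases heq : e = s(v, w)
      · exact heq ▸ he
      · simp [heq] at h
    · intro x hx
      rw [bd_single hvw, Pi.add_apply, Pi.single_eq_of_ne, Pi.single_eq_of_ne, add_zero]
      exacts [fun h => hx (h ▸ hw), fun h => hx (h ▸ hv)]
    · refine Pi.single_eq_of_ne (fun h => ?_) _
      rcases Sym2.eq_iff.1 h with h | h
      exacts [hbv h.1, hbw h.1]
  have := main _ (chain c) rfl (fun e he => mem_edges_of_chain_ne_zero he) fun v _ =>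
    congrFun (chain_mem_cycleSpace c).2 v
  rw [fill_eq_self (chain_mem_cycleSpace c).2] at this
  exact hcM this

/-- The peripheral cycles. -/
def peripheralSet (G : SimpleGraph V) : Set (Sym2 V → ZMod 2) :=
  {z | ∃ (u : V) (c : G.Walk u u), c.IsCycle ∧ Peripheral G {v | v ∈ c.support} ∧
    (∀ a ∈ c.support, ∀ b ∈ c.support, G.Adj a b → s(a, b) ∈ c.edges) ∧ z = chain c}

/-- Tutte's theorem: the peripheral cycles span the cycle space of a 3-connected graph. -/
theorem ThreeConn.mem_span_peripheralSet (h3 : ThreeConn G) {z : Sym2 V → ZMod 2}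
    (hz : z ∈ cycleSpace G) : z ∈ Submodule.span (ZMod 2) (peripheralSet G) := by
  classical
  have main : ∀ n m, ∀ (B : Set V) (z : Sym2 V → ZMod 2), Fintype.card V - B.ncard = n →
      weight z = m → B ⊆ core G → ConnIn G B → z ∈ cycleSpace G → Avoids z B →
      z ∈ Submodule.span (ZMod 2) (peripheralSet G) := by
    intro n
    induction n using Nat.strong_induction_on with
    | _ n ih1 =>
    intro m
    induction m using Nat.strong_induction_on with
    | _ m ih2 =>
    rintro B z rfl rfl hBc hB hz hzB
    have H1 : ∀ (B' : Set V) (y : Sym2 V → ZMod 2), B.ncard < B'.ncard → B' ⊆ core G →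
        ConnIn G B' → y ∈ cycleSpace G → Avoids y B' →
        y ∈ Submodule.span (ZMod 2) (peripheralSet G) := by
      intro B' y hlt
      have : B'.ncard ≤ Fintype.card V := by
        rw [← Nat.card_eq_fintype_card]; exact Set.ncard_le_card _
      exact ih1 _ (by omega) _ B' y rfl rfl
    rcases mem_or_eq_chain hz hzB fun y hy hyB hlt => ih2 _ hlt B y rfl rfl hBc hB hy hyB with
      h | ⟨u, c, hc, rfl, hchord⟩
    · exact h
    set S : Set V := {v | v ∈ c.support} with hSdef
    have hS : IndCycle G S := ⟨u, c, hc, fun v => Iff.rfl, hchord⟩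
    have havoid : ∀ B' : Set V, B' ⊆ core G \ S → Avoids (chain c) B' := by
      intro B' hB' v hv w
      by_contra hne
      exact (hB' hv).2
        (Walk.mem_support_of_mem_edges (mem_edges_of_chain_ne_zero hne) (Sym2.mem_mk_left v w))
    by_cases hbig : ∃ B' : Set V, B' ⊆ core G \ S ∧ ConnIn G B' ∧ B.ncard < B'.ncard
    · obtain ⟨B', h1, h2, h4⟩ := hbig
      exact H1 B' _ h4 (fun v hv => (h1 hv).1) h2 hz (havoid B' h1)
    push Not at hbig
    by_cases hconn : ConnIn G (core G \ S)
    · exact Submodule.subset_span ⟨u, c, hc, ⟨hS, hconn⟩, hchord, rfl⟩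
    have hBS : B ⊆ core G \ S := by
      refine fun v hv => ⟨hBc hv, fun hvS => ?_⟩
      have h2 := hc.ncard_neighborSet_toSubgraph_eq_two hvS
      obtain ⟨w, hw⟩ : (c.toSubgraph.neighborSet v).Nonempty := by
        rw [← Set.ncard_pos (Set.toFinite _)]; omega
      have h4 := (Walk.mem_edges_toSubgraph c).1 (Subgraph.mem_edgeSet.2 hw)
      exact (chain_ne_zero_iff hc.isTrail).2 h4 (hzB v hv w)
    rw [ConnIn] at hconn
    push Not at hconn
    obtain ⟨x, hx, y, hy, hxy⟩ := hconn
    obtain ⟨b₀, hb₀⟩ : B.Nonempty := by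
      rw [← Set.ncard_pos (Set.toFinite _)]
      have := hbig {x} (by simpa using hx) connIn_singleton
      rw [Set.ncard_singleton] at this
      omega
    have hBeq : B = comp G (core G \ S) b₀ :=
      Set.eq_of_subset_of_ncard_le (hB.subset_comp hb₀ hBS) (hbig _ comp_subset connIn_comp)
        (Set.toFinite _)
    obtain ⟨d₀, hd₀, hd₀B⟩ : ∃ d ∈ core G \ S, d ∉ comp G (core G \ S) b₀ := by
      by_contra! h
      exact hxy ((Linked.symm (h x hx)).trans (h y hy))
    by_contra hcon
    refine h3.false_of_dominating_arcs hS (hBS hb₀) hd₀ hd₀B fun d hd hdB => ?_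
    refine (h3.chain_mem_or_exists (S := S) (c := c) (fun v => Iff.rfl) (hBS hb₀) hd hdB
      (M := Submodule.span (ZMod 2) (peripheralSet G)) ?_).resolve_left hcon
    rintro y hy b' hb' ⟨a, ha, _, rfl, hab⟩ hyB
    rw [← hBeq] at ha hyB
    refine H1 _ y ?_ ?_ (hB.insert ha hab) hy hyB
    · rw [Set.ncard_insert_of_notMem (fun h => (hBS h).2 hb') (Set.toFinite _)]
      omega
    · exact Set.insert_subset (hS.subset_core hb') hBc
  exact main _ _ ∅ z rfl rfl (Set.empty_subset _) (fun u hu => absurd hu (Set.notMem_empty u)) hz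
    fun v hv => absurd hv (Set.notMem_empty v)

end PlanarDcol

namespace PlanarDcol

variable {V : Type} [Fintype V] {G : SimpleGraph V}

omit [Fintype V] in
theorem chain_eq_of_support_eq {u v : V} {c : G.Walk u u} {c' : G.Walk v v} (hc : c.IsCycle)
    (hc' : c'.IsCycle) (h : ∀ a ∈ c.support, ∀ b ∈ c.support, G.Adj a b → s(a, b) ∈ c.edges)
    (h' : ∀ a ∈ c'.support, ∀ b ∈ c'.support, G.Adj a b → s(a, b) ∈ c'.edges)
    (hs : ∀ x, x ∈ c.support ↔ x ∈ c'.support) : chain c = chain c' := by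
  have key : ∀ e, chain c e ≠ 0 ↔ chain c' e ≠ 0 := by
    intro e
    rw [chain_ne_zero_iff hc.isTrail, chain_ne_zero_iff hc'.isTrail]
    induction e using Sym2.ind with
    | _ x y =>
    constructor
    · intro he
      exact h' x ((hs x).1 (c.fst_mem_support_of_mem_edges he)) y
        ((hs y).1 (c.snd_mem_support_of_mem_edges he)) (c.adj_of_mem_edges he)
    · intro he
      exact h x ((hs x).2 (c'.fst_mem_support_of_mem_edges he)) y
        ((hs y).2 (c'.snd_mem_support_of_mem_edges he)) (c'.adj_of_mem_edges he)
  ext e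
  by_cases he : chain c e = 0
  · rw [he, not_not.1 fun h => (key e).2 h he]
  · rw [zmod_two_ne_zero.1 he, zmod_two_ne_zero.1 ((key e).1 he)]

theorem ThreeConn.macLane (hG : IsPlanar G) (h3 : ThreeConn G) : MacLane G := by
  classical
  have hfin : (peripheralSet G).Finite := Set.toFinite _
  refine ⟨hfin.toFinset.toList, ?_, ?_, ?_⟩
  · intro z hz
    obtain ⟨u, c, -, -, -, rfl⟩ := hfin.mem_toFinset.1 (Finset.mem_toList.1 hz)
    exact chain_mem_cycleSpace c
  · intro z hz
    have := h3.mem_span_peripheralSet hz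
    rwa [lspan, show {z | z ∈ hfin.toFinset.toList} = peripheralSet G by ext; simp]
  · intro e
    by_contra! hlt
    have hcard : 2 < (hfin.toFinset.filter fun z => z e ≠ 0).card := by
      refine hlt.trans_le ?_
      rw [cover, List.countP_eq_length_filter]
      have h1 : (hfin.toFinset.toList.filter fun z => z e ≠ 0).Nodup :=
        (Finset.nodup_toList _).filter _
      rw [← List.toFinset_card_of_nodup h1]
      refine Finset.card_le_card fun z hz => ?_
      simpa using hz
    obtain ⟨z, hz⟩ : ∃ z : Fin 3 → Sym2 V → ZMod 2, Function.Injective z ∧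
        ∀ i, z i ∈ peripheralSet G ∧ z i e ≠ 0 := by
      obtain ⟨a, ha, b, hb, c, hc, hab, hac, hbc⟩ := Finset.two_lt_card.1 hcard
      simp only [Finset.mem_filter, hfin.mem_toFinset] at ha hb hc
      refine ⟨![a, b, c], ?_, ?_⟩
      · intro i j hij
        fin_cases i <;> fin_cases j <;> simp_all
      · intro i
        fin_cases i
        exacts [ha, hb, hc]
    obtain ⟨hinj, hz⟩ := hz
    choose u c hc hp hi hzc using fun i => (hz i).1
    have he : ∀ i, e ∈ (c i).edges := fun i =>
      mem_edges_of_chain_ne_zero (hzc i ▸ (hz i).2)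
    induction e using Sym2.ind with
    | _ x y =>
    refine Peripheral.not_three hG h3 (S := fun i => {v | v ∈ (c i).support}) hp ?_
      ((c 0).adj_of_mem_edges (he 0)) (fun i => (c i).fst_mem_support_of_mem_edges (he i))
      (fun i => (c i).snd_mem_support_of_mem_edges (he i))
    intro i j hij
    apply hinj
    rw [hzc i, hzc j]
    exact chain_eq_of_support_eq (hc i) (hc j) (hi i) (hi j) fun x => Set.ext_iff.1 hij x

end PlanarDcol

namespace PlanarDcol

section

variable {V : Type*} [Fintype V] {G H K : SimpleGraph V}

omit [Fintype V] in
theorem lspan_cons (f : Sym2 V → ZMod 2) (l : List (Sym2 V → ZMod 2)) {z : Sym2 V → ZMod 2} :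
    z ∈ lspan (f :: l) ↔ ∃ a : ZMod 2, ∃ w ∈ lspan l, z = a • f + w := by
  rw [lspan, show {z | z ∈ f :: l} = insert f {z | z ∈ l} by ext; simp, Submodule.mem_span_insert]
  rfl

omit [Fintype V] in
theorem lspan_perm {l l' : List (Sym2 V → ZMod 2)} (h : l.Perm l') : lspan l = lspan l' := by
  rw [lspan, lspan, show {z | z ∈ l} = {z | z ∈ l'} by ext; simp [h.mem_iff]]

/-- Some face boundary of an edge can be omitted. -/
theorem MacLane.exists_cover_le_one (h : MacLane G) (e : Sym2 V) :
    ∃ l : List (Sym2 V → ZMod 2), (∀ z ∈ l, z ∈ cycleSpace G) ∧ cycleSpace G ≤ lspan l ∧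
      (∀ e, cover l e ≤ 2) ∧ cover l e ≤ 1 := by
  classical
  obtain ⟨l, hl, hs, hc⟩ := h
  by_cases h0 : ∃ f ∈ l, f e ≠ 0
  swap
  · push Not at h0
    refine ⟨l, hl, hs, hc, ?_⟩
    rw [cover, List.countP_eq_zero.2 (by simpa using h0)]
    omega
  obtain ⟨f, hf, hfe⟩ := h0
  have hp := List.perm_cons_erase hf
  set l' := l.erase f with hl'
  have hcov : ∀ e', cover l e' = cover l' e' + if f e' ≠ 0 then 1 else 0 := fun e' => by
    rw [cover_perm hp, cover_cons]
  have hle := hcov e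
  rw [if_pos hfe] at hle
  have h2 := hc e
  by_cases h1 : cover l e ≤ 1
  · exact ⟨l, hl, hs, hc, h1⟩
  have hmem : ∀ z ∈ l', z ∈ l := fun z hz => hp.mem_iff.2 (List.mem_cons_of_mem _ hz)
  refine ⟨l.sum :: l', ?_, ?_, ?_, ?_⟩
  · intro z hz
    rcases List.mem_cons.1 hz with rfl | hz
    · exact list_sum_mem hl
    · exact hl z (hmem z hz)
  · refine hs.trans (lspan_le.2 fun z hz => ?_)
    rcases List.mem_cons.1 (hp.mem_iff.1 hz) with rfl | hz
    · have h3 : z = l.sum - l'.sum := by rw [hp.sum_eq, List.sum_cons, add_sub_cancel_right]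
      rw [h3]
      refine sub_mem (mem_lspan (by simp)) (list_sum_mem fun y hy => mem_lspan (by simp [hy]))
    · exact mem_lspan (List.mem_cons_of_mem _ hz)
  · intro e'
    rw [cover_cons, sum_apply_eq_cover]
    have h3 := hc e'
    have h4 := hcov e'
    obtain h5 | h5 | h5 : cover l e' = 0 ∨ cover l e' = 1 ∨ cover l e' = 2 := by omega
    · rw [h5, if_neg (by decide)]
      omega
    · rw [h5, if_pos (by decide)]
      omega
    · rw [h5, if_neg (by decide)]
      omega
  · rw [cover_cons, sum_apply_eq_cover, show cover l e = 2 by omega]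
    rw [if_neg (by decide)]
    omega

theorem MacLane.of_deleteEdge (h : MacLane G) (hHG : H ≤ G) {e : Sym2 V}
    (hH : ∀ e' ∈ G.edgeSet, e' ≠ e → e' ∈ H.edgeSet) (he : e ∉ H.edgeSet) : MacLane H := by
  classical
  obtain ⟨l, hl, hs, hc, hce⟩ := h.exists_cover_le_one e
  have hmem : ∀ z ∈ l, z e = 0 → z ∈ cycleSpace H := fun z hz hze =>
    ⟨fun e' h' => hH e' ((hl z hz).1 e' h') fun h => h' (h ▸ hze), (hl z hz).2⟩
  have hzero : ∀ z ∈ cycleSpace H, z e = 0 := fun z hz => by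
    by_contra h
    exact he (hz.1 e h)
  by_cases h0 : ∃ f ∈ l, f e ≠ 0
  swap
  · push Not at h0
    exact ⟨l, fun z hz => hmem z hz (h0 z hz), (cycleSpace_mono hHG).trans hs, hc⟩
  obtain ⟨f, hf, hfe⟩ := h0
  have hp := List.perm_cons_erase hf
  set l' := l.erase f with hl'
  have hcov : ∀ e', cover l e' = cover l' e' + if f e' ≠ 0 then 1 else 0 := fun e' => by
    rw [cover_perm hp, cover_cons]
  have hle := hcov e
  rw [if_pos hfe] at hle
  have hl'e : ∀ z ∈ l', z e = 0 := by
    have h0 : cover l' e = 0 := by omega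
    rw [cover, List.countP_eq_zero] at h0
    simpa using h0
  have hspan : ∀ z ∈ lspan l', z e = 0 := by
    intro z hz
    have h1 : lspan l' ≤ LinearMap.ker (LinearMap.proj (R := ZMod 2) (φ := fun _ => ZMod 2) e) :=
      lspan_le.2 fun z hz => hl'e z hz
    exact h1 hz
  refine ⟨l', fun z hz => hmem z (hp.mem_iff.2 (List.mem_cons_of_mem _ hz)) (hl'e z hz), ?_,
    fun e' => le_trans (by rw [hcov]; omega) (hc e')⟩
  intro z hz
  have h1 := hs (cycleSpace_mono hHG hz)
  rw [lspan_perm hp, lspan_cons] at h1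
  obtain ⟨a, w, hw, rfl⟩ := h1
  have h2 := hzero _ hz
  rw [Pi.add_apply, hspan w hw, Pi.smul_apply, zmod_two_ne_zero.1 hfe, add_zero, smul_eq_mul,
    mul_one] at h2
  rwa [h2, zero_smul, zero_add]

theorem MacLane.sup (hG : MacLane G) (hH : MacLane H) (hGK : G ≤ K) (hHK : H ≤ K)
    (hz : ∀ z ∈ cycleSpace K, ∃ y ∈ cycleSpace G, ∃ w ∈ cycleSpace H, z = y + w) {e₀ : Sym2 V}
    (he : ∀ e ∈ G.edgeSet, e ∈ H.edgeSet → e = e₀) : MacLane K := by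
  obtain ⟨l, hl, hs, hc, hce⟩ := hG.exists_cover_le_one e₀
  obtain ⟨l', hl', hs', hc', hce'⟩ := hH.exists_cover_le_one e₀
  refine ⟨l ++ l', ?_, ?_, fun e => ?_⟩
  · intro z hz
    rcases List.mem_append.1 hz with hz | hz
    exacts [cycleSpace_mono hGK (hl z hz), cycleSpace_mono hHK (hl' z hz)]
  · intro z hzK
    obtain ⟨y, hy, w, hw, rfl⟩ := hz z hzK
    have h1 : lspan l ≤ lspan (l ++ l') := lspan_le.2 fun z hz => mem_lspan (by simp [hz])
    have h2 : lspan l' ≤ lspan (l ++ l') := lspan_le.2 fun z hz => mem_lspan (by simp [hz])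
    exact add_mem (h1 (hs hy)) (h2 (hs' hw))
  · rw [cover_append]
    have h1 := hc e
    have h2 := hc' e
    by_cases heq : e = e₀
    · subst heq
      omega
    have hzero : ∀ {F : SimpleGraph V} {m : List (Sym2 V → ZMod 2)},
        (∀ z ∈ m, z ∈ cycleSpace F) → e ∉ F.edgeSet → cover m e = 0 := by
      intro F m hm heF
      rw [cover, List.countP_eq_zero]
      intro z hz
      simp only [decide_eq_true_eq, not_not]
      by_contra h
      exact heF ((hm z hz).1 e h)
    by_cases hG : e ∈ G.edgeSet
    · rw [hzero hl' fun h => heq (he e hG h)]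
      omega
    · rw [hzero hl hG]
      omega

end

end PlanarDcol

namespace PlanarDcol

section

variable {V : Type*} {G H : SimpleGraph V}

theorem connIn_of_induce_connected {S : Set V} (h : (G.induce S).Connected) : ConnIn G S := by
  intro u hu v hv
  obtain ⟨p⟩ := h.preconnected ⟨u, hu⟩ ⟨v, hv⟩
  refine ⟨p.map (Embedding.induce S).toHom, fun z hz => ?_⟩
  have hz : z ∈ (p.map (Embedding.induce S).toHom).support := hz
  rw [Walk.support_map, List.mem_map] at hz
  obtain ⟨x, -, rfl⟩ := hz
  exact x.2

theorem Linked.of_adj_imp {S T : Set V} {u v : V} (h : Linked H S u v) (hST : S ⊆ T)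
    (hadj : ∀ x ∈ S, ∀ y ∈ S, H.Adj x y → Linked G T x y) : Linked G T u v := by
  obtain ⟨p, hp⟩ := h
  induction p with
  | nil => exact Linked.refl (hST (hp _ (by simp)))
  | @cons x y z hxy q ih =>
    exact (hadj x (hp _ (by simp)) y (hp _ (by simp)) hxy).trans
      (ih fun t ht => hp t (by simp [ht]))

theorem Linked.mem_core {S : Set V} {u v : V} (h : Linked G S u v) (huv : u ≠ v) : u ∈ core G := by
  obtain ⟨p, -⟩ := h
  cases p with
  | nil => exact absurd rfl huv
  | cons hxy q => exact ⟨_, hxy⟩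

end

section

variable {V W : Type} {G G₁ G₂ : SimpleGraph V} {F : SimpleGraph W}

theorem isMinor_mono (h : G₁ ≤ G) (hF : IsMinor F G₁) : IsMinor F G := by
  obtain ⟨B, hne, hc, hd, ha⟩ := hF
  refine ⟨B, hne, fun w => ?_, hd, fun w w' hw => ?_⟩
  · exact ConnIn.induce_connected (fun u hu v hv =>
      (connIn_of_induce_connected (hc w) u hu v hv).of_adj_imp subset_rfl
        fun x hx y hy hxy => Linked.of_adj (h hxy) hx hy) (hne w)
  · obtain ⟨u, hu, v, hv, huv⟩ := ha w w' hw
    exact ⟨u, hu, v, hv, h huv⟩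

/-- An added edge can be replaced by a path through an otherwise disjoint subgraph. -/
theorem isMinor_of_sup_edge (hF : ∀ w, ∃ w', F.Adj w w') {a b : V} (hab : a ≠ b) (h₁ : G₁ ≤ G)
    (h₂ : G₂ ≤ G) (hl : Linked G₂ Set.univ a b) (hcore : core G₁ ∩ core G₂ ⊆ {a, b})
    (h : IsMinor F (G₁ ⊔ edge a b)) : IsMinor F G := by
  classical
  obtain ⟨B, hne, hc, hd, ha⟩ := h
  set P := comp G₂ {b}ᶜ a with hP
  have haP : a ∈ P := mem_comp_self (by simpa using hab)
  have hPG : ConnIn G P := fun u hu v hv => (connIn_comp u hu v hv).of_adj_imp subset_rfl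
    fun x hx y hy hxy => Linked.of_adj (h₂ hxy) hx hy
  obtain ⟨t, ht, htb⟩ : ∃ t ∈ P, G.Adj t b := by
    obtain ⟨t, b', h1, h2, -, h4, -⟩ := hl.exists_exit (A := P) haP
      fun h => (comp_subset h) rfl
    have hb' : b' = b := by
      by_contra hne
      exact h4 (comp_closed h1.right_mem.2 hne h2)
    exact ⟨t, h1.right_mem.2, h₂ (hb' ▸ h2)⟩
  have hPcore : ∀ x ∈ P, x ≠ a → x ∈ core G₂ := fun x hx hxa => (Linked.symm hx).mem_core hxa
  have hBcore : ∀ w, ∀ x ∈ B w, x ≠ a → x ≠ b → x ∈ core G₁ := by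
    intro w x hx hxa hxb
    have h1 : x ∈ core (G₁ ⊔ edge a b) := by
      obtain ⟨w', hw⟩ := hF w
      obtain ⟨u, hu, v, hv, huv⟩ := ha w w' hw
      by_cases hxu : x = u
      · exact hxu ▸ ⟨v, huv⟩
      · exact (connIn_of_induce_connected (hc w) x hx u hu).mem_core hxu
    obtain ⟨y, hy | hy⟩ := h1
    · exact ⟨y, hy⟩
    · rw [edge_adj] at hy
      rcases hy.1 with h | h
      exacts [absurd h.1 hxa, absurd h.1 hxb]
  have hdP : ∀ w, a ∉ B w → Disjoint P (B w) := by
    intro w haw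
    rw [Set.disjoint_left]
    intro x hx hxw
    have hxa : x ≠ a := fun h => haw (h ▸ hxw)
    have hxb : x ≠ b := fun h => (comp_subset hx) h
    rcases hcore ⟨hBcore w x hxw hxa hxb, hPcore x hx hxa⟩ with h | h
    exacts [hxa h, hxb h]
  set B' : W → Set V := fun w => if a ∈ B w then B w ∪ P else B w with hB'
  have hpos : ∀ w, a ∈ B w → B' w = B w ∪ P := fun w h => if_pos h
  have hneg : ∀ w, a ∉ B w → B' w = B w := fun w h => if_neg h
  have hsub : ∀ w, B w ⊆ B' w := fun w => by
    by_cases h : a ∈ B w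
    · rw [hpos w h]
      exact Set.subset_union_left
    · rw [hneg w h]
  have hconn : ∀ w, ∀ x ∈ B w, ∀ y ∈ B w, Linked G (B' w) x y := by
    intro w x hx y hy
    refine (connIn_of_induce_connected (hc w) x hx y hy).of_adj_imp (hsub w) ?_
    have hlink : a ∈ B w → b ∈ B w → Linked G (B' w) a b := by
      intro haw hbw
      rw [hpos w haw]
      exact ((hPG a haP t ht).mono Set.subset_union_right).trans
        (Linked.of_adj htb (Or.inr ht) (Or.inl hbw))
    rintro x hx y hy (hxy | hxy)
    · exact Linked.of_adj (h₁ hxy) (hsub w hx) (hsub w hy)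
    · rw [edge_adj] at hxy
      rcases hxy.1 with ⟨rfl, rfl⟩ | ⟨rfl, rfl⟩
      exacts [hlink hx hy, (hlink hy hx).symm]
  refine ⟨B', fun w => (hne w).mono (hsub w), fun w => ?_, ?_, ?_⟩
  · refine ConnIn.induce_connected ?_ ((hne w).mono (hsub w))
    by_cases haw : a ∈ B w
    · have key : ∀ x ∈ B' w, Linked G (B' w) x a := by
        intro x hx
        have hx' := hx
        rw [hpos w haw] at hx
        rcases hx with hx | hx
        · exact hconn w x hx a haw
        · exact (hPG x hx a haP).mono (by rw [hpos w haw]; exact Set.subset_union_right)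
      exact fun x hx y hy => (key x hx).trans (key y hy).symm
    · intro x hx y hy
      rw [hneg w haw] at hx hy
      exact hconn w x hx y hy
  · intro w w' hww
    have h1 : Disjoint (B w) (B w') := hd hww
    change Disjoint (B' w) (B' w')
    by_cases haw : a ∈ B w
    · have haw' : a ∉ B w' := Set.disjoint_left.1 h1 haw
      rw [hpos w haw, hneg w' haw', Set.disjoint_union_left]
      exact ⟨h1, hdP w' haw'⟩
    · rw [hneg w haw]
      by_cases haw' : a ∈ B w'
      · rw [hpos w' haw', Set.disjoint_union_right]
        exact ⟨h1, (hdP w haw).symm⟩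
      · rwa [hneg w' haw']
  · intro w w' hww
    obtain ⟨u, hu, v, hv, huv | huv⟩ := ha w w' hww
    · exact ⟨u, hsub w hu, v, hsub w' hv, h₁ huv⟩
    · rw [edge_adj] at huv
      rcases huv.1 with ⟨rfl, rfl⟩ | ⟨rfl, rfl⟩
      · exact ⟨t, by rw [hpos w hu]; exact Or.inr ht, v, hsub w' hv, htb⟩
      · exact ⟨u, hsub w hu, t, by rw [hpos w' hv]; exact Or.inr ht, htb.symm⟩

theorem _root_.IsPlanar.mono (hG : IsPlanar G) (h : G₁ ≤ G) : IsPlanar G₁ :=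
  ⟨fun h' => hG.1 (isMinor_mono h h'), fun h' => hG.2 (isMinor_mono h h')⟩

theorem _root_.IsPlanar.sup_edge (hG : IsPlanar G) {a b : V} (hab : a ≠ b) (h₁ : G₁ ≤ G)
    (h₂ : G₂ ≤ G) (hl : Linked G₂ Set.univ a b) (hcore : core G₁ ∩ core G₂ ⊆ {a, b}) :
    IsPlanar (G₁ ⊔ edge a b) := by
  refine ⟨fun h => hG.1 (isMinor_of_sup_edge ?_ hab h₁ h₂ hl hcore h),
    fun h => hG.2 (isMinor_of_sup_edge ?_ hab h₁ h₂ hl hcore h)⟩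
  · intro w
    exact ⟨w + 1, by simp⟩
  · rintro (w | w)
    exacts [⟨Sum.inr 0, by simp⟩, ⟨Sum.inl 0, by simp⟩]

end

end PlanarDcol

namespace PlanarDcol

section

variable {V : Type*} {G : SimpleGraph V}

/-- The subgraph of the edges that satisfy a symmetric condition. -/
def filterGraph (G : SimpleGraph V) (P : V → V → Prop) (hP : ∀ u v, P u v → P v u) :
    SimpleGraph V where
  Adj u v := G.Adj u v ∧ P u v
  symm := ⟨fun u v h => ⟨h.1.symm, hP u v h.2⟩⟩
  loopless := ⟨fun _ h => h.1.ne rfl⟩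

/-- A separation of order at most two. -/
theorem exists_separation (h : ¬ ThreeConn G) : ∃ (a b x y : V) (G₁ G₂ : SimpleGraph V),
    G = G₁ ⊔ G₂ ∧ Disjoint G₁.edgeSet G₂.edgeSet ∧ core G₁ ∩ core G₂ ⊆ {a, b} ∧
    x ∈ core G₁ ∧ y ∈ core G₂ ∧ x ≠ a ∧ x ≠ b ∧ y ≠ a ∧ y ≠ b := by
  classical
  simp only [ThreeConn, ConnIn, not_forall] at h
  obtain ⟨a, b, x, hx, y, hy, hxy⟩ := h
  set K := comp G (core G \ {a, b}) x with hK
  have hxK : x ∈ K := mem_comp_self hx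
  refine ⟨a, b, x, y, filterGraph G (fun u v => u ∈ K ∨ v ∈ K) fun _ _ h => h.symm,
    filterGraph G (fun u v => ¬ (u ∈ K ∨ v ∈ K)) fun _ _ h h' => h h'.symm, ?_, ?_, ?_, ?_, ?_,
    fun h => hx.2 (Or.inl h), fun h => hx.2 (Or.inr h), fun h => hy.2 (Or.inl h),
    fun h => hy.2 (Or.inr h)⟩
  · ext u v
    simp only [filterGraph, SimpleGraph.sup_adj]
    tauto
  · rw [Set.disjoint_left]
    intro e he he'
    induction e using Sym2.ind with
    | _ u v => exact he'.2 he.2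
  · rintro v ⟨⟨w, hvw, hK1⟩, w', hvw', hK2⟩
    push Not at hK2
    by_contra hv
    exact hK2.1 (comp_closed (hK1.resolve_left hK2.1) ⟨⟨w, hvw⟩, hv⟩ hvw.symm)
  · obtain ⟨w, hw⟩ := hx.1
    exact ⟨w, hw, Or.inl hxK⟩
  · obtain ⟨w, hw⟩ := hy.1
    refine ⟨w, hw, ?_⟩
    rintro (h | h)
    exacts [hxy h, hxy (comp_closed h hy hw.symm)]

end

section

variable {V : Type*} [Fintype V] {G G₁ G₂ : SimpleGraph V}

theorem bd_eq_zero_of_notMem_core {z : Sym2 V → ZMod 2} (hz : ∀ e, z e ≠ 0 → e ∈ G.edgeSet)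
    {v : V} (hv : v ∉ core G) : bd z v = 0 :=
  Finset.sum_eq_zero fun u _ => by
    by_contra h
    exact hv ⟨u, hz _ h⟩

theorem zmod_two_eq_of_add_eq_zero {x y : ZMod 2} (h : x + y = 0) : x = y := by
  revert x y; decide

/-- Splitting a cycle along a separation of order two. -/
theorem exists_split {z : Sym2 V → ZMod 2} (hz : z ∈ cycleSpace (G₁ ⊔ G₂)) {a b : V}
    (hcore : core G₁ ∩ core G₂ ⊆ {a, b}) : ∃ y w : Sym2 V → ZMod 2, z = y + w ∧
      (∀ e, y e ≠ 0 → e ∈ G₁.edgeSet) ∧ (∀ e, w e ≠ 0 → e ∈ G₂.edgeSet) ∧ bd y = bd w ∧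
      (∀ v, v ≠ a → v ≠ b → bd y v = 0) ∧ (a = b → bd y = 0) ∧ bd y a = bd y b := by
  classical
  set y : Sym2 V → ZMod 2 := fun e => if e ∈ G₁.edgeSet then z e else 0 with hy
  have hy1 : ∀ e, y e ≠ 0 → e ∈ G₁.edgeSet := by
    intro e he
    simp only [hy] at he
    split_ifs at he with h
    · exact h
    · exact absurd rfl he
  have hw1 : ∀ e, (z - y) e ≠ 0 → e ∈ G₂.edgeSet := by
    intro e he
    have h1 : e ∉ G₁.edgeSet := fun h => he (by simp [hy, h])
    have h2 : z e ≠ 0 := by simpa [hy, h1] using he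
    have h3 := hz.1 e h2
    rw [SimpleGraph.edgeSet_sup] at h3
    exact h3.resolve_left h1
  have hsum : z = y + (z - y) := (add_sub_cancel y z).symm
  have hbd : bd y = bd (z - y) := by
    have h1 := hz.2
    rw [hsum, bd_add] at h1
    ext v
    have := congrFun h1 v
    exact zmod_two_eq_of_add_eq_zero this
  have h0 : ∀ v, v ≠ a → v ≠ b → bd y v = 0 := by
    intro v hva hvb
    by_cases h1 : v ∈ core G₁
    · rw [hbd]
      refine bd_eq_zero_of_notMem_core hw1 fun h2 => ?_
      rcases hcore ⟨h1, h2⟩ with h | h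
      exacts [hva h, hvb h]
    · exact bd_eq_zero_of_notMem_core hy1 h1
  have htot : ∑ v, bd y v = 0 := by
    rw [sum_bd hy1]
    simp
  have hab : a = b → bd y = 0 := by
    rintro rfl
    rw [Finset.sum_eq_single a (fun v _ hv => h0 v hv hv) (by simp)] at htot
    ext v
    by_cases hv : v = a
    · rw [hv, htot, Pi.zero_apply]
    · exact h0 v hv hv
  refine ⟨y, z - y, hsum, hy1, hw1, hbd, h0, hab, ?_⟩
  by_cases heq : a = b
  · rw [heq]
  rw [← Finset.sum_subset (Finset.subset_univ {a, b}) fun v _ hv => ?_, Finset.sum_pair heq] at htot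
  · exact zmod_two_eq_of_add_eq_zero htot
  · simp only [Finset.mem_insert, Finset.mem_singleton, not_or] at hv
    exact h0 v hv.1 hv.2

/-- The boundary sums to zero over every component. -/
theorem bd_eq_zero_of_not_linked {z : Sym2 V → ZMod 2} (hz : ∀ e, z e ≠ 0 → e ∈ G.edgeSet)
    {a b : V} (h0 : ∀ v, v ≠ a → v ≠ b → bd z v = 0) (hab : ¬ Linked G Set.univ a b) :
    bd z a = 0 := by
  classical
  have h1 := sum_bd hz (Finset.univ.filter fun v => v ∈ comp G Set.univ a)
  rw [Finset.sum_eq_single a, Finset.sum_eq_zero] at h1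
  · exact h1
  · intro v hv
    refine Finset.sum_eq_zero fun u hu => ?_
    by_contra hne
    simp only [Finset.mem_filter, Finset.mem_univ, true_and, Finset.mem_compl] at hv hu
    exact hu (comp_closed hv (Set.mem_univ u) (hz _ hne))
  · intro v hv hva
    simp only [Finset.mem_filter, Finset.mem_univ, true_and] at hv
    exact h0 v hva fun h => hab (h ▸ hv)
  · intro h
    exact absurd (mem_comp_self (Set.mem_univ a)) (by simpa using h)

theorem ncard_edgeSet_pos {x : V} (hx : x ∈ core G) : 0 < G.edgeSet.ncard := by
  obtain ⟨w, hw⟩ := hx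
  exact (Set.ncard_pos (Set.toFinite _)).2 ⟨s(x, w), hw⟩

theorem one_lt_ncard_edgeSet {a b x : V} (hx : x ∈ core G) (hxa : x ≠ a) (hxb : x ≠ b)
    (hab : a ≠ b) (hl : Linked G Set.univ a b) : 1 < G.edgeSet.ncard := by
  obtain ⟨w, hw⟩ := hx
  obtain ⟨a', ha'⟩ := hl.mem_core hab
  obtain ⟨b', hb'⟩ := hl.symm.mem_core hab.symm
  rw [Set.one_lt_ncard (Set.toFinite _)]
  by_cases hwa : w = a
  · refine ⟨s(x, w), hw, s(b, b'), hb', fun h => ?_⟩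
    rcases Sym2.eq_iff.1 h with h | h
    exacts [hxb h.1, hab (hwa.symm.trans h.2)]
  · refine ⟨s(x, w), hw, s(a, a'), ha', fun h => ?_⟩
    rcases Sym2.eq_iff.1 h with h | h
    exacts [hxa h.1, hwa h.2]

theorem ncard_edgeSet_sup_edge_le (a b : V) :
    (G ⊔ edge a b).edgeSet.ncard ≤ G.edgeSet.ncard + 1 := by
  rw [SimpleGraph.edgeSet_sup]
  refine (Set.ncard_union_le _ _).trans (Nat.add_le_add_left ?_ _)
  exact (Set.ncard_le_ncard edgeSet_edge_subset (Set.toFinite _)).trans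
    (Set.ncard_singleton _).le

/-- A separation of order two whose sides both link the two vertices. -/
theorem MacLane.of_sup_edge (hsup : G = G₁ ⊔ G₂) (hdisj : Disjoint G₁.edgeSet G₂.edgeSet) {a b : V}
    (hcore : core G₁ ∩ core G₂ ⊆ {a, b}) (hab : a ≠ b) (h₁ : MacLane (G₁ ⊔ edge a b))
    (h₂ : MacLane (G₂ ⊔ edge a b)) : MacLane G := by
  classical
  have hK : MacLane (G₁ ⊔ (G₂ ⊔ edge a b)) := by
    refine MacLane.sup h₁ h₂ (e₀ := s(a, b)) (sup_le le_sup_left (le_sup_right.trans le_sup_right))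
      le_sup_right (fun z hz => ?_) fun e he he' => ?_
    · have hcore' : core G₁ ∩ core (G₂ ⊔ edge a b) ⊆ {a, b} := by
        rintro v ⟨h1, w, h | h⟩
        · exact hcore ⟨h1, w, h⟩
        · rw [edge_adj] at h
          exact h.1.imp And.left And.left
      obtain ⟨y, w, rfl, hy, hw, hyw, h0, -, hyab⟩ := exists_split hz hcore'
      set δ : Sym2 V → ZMod 2 := bd y a • Pi.single s(a, b) 1 with hδ
      have hδe : ∀ e, δ e ≠ 0 → e ∈ (edge a b).edgeSet := by
        intro e he
        rw [edgeSet_edge_of_ne hab]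
        by_contra hne
        exact he (by rw [hδ, Pi.smul_apply, Pi.single_eq_of_ne hne, smul_zero])
      have hδb : bd δ = bd y := by
        have h1 : bd δ = bd y a • bd (Pi.single s(a, b) 1 : Sym2 V → ZMod 2) := by
          ext v
          simp only [hδ, bd, Pi.smul_apply, Finset.smul_sum]
        rw [h1, bd_single hab]
        ext v
        simp only [Pi.smul_apply, Pi.add_apply, smul_eq_mul]
        by_cases hva : v = a
        · subst hva
          simp [hab]
        · by_cases hvb : v = b
          · subst hvb
            simp [hva, hyab]
          · simp [hva, hvb, h0 v hva hvb]
      have hmem : ∀ {F : SimpleGraph V} {x : Sym2 V → ZMod 2}, (∀ e, x e ≠ 0 → e ∈ F.edgeSet) →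
          edge a b ≤ F → bd x = bd y → x + δ ∈ cycleSpace F := by
        intro F x hx hF hxy
        refine ⟨fun e he => ?_, ?_⟩
        · by_cases hxe : x e = 0
          · exact edgeSet_mono hF (hδe e (by simpa [hxe] using he))
          · exact hx e hxe
        · ext v
          rw [bd_add, hδb, hxy]
          exact CharTwo.add_self_eq_zero _
      refine ⟨y + δ, hmem (fun e he => ?_) le_sup_right rfl, w + δ,
        hmem hw le_sup_right hyw.symm, ?_⟩
      · rw [SimpleGraph.edgeSet_sup]
        exact Or.inl (hy e he)
      · ext e
        simp only [Pi.add_apply]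
        linear_combination - CharTwo.add_self_eq_zero (δ e)
    · rw [SimpleGraph.edgeSet_sup, edgeSet_edge_of_ne hab] at he he'
      rcases he with he | he
      · rcases he' with he' | he'
        exacts [absurd he' (Set.disjoint_left.1 hdisj he), he']
      · exact he
  rw [← sup_assoc, ← hsup] at hK
  by_cases hadj : G.Adj a b
  · rwa [sup_eq_left.2 ((edge_le_iff G).2 (Or.inr hadj))] at hK
  · refine hK.of_deleteEdge le_sup_left (e := s(a, b)) (fun e he hne => ?_) hadj
    rw [SimpleGraph.edgeSet_sup, edgeSet_edge_of_ne hab] at he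
    exact he.resolve_right hne

/-- A separation whose sides do not both link the two vertices. -/
theorem MacLane.of_sup (hsup : G = G₁ ⊔ G₂) (hdisj : Disjoint G₁.edgeSet G₂.edgeSet) {a b : V}
    (hcore : core G₁ ∩ core G₂ ⊆ {a, b})
    (hab : ¬ (a ≠ b ∧ Linked G₁ Set.univ a b ∧ Linked G₂ Set.univ a b)) (h₁ : MacLane G₁)
    (h₂ : MacLane G₂) : MacLane G := by
  subst hsup
  refine MacLane.sup h₁ h₂ le_sup_left le_sup_right (e₀ := s(a, b)) (fun z hz => ?_)
    fun e he he' => absurd he' (Set.disjoint_left.1 hdisj he)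
  obtain ⟨y, w, rfl, hy, hw, hyw, h0, heq, hyab⟩ := exists_split hz hcore
  have hbd : bd y = 0 := by
    by_cases h : a = b
    · exact heq h
    have ha : bd y a = 0 := by
      by_cases hl : Linked G₁ Set.univ a b
      · rw [hyw]
        rw [hyw] at h0
        exact bd_eq_zero_of_not_linked hw h0 fun h' => hab ⟨h, hl, h'⟩
      · exact bd_eq_zero_of_not_linked hy h0 hl
    ext v
    by_cases hva : v = a
    · rw [hva, ha, Pi.zero_apply]
    · by_cases hvb : v = b
      · rw [hvb, ← hyab, ha, Pi.zero_apply]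
      · exact h0 v hva hvb
  exact ⟨y, ⟨hy, hbd⟩, w, ⟨hw, hyw ▸ hbd⟩, rfl⟩

end

variable {V : Type} [Fintype V] {G : SimpleGraph V}

/-- Mac Lane's theorem, from the exclusion of the two Kuratowski minors. -/
theorem _root_.IsPlanar.macLane (hG : IsPlanar G) : MacLane G := by
  induction hn : G.edgeSet.ncard using Nat.strong_induction_on generalizing G with
  | _ n ih =>
  subst hn
  by_cases h3 : ThreeConn G
  · exact h3.macLane hG
  obtain ⟨a, b, x, y, G₁, G₂, hsup, hdisj, hcore, hx, hy, hxa, hxb, hya, hyb⟩ :=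
    exists_separation h3
  have hcard : G.edgeSet.ncard = G₁.edgeSet.ncard + G₂.edgeSet.ncard := by
    rw [hsup, SimpleGraph.edgeSet_sup, Set.ncard_union_eq hdisj (Set.toFinite _) (Set.toFinite _)]
  have hle₁ : G₁ ≤ G := hsup ▸ le_sup_left
  have hle₂ : G₂ ≤ G := hsup ▸ le_sup_right
  by_cases hl : a ≠ b ∧ Linked G₁ Set.univ a b ∧ Linked G₂ Set.univ a b
  · obtain ⟨hab, hl₁, hl₂⟩ := hl
    have h1 := one_lt_ncard_edgeSet hx hxa hxb hab hl₁
    have h2 := one_lt_ncard_edgeSet hy hya hyb hab hl₂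
    have h4 := ncard_edgeSet_sup_edge_le (G := G₁) a b
    have h5 := ncard_edgeSet_sup_edge_le (G := G₂) a b
    refine MacLane.of_sup_edge hsup hdisj hcore hab
      (ih _ (by omega) (hG.sup_edge hab hle₁ hle₂ hl₂ hcore) rfl)
      (ih _ (by omega) (hG.sup_edge hab hle₂ hle₁ hl₁ ?_) rfl)
    rwa [Set.inter_comm]
  · have h1 := ncard_edgeSet_pos hx
    have h2 := ncard_edgeSet_pos hy
    exact MacLane.of_sup hsup hdisj hcore hl (ih _ (by omega) (hG.mono hle₁) rfl)
      (ih _ (by omega) (hG.mono hle₂) rfl)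

end PlanarDcol

theorem planar_dcol_four_le_76
    {V : Type} [Fintype V] (G : SimpleGraph V) (hG : IsPlanar G) :
    dcol G 4 ≤ 76 :=
  (IsPlanar.macLane hG).dcol_le
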